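/- arXiv:2003.11322 — 4 statements merged into one kernel-verified Lean document; each statement's English description precedes it below -/
import Mathlib

section
/- If a positive definite integral lattice L represents D_n imprimitively (the image of D_n under some representation is not a primitive sublattice of L), then L is isometric to I_n ⊥ N or to D_n[1] ⊥ N for some integral lattice N, where D_n[1] = D_n + ℤ[1] (which exists as an integral lattice only when 4 | n). -/
open Matrix

/-- Square integer matrices of size `n`, used as Gram matrices of lattices. -/
abbrev Mat (n : ℕ) := Matrix (Fin n) (Fin n) ℤ

/-- `G` is the Gram matrix of a positive definite integral lattice:
it is symmetric and `vᵀ G v > 0` for every nonzero integer vector `v`. -/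
def PosDefInt {n : ℕ} (G : Mat n) : Prop :=
  G.IsSymm ∧ ∀ v : Fin n → ℤ, v ≠ 0 → 0 < v ⬝ᵥ G.mulVec v

/-- The lattice with Gram matrix `L` represents the lattice with Gram matrix `N`:
there is an integral matrix `T` (whose rows are the coordinates of the images of
the basis vectors) with `T L Tᵀ = N`. -/
def Represents {m n : ℕ} (L : Mat m) (N : Mat n) : Prop :=
  ∃ T : Matrix (Fin n) (Fin m) ℤ, T * L * T.transpose = N

/-- Isometry of (positive definite) lattices, expressed as mutual representation. -/
def Isom {m n : ℕ} (A : Mat m) (B : Mat n) : Prop :=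
  Represents A B ∧ Represents B A

theorem Represents.rfl' {n : ℕ} (A : Mat n) : Represents A A :=
  ⟨1, by simp⟩

theorem Represents.trans' {a b c : ℕ} {A : Mat a} {B : Mat b} {C : Mat c}
    (h1 : Represents A B) (h2 : Represents B C) : Represents A C := by
  obtain ⟨T1, h1⟩ := h1
  obtain ⟨T2, h2⟩ := h2
  refine ⟨T2 * T1, ?_⟩
  rw [← h2, ← h1]
  simp [Matrix.mul_assoc, Matrix.transpose_mul]

/-- A positive definite integral lattice of rank `n`, given by a Gram matrix. -/
def QLat (n : ℕ) := {G : Mat n // PosDefInt G}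

instance latSetoid (n : ℕ) : Setoid (QLat n) where
  r A B := Isom A.1 B.1
  iseqv := ⟨fun A => ⟨Represents.rfl' _, Represents.rfl' _⟩,
    fun h => ⟨h.2, h.1⟩,
    fun h1 h2 => ⟨h1.1.trans' h2.1, h2.2.trans' h1.2⟩⟩

/-- Isometry classes of positive definite integral lattices of rank `n` (`Φ_n`). -/
def Cls (n : ℕ) := Quotient (latSetoid n)

/-- The isometry class of a lattice. -/
def cls {n : ℕ} (L : QLat n) : Cls n := Quotient.mk _ L

/-- A lattice represents an isometry class. -/
def RepCls {m n : ℕ} (L : QLat m) (c : Cls n) : Prop :=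
  ∃ N : QLat n, cls N = c ∧ Represents L.1 N.1

/-- The `n`-exceptional set of `L`: the classes of rank-`n` positive definite
integral lattices not represented by `L`. -/
def ExcSet (n : ℕ) {m : ℕ} (L : QLat m) : Set (Cls n) :=
  {c : Cls n | ¬ RepCls L c}
/-- Gram matrix of the orthogonal sum of two lattices. -/
def sumGram {a b : ℕ} (A : Mat a) (B : Mat b) : Mat (a + b) :=
  Matrix.reindex finSumFinEquiv finSumFinEquiv (Matrix.fromBlocks A 0 0 B)

/-- `L` primitively represents `N`: there is a representation whose image is a
primitive sublattice (equivalently, the coordinate matrix `T` has an integral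
right inverse). -/
def PrimRep {m n : ℕ} (L : Mat m) (N : Mat n) : Prop :=
  ∃ T : Matrix (Fin n) (Fin m) ℤ,
    T * L * T.transpose = N ∧ ∃ S : Matrix (Fin m) (Fin n) ℤ, T * S = 1

/-- Gram matrix of the root lattice `D_n` with respect to the basis
`b_0 = e_0 + e_1`, `b_j = e_{j-1} - e_j` for `1 ≤ j ≤ n-1`. -/
def Dgram (n : ℕ) : Mat n :=
  Matrix.of fun i j =>
    if i = j then 2
    else if ((i : ℕ) = 0 ∧ (j : ℕ) = 2) ∨ ((i : ℕ) = 2 ∧ (j : ℕ) = 0) then 1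
    else if (1 ≤ (i : ℕ) ∧ (i : ℕ) + 1 = (j : ℕ)) ∨ (1 ≤ (j : ℕ) ∧ (j : ℕ) + 1 = (i : ℕ)) then -1
    else 0


/-- Gram matrix of the unimodular lattice `D_n[1] = D_n + ℤ[1]` (for `4 ∣ n`),
with respect to the basis `b_0, …, b_{n-2}, [1]` where `[1] = (1/2, …, 1/2)`. -/
def Dn1gram (n : ℕ) : Mat n :=
  Matrix.of fun i j =>
    if hi : (i : ℕ) < n - 1 then
      if hj : (j : ℕ) < n - 1 then Dgram (n - 1) ⟨i, hi⟩ ⟨j, hj⟩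
      else if (i : ℕ) = 0 then 1 else 0
    else
      if hj : (j : ℕ) < n - 1 then (if (j : ℕ) = 0 then 1 else 0)
      else ((n / 4 : ℕ) : ℤ)


abbrev frm {m : ℕ} (L : Mat m) : LinearMap.BilinForm ℤ (Fin m → ℤ) := Matrix.toBilin' L

theorem frm_apply {m : ℕ} (L : Mat m) (x y : Fin m → ℤ) : frm L x y = x ⬝ᵥ L *ᵥ y := by
  simp [frm, Matrix.toBilin'_apply']

theorem gram_apply {m n k : ℕ} (L : Mat m) (U : Matrix (Fin n) (Fin m) ℤ)
    (V : Matrix (Fin k) (Fin m) ℤ) (i : Fin n) (j : Fin k) :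
    (U * L * V.transpose) i j = frm L (U i) (V j) := by
  rw [frm_apply, Matrix.mul_assoc, Matrix.mul_apply]
  simp [dotProduct, Matrix.mul_apply, Matrix.mulVec]

theorem nonprim {m n : ℕ} (T : Matrix (Fin n) (Fin m) ℤ) (hli : LinearIndependent ℤ (fun i => T i))
    (h : ¬ ∃ S : Matrix (Fin m) (Fin n) ℤ, T * S = 1) :
    ∃ (k : ℤ) (w : Fin m → ℤ), k ≠ 0 ∧ k • w ∈ Submodule.span ℤ (Set.range (fun i => T i)) ∧
      w ∉ Submodule.span ℤ (Set.range (fun i => T i)) := by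
  by_contra hc
  push Not at hc
  apply h
  set P := Submodule.span ℤ (Set.range (fun i => T i)) with hP
  have htf : Module.IsTorsionFree ℤ ((Fin m → ℤ) ⧸ P) := by
    rw [Module.isTorsionFree_iff_smul_eq_zero]
    intro k x hx
    obtain ⟨w, rfl⟩ := P.mkQ_surjective x
    by_cases hk : k = 0
    · exact Or.inl hk
    · right
      rw [← map_smul, Submodule.mkQ_apply, Submodule.Quotient.mk_eq_zero] at hx
      rw [Submodule.mkQ_apply, Submodule.Quotient.mk_eq_zero]
      exact hc k w hk hx
  have hfree : Module.Free ℤ ((Fin m → ℤ) ⧸ P) := inferInstance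
  obtain ⟨s, hs⟩ := Module.projective_lifting_property P.mkQ LinearMap.id P.mkQ_surjective
  have hmem : ∀ x, (LinearMap.id - s ∘ₗ P.mkQ : (Fin m → ℤ) →ₗ[ℤ] (Fin m → ℤ)) x ∈ P := by
    intro x
    rw [← Submodule.Quotient.mk_eq_zero, ← Submodule.mkQ_apply, LinearMap.sub_apply, map_sub]
    have := LinearMap.congr_fun hs (P.mkQ x)
    simp only [LinearMap.comp_apply, LinearMap.id_apply] at this ⊢
    rw [this, sub_self]
  let pr : (Fin m → ℤ) →ₗ[ℤ] P := LinearMap.codRestrict P _ hmem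
  let F : (Fin m → ℤ) →ₗ[ℤ] (Fin n →₀ ℤ) := hli.repr ∘ₗ pr
  have hF : ∀ j, F (T j) = Finsupp.single j 1 := by
    intro j
    have hj : T j ∈ P := Submodule.subset_span ⟨j, rfl⟩
    have : pr (T j) = ⟨T j, hj⟩ := by
      apply Subtype.ext
      have h0 : P.mkQ (T j) = 0 := by
        rw [Submodule.mkQ_apply, Submodule.Quotient.mk_eq_zero]; exact hj
      simp only [pr, LinearMap.codRestrict_apply, LinearMap.sub_apply, LinearMap.comp_apply, h0]
      simp
    show hli.repr (pr (T j)) = _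
    rw [this]
    exact hli.repr_eq_single j _ rfl
  refine ⟨Matrix.of fun i k => F (Pi.single i 1) k, ?_⟩
  ext j k
  have h1 : T j = ∑ i, T j i • (Pi.single i (1:ℤ) : Fin m → ℤ) := by
    ext a; simp [Finset.sum_apply, Pi.single_apply]
  have h2 := congrArg (fun v => v k) (hF j)
  rw [h1, map_sum] at h2
  simp only [map_smul, Finsupp.finsetSum_apply, Finsupp.smul_apply, smul_eq_mul] at h2
  rw [Matrix.mul_apply]
  simp only [Matrix.of_apply]
  rw [h2, Matrix.one_apply, Finsupp.single_apply]

theorem splitting {m n : ℕ} (L : Mat m) (hL : PosDefInt L) (A : Mat n) (U : Matrix (Fin n) (Fin m) ℤ)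
    (hU : ∀ i j, frm L (U i) (U j) = A i j)
    (hx : ∀ x : Fin m → ℤ, ∃ c : Fin n → ℤ, ∀ i, frm L (x - ∑ k, c k • U k) (U i) = 0) :
    ∃ (r : ℕ) (N : QLat r), Isom L (sumGram A N.1) := by
  have hsym : ∀ x y, frm L x y = frm L y x := by
    intro x y
    rw [frm_apply, frm_apply, Matrix.dotProduct_mulVec, ← Matrix.mulVec_transpose, hL.1.eq,
      dotProduct_comm]
  let K : Submodule ℤ (Fin m → ℤ) := ⨅ i, LinearMap.ker (LinearMap.flip (frm L) (U i))
  have hK : ∀ x, x ∈ K ↔ ∀ i, frm L x (U i) = 0 := by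
    intro x; simp [K, Submodule.mem_iInf]
  let b := Module.finBasis ℤ K
  let V : Matrix (Fin (Module.finrank ℤ K)) (Fin m) ℤ := Matrix.of fun i => (b i : Fin m → ℤ)
  have hV : ∀ i, V i = (b i : Fin m → ℤ) := fun i => rfl
  have hVU : ∀ i j, frm L (V i) (U j) = 0 := fun i j => (hK _).1 (b i).2 j
  have hN : PosDefInt (V * L * V.transpose) := by
    constructor
    · ext i j
      rw [Matrix.transpose_apply, gram_apply, gram_apply, hsym]
    · intro v hv
      have : v ⬝ᵥ (V * L * V.transpose) *ᵥ v = (v ᵥ* V) ⬝ᵥ L *ᵥ (v ᵥ* V) := by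
        rw [← Matrix.mulVec_mulVec, ← Matrix.mulVec_mulVec, Matrix.mulVec_transpose,
          Matrix.dotProduct_mulVec]
      rw [this]
      apply hL.2
      intro h0
      apply hv
      have h1 : ∑ i, v i • b i = 0 := by
        apply Subtype.ext
        rw [Matrix.vecMul_eq_sum] at h0
        simpa [hV] using h0
      funext i
      exact Fintype.linearIndependent_iff.1 b.linearIndependent v h1 i
  suffices hI : Isom L (sumGram A (V * L * V.transpose)) from ⟨_, ⟨_, hN⟩, hI⟩
  -- the stacked matrix
  let Z0 : Matrix (Fin n ⊕ Fin (Module.finrank ℤ K)) (Fin m) ℤ := Matrix.fromRows U V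
  let Z : Matrix (Fin (n + Module.finrank ℤ K)) (Fin m) ℤ := Z0.submatrix finSumFinEquiv.symm id
  have hZ0 : Z0 * L * Z0.transpose = Matrix.fromBlocks A 0 0 (V * L * V.transpose) := by
    have e1 : U * L * U.transpose = A := by ext i j; rw [gram_apply, hU]
    have e2 : V * L * U.transpose = 0 := by ext i j; rw [gram_apply, hVU]; rfl
    have e3 : U * L * V.transpose = 0 := by ext i j; rw [gram_apply, hsym, hVU]; rfl
    have e4 := Matrix.fromRows_mul_fromCols (U * L) (V * L) U.transpose V.transpose
    rw [e1, e2, e3] at e4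
    rw [← e4]
    simp only [Z0, Matrix.transpose_fromRows, Matrix.fromRows_mul]

  have hZ : Z * L * Z.transpose = sumGram A (V * L * V.transpose) := by
    unfold sumGram
    rw [← hZ0]
    ext i j
    simp [Z, Matrix.mul_apply, Matrix.reindex_apply]
  refine ⟨⟨Z, hZ⟩, ?_⟩
  choose c hc using hx
  let W1 : Matrix (Fin m) (Fin n) ℤ := Matrix.of fun a => c (Pi.single a 1)
  have hmem : ∀ a : Fin m, (Pi.single a 1 - ∑ k, W1 a k • U k : Fin m → ℤ) ∈ K := by
    intro a; rw [hK]; exact hc _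
  let W2 : Matrix (Fin m) (Fin (Module.finrank ℤ K)) ℤ :=
    Matrix.of fun a k => b.repr ⟨_, hmem a⟩ k
  have hW : Matrix.fromCols W1 W2 * Z0 = 1 := by
    rw [Matrix.fromCols_mul_fromRows]
    ext a d
    have h1 := congrArg Subtype.val (b.sum_repr ⟨_, hmem a⟩)
    have h2 := congrFun h1 d
    simp only [Submodule.coe_sum, Submodule.coe_smul, Finset.sum_apply, Pi.smul_apply,
      smul_eq_mul, Pi.sub_apply] at h2
    rw [Matrix.add_apply, Matrix.mul_apply, Matrix.mul_apply]
    have h3 : ∑ j, W2 a j * V j d = _ := h2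
    rw [h3, Matrix.one_apply, Pi.single_apply]
    simp [eq_comm]
  refine ⟨(Matrix.fromCols W1 W2).submatrix id finSumFinEquiv.symm, ?_⟩
  have hW' : (Matrix.fromCols W1 W2).submatrix id finSumFinEquiv.symm * Z = 1 := by
    simp only [Z]
    rw [Matrix.submatrix_mul_equiv, hW]
    simp
  rw [← hZ]
  generalize (Matrix.fromCols W1 W2).submatrix id finSumFinEquiv.symm = W at *
  calc W * (Z * L * Z.transpose) * W.transpose = (W * Z) * L * (W * Z).transpose := by
        simp only [Matrix.transpose_mul, Matrix.mul_assoc]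
    _ = L := by rw [hW']; simp

def Dfun (i j : ℕ) : ℤ :=
  if i = j then 2
    else if (i = 0 ∧ j = 2) ∨ (i = 2 ∧ j = 0) then 1
    else if (1 ≤ i ∧ i + 1 = j) ∨ (1 ≤ j ∧ j + 1 = i) then -1
    else 0

theorem Dgram_eq (n : ℕ) (i j : Fin n) : Dgram n i j = Dfun i j := by
  simp [Dgram, Dfun, Fin.ext_iff]

def Eseq {m : ℕ} (t : ℕ → Fin m → ℤ) : ℕ → Fin m → ℤ
  | 0 => t 0 + t 1
  | (j + 1) => Eseq t j - (2 : ℤ) • t (j + 1)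

def Efun (i j : ℕ) : ℤ :=
  if j = 0 then (if i ≤ 1 then 2 else 0)
  else if i + 1 = j then 2 else if i = j then -2 else 0

theorem Et {m n : ℕ} (hn : 4 ≤ n) (B : LinearMap.BilinForm ℤ (Fin m → ℤ)) (t : ℕ → Fin m → ℤ)
    (h : ∀ i j, i < n → j < n → B (t i) (t j) = Dfun i j) (i j : ℕ) (hi : i < n) (hj : j < n) :
    B (Eseq t i) (t j) = Efun i j := by
  induction i with
  | zero =>
    simp only [Eseq, map_add, LinearMap.add_apply]
    rw [h 0 j (by omega) hj, h 1 j (by omega) hj]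
    unfold Dfun Efun
    split_ifs <;> first | omega | grind
  | succ i ih =>
    simp only [Eseq, map_sub, LinearMap.sub_apply, map_smul, LinearMap.smul_apply, smul_eq_mul]
    rw [ih (by omega), h _ j hi hj]
    unfold Dfun Efun
    split_ifs <;> first | omega | grind

theorem EE {m n : ℕ} (hn : 4 ≤ n) (B : LinearMap.BilinForm ℤ (Fin m → ℤ)) (t : ℕ → Fin m → ℤ)
    (h : ∀ i j, i < n → j < n → B (t i) (t j) = Dfun i j) (i j : ℕ) (hi : i < n) (hj : j < n) :
    B (Eseq t i) (Eseq t j) = if i = j then 4 else 0 := by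
  induction j with
  | zero =>
    simp only [Eseq, map_add]
    rw [Et hn B t h i 0 hi (by omega), Et hn B t h i 1 hi (by omega)]
    unfold Efun
    split_ifs <;> first | omega | grind
  | succ j ih =>
    simp only [Eseq, map_sub, map_smul, smul_eq_mul]
    rw [ih (by omega), Et hn B t h i _ hi hj]
    unfold Efun
    split_ifs <;> first | omega | grind

theorem tli {m n : ℕ} (hn : 4 ≤ n) (B : LinearMap.BilinForm ℤ (Fin m → ℤ)) (t : ℕ → Fin m → ℤ)
    (h : ∀ i j, i < n → j < n → B (t i) (t j) = Dfun i j) :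
    LinearIndependent ℤ (fun i : Fin n => t i) := by
  rw [Fintype.linearIndependent_iff]
  intro x hx
  let y : ℕ → ℤ := fun j => if hj : j < n then x ⟨j, hj⟩ else 0
  have hy : ∀ i : Fin n, x i = y i := by intro i; simp [y]
  have hs : ∑ j ∈ Finset.range n, y j • t j = 0 := by
    rw [Finset.sum_range]; simpa [hy] using hx
  have hyn : y n = 0 := by simp [y]
  have key : ∀ i, i < n → ∑ j ∈ Finset.range n, y j * Efun i j = 0 := by
    intro i hi
    have := congrArg (B (Eseq t i)) hs
    rw [map_sum, map_zero] at this
    rw [← this]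
    apply Finset.sum_congr rfl
    intro j hj
    rw [map_smul, Et hn B t h i j hi (Finset.mem_range.1 hj), smul_eq_mul]
  have hE : ∀ i j, Efun i j = (if j = 0 then (if i ≤ 1 then 2 else 0) else 0)
     + (if j = i + 1 then 2 else 0) + (if j = i then (if i = 0 then 0 else -2) else 0) := by
    intro i j; unfold Efun; split_ifs <;> first | omega | grind
  have key2 : ∀ i, i < n → y 0 * (if i ≤ 1 then 2 else 0) + y (i+1) * 2 +
      y i * (if i = 0 then 0 else -2) = 0 := by
    intro i hi
    have := key i hi
    simp only [hE, mul_add, Finset.sum_add_distrib, mul_ite, mul_zero, Finset.sum_ite_eq',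
      Finset.mem_range, hi, if_true, show 0 < n by omega] at this ⊢
    by_cases h1 : i + 1 < n
    · simpa [h1] using this
    · have : i + 1 = n := by omega
      simp_all
  have h2 : ∀ k, k ≤ n - 2 → y (n - k) = 0 := by
    intro k
    induction k with
    | zero => intro _; simpa using hyn
    | succ k ih =>
      intro hk
      have := key2 (n - (k+1)) (by omega)
      rw [if_neg (by omega), if_neg (by omega), show n - (k+1) + 1 = n - k by omega,
        ih (by omega)] at this
      omega
  have h3 := key2 0 (by omega)
  have h4 := key2 1 (by omega)
  have h5 : y 2 = 0 := by
    have := h2 (n-2) (by omega)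
    rwa [show n - (n-2) = 2 by omega] at this
  simp at h3 h4
  intro i
  rw [hy]
  by_cases h0 : (i : ℕ) = 0
  · rw [h0]; omega
  by_cases h1 : (i : ℕ) = 1
  · rw [h1]; omega
  have := h2 (n - i) (by omega)
  rwa [show n - (n - (i : ℕ)) = i by omega] at this

theorem smul_cancel {m : ℕ} {k : ℤ} (hk : k ≠ 0) {x y : Fin m → ℤ} (h : k • x = k • y) : x = y :=
  smul_right_injective _ hk h

theorem frm_symm {m : ℕ} {L : Mat m} (hL : PosDefInt L) (x y : Fin m → ℤ) :
    frm L x y = frm L y x := by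
  rw [frm_apply, frm_apply, Matrix.dotProduct_mulVec, ← Matrix.mulVec_transpose, hL.1.eq,
    dotProduct_comm]

theorem exG {m : ℕ} (S : Submodule ℤ (Fin m → ℤ)) (E b : ℕ → Fin m → ℤ) (N : ℕ)
    (hb : ∀ j, j + 1 < N → b (j + 1) ∈ S)
    (hE : ∀ j, j + 1 < N → (2 : ℤ) • b (j + 1) = E j - E (j + 1)) :
    ∀ i, i < N → ∃ g ∈ S, (2 : ℤ) • g = E i - E 0 := by
  intro i
  induction i with
  | zero => intro _; exact ⟨0, S.zero_mem, by simp⟩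
  | succ i ih =>
    intro hi
    obtain ⟨g, hg, hg2⟩ := ih (by omega)
    refine ⟨g - b (i + 1), S.sub_mem hg (hb i hi), ?_⟩
    rw [smul_sub, hg2, hE i hi]
    abel

theorem combo {m : ℕ} (S : Submodule ℤ (Fin m → ℤ)) (E b : ℕ → Fin m → ℤ) (N : ℕ)
    (hb : ∀ j, j + 1 < N → b (j + 1) ∈ S)
    (hE : ∀ j, j + 1 < N → (2 : ℤ) • b (j + 1) = E j - E (j + 1)) (h0 : E 0 ∈ S)
    (d : ℕ → ℤ) (q r : ℤ) (hd : ∑ i ∈ Finset.range N, d i = 2 * q + r) :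
    ∃ u ∈ S, (2 : ℤ) • u + r • E 0 = ∑ i ∈ Finset.range N, d i • E i := by
  have hG := exG S E b N hb hE
  choose! g hgS hg using hG
  refine ⟨∑ i ∈ Finset.range N, d i • g i + q • E 0, ?_, ?_⟩
  · refine S.add_mem (S.sum_mem fun i hi => S.smul_mem _ (hgS i (Finset.mem_range.1 hi)))
      (S.smul_mem _ h0)
  · have h1 : (2 : ℤ) • ∑ i ∈ Finset.range N, d i • g i =
        ∑ i ∈ Finset.range N, d i • E i - (∑ i ∈ Finset.range N, d i) • E 0 := by
      rw [Finset.smul_sum, Finset.sum_smul, ← Finset.sum_sub_distrib]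
      apply Finset.sum_congr rfl
      intro i hi
      rw [smul_comm, hg i (Finset.mem_range.1 hi), smul_sub]
    rw [smul_add, h1, hd]
    module

theorem caseI {m n : ℕ} (L : Mat m) (hL : PosDefInt L) (e : ℕ → Fin m → ℤ)
    (he : ∀ i j, i < n → j < n → frm L (e i) (e j) = if i = j then 1 else 0) :
    ∃ (r : ℕ) (N : QLat r), Isom L (sumGram (1 : Mat n) N.1) := by
  have hU : ∀ i j : Fin n, frm L (e i) (e j) = (1 : Mat n) i j := by
    intro i j
    rw [he i j i.2 j.2, Matrix.one_apply]
    simp [Fin.ext_iff]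
  apply splitting L hL (1 : Mat n) (Matrix.of fun i => e i) hU
  intro x
  refine ⟨fun k => frm L x (e k), ?_⟩
  intro i
  have : ∀ k : Fin n, (Matrix.of fun i : Fin n => e i) k = e k := fun _ => rfl
  simp only [this, map_sub, map_sum, LinearMap.sub_apply, LinearMap.sum_apply, map_smul,
    LinearMap.smul_apply, hU, smul_eq_mul, Matrix.one_apply, mul_ite, mul_one, mul_zero]
  simp

theorem ar1 (X : ℤ) (i : ℕ) (h : 2 * X = (if i = 0 then 4 else 0) + (if i = 1 then 4 else 0)) :
    X = Efun i 0 := by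
  unfold Efun
  split_ifs at h ⊢ <;> first | omega | grind

theorem ar2 (X : ℤ) (i j : ℕ)
    (h : 2 * X = (if i = j then 4 else 0) - (if i = j + 1 then 4 else 0)) :
    X = Efun i (j + 1) := by
  unfold Efun
  split_ifs at h ⊢ <;> first | omega | grind

theorem ar3 (X : ℤ) (i : ℕ) (h : 2 * X = Efun 0 i + Efun 1 i) : X = Dfun i 0 := by
  unfold Efun at h
  unfold Dfun
  split_ifs at h ⊢ <;> first | omega | grind

theorem ar4 (X : ℤ) (i j : ℕ) (h : 2 * X = Efun j i - Efun (j + 1) i) : X = Dfun i (j + 1) := by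
  unfold Efun at h
  unfold Dfun
  split_ifs at h ⊢ <;> first | omega | grind

theorem caseII {m n : ℕ} (hn : 4 ≤ n) (L : Mat m) (hL : PosDefInt L) (E b : ℕ → Fin m → ℤ)
    (w : Fin m → ℤ)
    (hEE : ∀ i j, i < n → j < n → frm L (E i) (E j) = if i = j then 4 else 0)
    (hb0 : (2 : ℤ) • b 0 = E 0 + E 1)
    (hb : ∀ j, j + 1 < n → (2 : ℤ) • b (j + 1) = E j - E (j + 1))
    (hw : (4 : ℤ) • w = ∑ i ∈ Finset.range n, E i) :
    4 ∣ n ∧ ∃ (r : ℕ) (N : QLat r), Isom L (sumGram (Dn1gram n) N.1) := by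
  have hx0 : ∀ x, 2 * frm L x (b 0) = frm L x (E 0) + frm L x (E 1) := by
    intro x
    have := congrArg (frm L x) hb0
    simpa only [map_smul, map_add, smul_eq_mul] using this
  have hx1 : ∀ x j, j + 1 < n → 2 * frm L x (b (j+1)) = frm L x (E j) - frm L x (E (j+1)) := by
    intro x j hj
    have := congrArg (frm L x) (hb j hj)
    simpa only [map_smul, map_sub, smul_eq_mul] using this
  have hxw : ∀ x, 4 * frm L x w = ∑ i ∈ Finset.range n, frm L x (E i) := by
    intro x
    have := congrArg (frm L x) hw
    simpa only [map_smul, map_sum, smul_eq_mul] using this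
  have hEb : ∀ i j, i < n → j < n → frm L (E i) (b j) = Efun i j := by
    intro i j hi hj
    rcases j with _ | j
    · have := hx0 (E i)
      rw [hEE i 0 hi (by omega), hEE i 1 hi (by omega)] at this
      exact ar1 _ _ this
    · have := hx1 (E i) j hj
      rw [hEE i j hi (by omega), hEE i (j+1) hi (by omega)] at this
      exact ar2 _ _ _ this
  have hbb : ∀ i j, i < n → j < n → frm L (b i) (b j) = Dfun i j := by
    intro i j hi hj
    rcases j with _ | j
    · have := hx0 (b i)
      rw [frm_symm hL _ (E 0), frm_symm hL _ (E 1), hEb 0 i (by omega) hi,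
        hEb 1 i (by omega) hi] at this
      exact ar3 _ _ this
    · have := hx1 (b i) j hj
      rw [frm_symm hL _ (E j), frm_symm hL _ (E (j+1)), hEb j i (by omega) hi,
        hEb (j+1) i (by omega) hi] at this
      exact ar4 _ _ _ this
  have hEw : ∀ i, i < n → frm L (E i) w = 1 := by
    intro i hi
    have := hxw (E i)
    have h2 : ∑ j ∈ Finset.range n, frm L (E i) (E j) = 4 := by
      rw [Finset.sum_congr rfl (fun j hj => hEE i j hi (Finset.mem_range.1 hj))]
      simp [hi]
    omega
  have hww : 4 * frm L w w = n := by
    rw [hxw, Finset.sum_congr rfl (fun i hi => by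
      rw [frm_symm hL, hEw i (Finset.mem_range.1 hi)])]
    simp
  have hwb : ∀ j, j < n → frm L w (b j) = if j = 0 then 1 else 0 := by
    intro j hj
    rcases j with _ | j
    · have := hx0 w
      rw [frm_symm hL w (E 0), frm_symm hL w (E 1), hEw _ (by omega), hEw _ (by omega)] at this
      simp; omega
    · have := hx1 w j hj
      rw [frm_symm hL w (E j), frm_symm hL w (E (j+1)), hEw _ (by omega), hEw _ (by omega)] at this
      simp; omega
  have h4 : 4 ∣ n := by omega
  refine ⟨h4, ?_⟩
  let U : Matrix (Fin n) (Fin m) ℤ := Matrix.of fun i => if (i : ℕ) < n - 1 then b i else w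
  have hUi : ∀ i : Fin n, U i = if (i : ℕ) < n - 1 then b i else w := fun _ => rfl
  apply splitting L hL (Dn1gram n) U
  · intro i j
    rw [hUi, hUi]
    unfold Dn1gram
    simp only [Matrix.of_apply]
    by_cases hi : (i : ℕ) < n - 1 <;> by_cases hj : (j : ℕ) < n - 1
    · simp only [hi, hj, if_true, dif_pos]
      rw [hbb _ _ i.2 j.2, Dgram_eq]
    · simp only [hi, hj, if_true, if_false, dif_pos, dif_neg, not_false_eq_true]
      rw [frm_symm hL, hwb _ i.2]
    · simp only [hi, hj, if_true, if_false, dif_pos, dif_neg, not_false_eq_true]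
      rw [hwb _ j.2]
    · simp only [hi, hj, if_false, dif_neg, not_false_eq_true]
      omega
  · intro x
    set c : ℕ → ℤ := fun i => frm L x (E i) with hc
    set z := c (n - 1) with hz
    have hpar : ∀ i, i < n → ∃ p, c i = c 0 + 2 * p := by
      intro i
      induction i with
      | zero => intro _; exact ⟨0, by ring⟩
      | succ i ih =>
        intro hi
        obtain ⟨p, hp⟩ := ih (by omega)
        refine ⟨p - frm L x (b (i+1)), ?_⟩
        have := hx1 x i hi
        simp only [hc] at hp ⊢
        linarith
    have hd : ∀ i, i < n → ∃ d, c i = z + 2 * d := by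
      intro i hi
      obtain ⟨p, hp⟩ := hpar i hi
      obtain ⟨p', hp'⟩ := hpar (n-1) (by omega)
      exact ⟨p - p', by rw [hp, hz, hp']; ring⟩
    choose! d hd using hd
    set S := Submodule.span ℤ (Set.range (fun i => U i)) with hS
    have hbS : ∀ j, j < n - 1 → b j ∈ S := by
      intro j hj
      apply Submodule.subset_span
      refine ⟨⟨j, by omega⟩, ?_⟩
      simp only [hUi]; rw [if_pos hj]
    have hwS : w ∈ S := by
      apply Submodule.subset_span
      refine ⟨⟨n - 1, by omega⟩, ?_⟩
      simp only [hUi]; rw [if_neg (by simp)]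
    have hE0 : E 0 = b 0 + b 1 := by
      apply smul_cancel (two_ne_zero)
      rw [smul_add, hb0, hb 0 (by omega)]
      module
    have hE0S : E 0 ∈ S := by
      rw [hE0]; exact S.add_mem (hbS 0 (by omega)) (hbS 1 (by omega))
    obtain ⟨k, hk⟩ := h4
    have hsumd : ∑ i ∈ Finset.range (n-1), d i = 2 * (frm L x w - k * z) + 0 ∧ d (n-1) = 0 := by
      have h1 := hxw x
      have h2 := hd (n-1) (by omega)
      have h3 : ∑ i ∈ Finset.range n, frm L x (E i) = n * z + 2 * ∑ i ∈ Finset.range n, d i := by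
        rw [Finset.sum_congr rfl (fun i hi => hd i (Finset.mem_range.1 hi)),
          Finset.sum_add_distrib, ← Finset.mul_sum]
        simp
      have h5 : d (n-1) = 0 := by omega
      rw [h3, show n = (n - 1) + 1 by omega, Finset.sum_range_succ, h5] at h1
      refine ⟨?_, h5⟩
      have h6 : ((n - 1 + 1 : ℕ) : ℤ) = 4 * k := by omega
      rw [h6] at h1
      linarith
    obtain ⟨u1, hu1S, hu1⟩ := combo S E b (n-1) (fun j hj => hbS _ hj)
      (fun j hj => hb j (by omega)) hE0S d _ _ hsumd.1
    have hu : (4 : ℤ) • (u1 + z • w) = ∑ i ∈ Finset.range n, c i • E i := by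
      have e1 : ∑ i ∈ Finset.range n, c i • E i = z • ∑ i ∈ Finset.range n, E i +
          (2 : ℤ) • ∑ i ∈ Finset.range n, d i • E i := by
        rw [Finset.smul_sum, Finset.smul_sum, ← Finset.sum_add_distrib]
        apply Finset.sum_congr rfl
        intro i hi
        rw [hd i (Finset.mem_range.1 hi)]
        module
      have e2 : ∑ i ∈ Finset.range n, d i • E i = ∑ i ∈ Finset.range (n-1), d i • E i := by
        conv_lhs => rw [show n = (n - 1) + 1 by omega]
        rw [Finset.sum_range_succ, hsumd.2]
        simp
      rw [e1, e2, ← hu1, ← hw]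
      module
    have hmem : u1 + z • w ∈ S := S.add_mem hu1S (S.smul_mem _ hwS)
    obtain ⟨a, ha⟩ := (Submodule.mem_span_range_iff_exists_fun ℤ).1 hmem
    refine ⟨a, ?_⟩
    rw [ha]
    generalize hv : u1 + z • w = v at *
    have hvE : ∀ i, i < n → frm L (x - v) (E i) = 0 := by
      intro i hi
      have h1 := congrArg (fun y => frm L y (E i)) hu
      simp only [map_smul, LinearMap.smul_apply, map_sum, LinearMap.sum_apply, smul_eq_mul] at h1
      rw [Finset.sum_congr rfl (fun j hj => by rw [hEE j i (Finset.mem_range.1 hj) hi])] at h1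
      simp [hi] at h1
      rw [map_sub, LinearMap.sub_apply]
      simp only [hc] at h1
      linarith
    intro i
    rw [hUi]
    split_ifs with hi
    · rcases hi' : (i : ℕ) with _ | j
      · have := hx0 (x - v)
        rw [hvE 0 (by omega), hvE 1 (by omega)] at this
        omega
      · have := hx1 (x - v) j (by omega)
        rw [hvE j (by omega), hvE (j+1) (by omega)] at this
        omega
    · have := hxw (x - v)
      rw [Finset.sum_eq_zero (fun i hi => hvE i (Finset.mem_range.1 hi))] at this
      omega

/-- If a positive definite integral lattice `L` represents `D_n`
imprimitively, then `L ≅ I_n ⊥ N` or (only possible when `4 ∣ n`) `L ≅ D_n[1] ⊥ N`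
for some integral lattice `N`. -/
theorem imprimitive_Dn_rep (n m : ℕ) (hn : 4 ≤ n) (L : QLat m)
    (h : ∃ T : Matrix (Fin n) (Fin m) ℤ,
      T * L.1 * T.transpose = Dgram n ∧ ¬ ∃ S : Matrix (Fin m) (Fin n) ℤ, T * S = 1) :
    (∃ (r : ℕ) (N : QLat r), Isom L.1 (sumGram (1 : Mat n) N.1)) ∨
      (4 ∣ n ∧ ∃ (r : ℕ) (N : QLat r), Isom L.1 (sumGram (Dn1gram n) N.1)) := by
  obtain ⟨G, hG⟩ := L
  obtain ⟨T, hT, hTS⟩ := h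
  change T * G * T.transpose = Dgram n at hT
  change (∃ (r : ℕ) (N : QLat r), Isom G (sumGram (1 : Mat n) N.1)) ∨
      (4 ∣ n ∧ ∃ (r : ℕ) (N : QLat r), Isom G (sumGram (Dn1gram n) N.1))
  let t : ℕ → Fin m → ℤ := fun j => if hj : j < n then T ⟨j, hj⟩ else 0
  have htT : (fun i : Fin n => t i) = fun i => T i := by
    funext i; simp [t]
  have ht : ∀ i j, i < n → j < n → frm G (t i) (t j) = Dfun i j := by
    intro i j hi hj
    have h1 := gram_apply G T T ⟨i, hi⟩ ⟨j, hj⟩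
    rw [hT, Dgram_eq] at h1
    simp only [t, hi, hj, dif_pos]
    exact h1.symm
  have hli := tli hn (frm G) t ht
  rw [htT] at hli
  obtain ⟨k, w, hk, hkw, hwS⟩ := nonprim T hli hTS
  rw [← htT] at hkw hwS
  set S := Submodule.span ℤ (Set.range (fun i : Fin n => t i)) with hS
  set E := Eseq t with hEdef
  have hEE : ∀ i j, i < n → j < n → frm G (E i) (E j) = if i = j then 4 else 0 :=
    fun i j hi hj => EE hn (frm G) t ht i j hi hj
  have htS : ∀ j, j < n → t j ∈ S := fun j hj => Submodule.subset_span ⟨⟨j, hj⟩, rfl⟩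
  have hE0 : E 0 = t 0 + t 1 := rfl
  have hEs : ∀ j, E (j+1) = E j - (2 : ℤ) • t (j+1) := fun j => rfl
  have hES : ∀ i, i < n → E i ∈ S := by
    intro i
    induction i with
    | zero => intro _; rw [hE0]; exact S.add_mem (htS _ (by omega)) (htS _ (by omega))
    | succ i ih =>
      intro hi; rw [hEs]; exact S.sub_mem (ih (by omega)) (S.smul_mem _ (htS _ hi))
  have h2t0 : (2 : ℤ) • t 0 = E 0 + E 1 := by rw [hEs, hE0]; module
  have h2t : ∀ j, (2 : ℤ) • t (j+1) = E j - E (j+1) := by intro j; rw [hEs]; module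
  set c : ℕ → ℤ := fun i => frm G w (E i) with hc
  have h4w : (4 : ℤ) • w = ∑ i ∈ Finset.range n, c i • E i := by
    rw [← sub_eq_zero]
    set x := (4 : ℤ) • w - ∑ i ∈ Finset.range n, c i • E i with hx
    clear_value x
    have hxE : ∀ i, i < n → frm G x (E i) = 0 := by
      intro i hi
      rw [hx]
      simp only [map_sub, LinearMap.sub_apply, map_smul, LinearMap.smul_apply, map_sum,
        LinearMap.sum_apply, smul_eq_mul]
      rw [Finset.sum_congr rfl (fun j hj => by rw [hEE j i (Finset.mem_range.1 hj) hi])]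
      simp [hi, hc]
      ring
    have hxt : ∀ i, i < n → frm G x (t i) = 0 := by
      intro i hi
      rcases i with _ | i
      · have := congrArg (frm G x) h2t0
        rw [map_smul, map_add, hxE _ (by omega), hxE _ (by omega), smul_eq_mul] at this
        omega
      · have := congrArg (frm G x) (h2t i)
        rw [map_smul, map_sub, hxE _ (by omega), hxE _ (by omega), smul_eq_mul] at this
        omega
    have hxS : S ≤ LinearMap.ker (frm G x) := by
      rw [hS, Submodule.span_le]
      rintro _ ⟨i, rfl⟩
      exact hxt i i.2
    have hkx : k • x ∈ S := by
      rw [hx, smul_sub, smul_comm]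
      exact S.sub_mem (S.smul_mem _ hkw) (S.smul_mem _ (S.sum_mem fun i hi =>
        S.smul_mem _ (hES i (Finset.mem_range.1 hi))))
    have h0 : frm G x (k • x) = 0 := hxS hkx
    rw [map_smul, smul_eq_mul] at h0
    have h1 : frm G x x = 0 := by
      rcases mul_eq_zero.1 h0 with h | h
      · exact absurd h hk
      · exact h
    by_contra hne
    have h2 := hG.2 x hne
    rw [← frm_apply, h1] at h2
    exact lt_irrefl _ h2
  have hpar : ∀ i, i < n → ∃ p, c i = c 0 + 2 * p := by
    intro i
    induction i with
    | zero => intro _; exact ⟨0, by ring⟩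
    | succ i ih =>
      intro hi
      obtain ⟨p, hp⟩ := ih (by omega)
      refine ⟨p - frm G w (t (i+1)), ?_⟩
      have := congrArg (frm G w) (h2t i)
      rw [map_smul, map_sub, smul_eq_mul] at this
      simp only [hc] at hp ⊢
      linarith
  rcases Int.even_or_odd' (c 0) with ⟨c0, hc0 | hc0⟩
  · left
    have hd : ∀ i, i < n → ∃ d, c i = 2 * d := by
      intro i hi
      obtain ⟨p, hp⟩ := hpar i hi
      exact ⟨c0 + p, by rw [hp, hc0]; ring⟩
    choose! d hd using hd
    have h2w : (2 : ℤ) • w = ∑ i ∈ Finset.range n, d i • E i := by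
      apply smul_cancel (two_ne_zero)
      rw [smul_smul, Finset.smul_sum, show (2 : ℤ) * 2 = 4 by norm_num, h4w]
      apply Finset.sum_congr rfl
      intro i hi
      rw [hd i (Finset.mem_range.1 hi), mul_smul]
    have hcombo := combo S E t n (fun j hj => htS _ hj) (fun j _ => h2t j) (hES 0 (by omega)) d
    rcases Int.even_or_odd' (∑ i ∈ Finset.range n, d i) with ⟨q, hq | hq⟩
    · exfalso
      obtain ⟨u, huS, hu⟩ := hcombo q 0 (by rw [hq]; ring)
      rw [zero_smul, add_zero, ← h2w] at hu
      exact hwS (smul_cancel two_ne_zero hu ▸ huS)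
    · obtain ⟨u, huS, hu⟩ := hcombo q 1 hq
      rw [one_smul, ← h2w] at hu
      let e : ℕ → Fin m → ℤ := fun i => Nat.rec (w - u) (fun j v => v - t (j+1)) i
      have he : ∀ i, (2 : ℤ) • e i = E i := by
        intro i
        induction i with
        | zero =>
          show (2 : ℤ) • (w - u) = E 0
          rw [smul_sub, ← hu]; abel
        | succ i ih =>
          show (2 : ℤ) • (e i - t (i+1)) = E (i+1)
          rw [smul_sub, ih, hEs]
      apply caseI G hG e
      intro i j hi hj
      have h1 := hEE i j hi hj
      rw [← he, ← he] at h1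
      simp only [map_smul, LinearMap.smul_apply, smul_eq_mul] at h1
      split_ifs at h1 ⊢ <;> omega
  · right
    have hs : ∀ i, i < n → ∃ s q : ℤ, (s = 1 ∨ s = -1) ∧ c i = s + 4 * q := by
      intro i hi
      obtain ⟨p, hp⟩ := hpar i hi
      rcases Int.even_or_odd' (c0 + p) with ⟨r, hr | hr⟩
      · exact ⟨1, r, Or.inl rfl, by omega⟩
      · exact ⟨-1, r + 1, Or.inr rfl, by omega⟩
    choose! s q hs1 hs using hs
    have hdiff : ∀ j, j + 1 < n → ∃ a, s j - s (j+1) = 2 * a := by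
      intro j hj
      rcases hs1 j (by omega) with h | h <;> rcases hs1 (j+1) hj with h' | h' <;> rw [h, h']
      exacts [⟨0, by norm_num⟩, ⟨1, by norm_num⟩, ⟨-1, by norm_num⟩, ⟨0, by norm_num⟩]
    choose! a ha using hdiff
    let b : ℕ → Fin m → ℤ := fun i => Nat.casesOn i ((s 1 + a 0) • E 0 - s 1 • t 1)
      (fun j => a j • E j + s (j+1) • t (j+1))
    apply caseII hn G hG (fun i => s i • E i) b (w - ∑ i ∈ Finset.range n, q i • E i)
    · intro i j hi hj
      simp only [map_smul, LinearMap.smul_apply, smul_eq_mul]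
      rw [hEE i j hi hj]
      split_ifs with hij
      · subst hij
        rcases hs1 i hi with h | h <;> rw [h] <;> norm_num
      · simp
    · show (2 : ℤ) • ((s 1 + a 0) • E 0 - s 1 • t 1) = s 0 • E 0 + s 1 • E 1
      rw [hEs 0, show s 0 = s 1 + 2 * a 0 by have := ha 0 (by omega); simp at this; linarith]
      module
    · intro j hj
      show (2 : ℤ) • (a j • E j + s (j+1) • t (j+1)) = s j • E j - s (j+1) • E (j+1)
      rw [hEs j, show s j = s (j+1) + 2 * a j by have := ha j hj; linarith]
      module
    · rw [smul_sub, h4w, Finset.smul_sum, ← Finset.sum_sub_distrib]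
      apply Finset.sum_congr rfl
      intro i hi
      rw [hs i (Finset.mem_range.1 hi)]
      module
end

section
/- If a positive definite integral lattice L represents A₈ imprimitively, then L is isometric to E₈ ⊥ N for some integral lattice N. -/
open Matrix

/-- Gram matrix of the root lattice `A_n` with respect to the simple roots
`α_j = e_{j-1} - e_j`. -/
def Agram (n : ℕ) : Mat n :=
  Matrix.of fun i j =>
    if i = j then 2
    else if (i : ℕ) + 1 = (j : ℕ) ∨ (j : ℕ) + 1 = (i : ℕ) then -1
    else 0

/-- Gram matrix of the lattice `(A_n ⊥ ℤz) + ℤ([i] + z/(n+1))`, where `Q(z) = k(n+1)`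
and `q = (i(n+1-i) + k)/(n+1)` is the norm of the glued vector `[i] + z/(n+1)`:
the Cartan matrix of `A_n` bordered by the row/column `B(α_j, [i]) = δ_{j, n+1-i}`
with corner entry `q`. -/
def AGlue (n i : ℕ) (q : ℤ) : Mat (n + 1) :=
  Matrix.of fun r c =>
    if hr : (r : ℕ) < n then
      if hc : (c : ℕ) < n then Agram n ⟨r, hr⟩ ⟨c, hc⟩
      else if (r : ℕ) = n - i then 1 else 0
    else
      if hc : (c : ℕ) < n then (if (c : ℕ) = n - i then 1 else 0)
      else q


/-- Gram matrix of the root lattice `E₈` (Cartan matrix, Bourbaki numbering). -/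
def E8gram : Mat 8 :=
  !![2, 0, -1, 0, 0, 0, 0, 0;
     0, 2, 0, -1, 0, 0, 0, 0;
     -1, 0, 2, -1, 0, 0, 0, 0;
     0, -1, -1, 2, -1, 0, 0, 0;
     0, 0, 0, -1, 2, -1, 0, 0;
     0, 0, 0, 0, -1, 2, -1, 0;
     0, 0, 0, 0, 0, -1, 2, -1;
     0, 0, 0, 0, 0, 0, -1, 2]


/-- Partial inverse of `Agram 8`. -/
def auxC : Mat 8 :=
  !![0, 0, 0, 0, 0, 0, 0, 0;
     -1, 0, 0, 0, 0, 0, 0, 0;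
     -2, -1, 0, 0, 0, 0, 0, 0;
     -3, -2, -1, 0, 0, 0, 0, 0;
     -4, -3, -2, -1, 0, 0, 0, 0;
     -5, -4, -3, -2, -1, 0, 0, 0;
     -6, -5, -4, -3, -2, -1, 0, 0;
     -7, -6, -5, -4, -3, -2, -1, 0]

/-- Inverse of `E8gram`. -/
def auxE8inv : Mat 8 :=
  !![4, 5, 7, 10, 8, 6, 4, 2;
     5, 8, 10, 15, 12, 9, 6, 3;
     7, 10, 14, 20, 16, 12, 8, 4;
     10, 15, 20, 30, 24, 18, 12, 6;
     8, 12, 16, 24, 20, 15, 10, 5;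
     6, 9, 12, 18, 15, 12, 8, 4;
     4, 6, 8, 12, 10, 8, 6, 3;
     2, 3, 4, 6, 5, 4, 3, 2]

/-- Three times the simple roots of `E₈` in terms of the simple roots of `A₈`. -/
def auxM : Mat 8 :=
  !![3, 0, 0, 0, 0, 0, 0, 0;
     -2, -4, -6, -5, -4, -3, -2, -1;
     0, 3, 0, 0, 0, 0, 0, 0;
     0, 0, 3, 0, 0, 0, 0, 0;
     0, 0, 0, 3, 0, 0, 0, 0;
     0, 0, 0, 0, 3, 0, 0, 0;
     0, 0, 0, 0, 0, 3, 0, 0;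
     0, 0, 0, 0, 0, 0, 3, 0]

/-- The functional generating the dual quotient. -/
def auxU : Matrix (Fin 1) (Fin 8) ℤ := !![8, 7, 6, 5, 4, 3, 2, 1]

/-- The last basis vector. -/
def auxE : Matrix (Fin 8) (Fin 1) ℤ := !![0; 0; 0; 0; 0; 0; 0; 1]

/-- Solution of `A z = 9 e`. -/
def auxZ : Matrix (Fin 8) (Fin 1) ℤ := !![1; 2; 3; 4; 5; 6; 7; 8]

theorem aux_AC : Agram 8 * auxC + auxE * auxU = 1 := by decide +kernel

theorem aux_Az : Agram 8 * auxZ = (9 : ℤ) • auxE := by decide +kernel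

theorem aux_E8 : E8gram * auxE8inv = 1 := by decide +kernel

theorem aux_E8symm : E8gramᵀ = E8gram := by decide +kernel

theorem aux_M : auxM * Agram 8 * auxMᵀ = (9 : ℤ) • E8gram := by decide +kernel

/-- If `u T` has an entry prime to 3, then `T` has a right inverse. -/
theorem aux_right_inv {m : ℕ} (L : Mat m) (T : Matrix (Fin 8) (Fin m) ℤ)
    (hT : T * L * Tᵀ = Agram 8) (j : Fin m) (hj : ¬ (3 : ℤ) ∣ (auxU * T) 0 j) :
    ∃ S : Matrix (Fin m) (Fin 8) ℤ, T * S = 1 := by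
  obtain ⟨d, hd⟩ : ∃ d, (auxU * T) 0 j = d := ⟨_, rfl⟩
  rw [hd] at hj
  have hcop : IsCoprime d 9 := by
    have h3 : IsCoprime (3 : ℤ) d := (Int.prime_three.coprime_iff_not_dvd).2 hj
    have := (h3.symm).mul_right h3.symm
    norm_num at this
    exact this
  obtain ⟨a, b, hab⟩ := hcop
  let f : Matrix (Fin m) (Fin 1) ℤ := Matrix.of fun i _ => if i = j then 1 else 0
  have hf : auxU * (T * f) = d • (1 : Matrix (Fin 1) (Fin 1) ℤ) := by
    ext p q
    fin_cases p
    fin_cases q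
    rw [← Matrix.mul_assoc]
    simp [Matrix.mul_apply, f]
    simpa [Matrix.mul_apply] using hd
  have hy : T * f - Agram 8 * (auxC * (T * f)) = d • auxE := by
    have : Agram 8 * (auxC * (T * f)) + auxE * (auxU * (T * f)) = T * f := by
      rw [← Matrix.mul_assoc (Agram 8), ← Matrix.mul_assoc auxE, ← Matrix.add_mul, aux_AC,
        Matrix.one_mul]
    rw [hf, Matrix.mul_smul, Matrix.mul_one] at this
    rw [sub_eq_iff_eq_add']
    exact this.symm
  let s : Matrix (Fin m) (Fin 1) ℤ :=
    a • (f - L * (Tᵀ * (auxC * (T * f)))) + b • (L * (Tᵀ * auxZ))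
  have hA : ∀ {k : ℕ} (X : Matrix (Fin 8) (Fin k) ℤ), T * (L * (Tᵀ * X)) = Agram 8 * X := by
    intro k X
    rw [← hT]
    simp only [Matrix.mul_assoc]
  have hs : T * s = auxE := by
    simp only [s, Matrix.mul_add, Matrix.mul_smul, Matrix.mul_sub, hA]
    rw [hy, aux_Az, smul_smul, smul_smul, ← add_smul, hab, one_smul]
  refine ⟨L * (Tᵀ * auxC) + s * auxU, ?_⟩
  rw [Matrix.mul_add, hA, ← Matrix.mul_assoc, hs, aux_AC]

/-- If `u T` is divisible by 3, then `L` represents `E₈`. -/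
theorem aux_E8_rep {m : ℕ} (L : Mat m) (T : Matrix (Fin 8) (Fin m) ℤ)
    (hT : T * L * Tᵀ = Agram 8) (h : ∀ j, (3 : ℤ) ∣ (auxU * T) 0 j) :
    ∃ R : Matrix (Fin 8) (Fin m) ℤ, R * L * Rᵀ = E8gram := by
  have hdvd : ∀ i j, (3 : ℤ) ∣ (auxM * T) i j := by
    intro i j
    have hj := h j
    simp [Matrix.mul_apply, Fin.sum_univ_eight, auxU] at hj
    fin_cases i <;> simp [Matrix.mul_apply, Fin.sum_univ_eight, auxM]
    omega
  choose R hR using hdvd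
  have hRM : (3 : ℤ) • (Matrix.of R) = auxM * T := by
    ext i j
    simp [hR i j]
  refine ⟨Matrix.of R, ?_⟩
  have h9 : (9 : ℤ) • (Matrix.of R * L * (Matrix.of R)ᵀ) = (9 : ℤ) • E8gram := by
    have h1 : (9 : ℤ) • (Matrix.of R * L * (Matrix.of R)ᵀ)
        = ((3 : ℤ) • Matrix.of R) * L * ((3 : ℤ) • Matrix.of R)ᵀ := by
      simp only [Matrix.transpose_smul, Matrix.smul_mul, Matrix.mul_smul, smul_smul]
      norm_num
    rw [h1, hRM, ← aux_M, ← hT, Matrix.transpose_mul]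
    simp only [Matrix.mul_assoc]
  ext i j
  have := congrFun (congrFun h9 i) j
  simp only [Matrix.smul_apply, smul_eq_mul] at this
  omega

/-- A sublattice isometric to `E₈` splits. -/
theorem aux_split {m : ℕ} (L : QLat m) (R : Matrix (Fin 8) (Fin m) ℤ)
    (hR : R * L.1 * Rᵀ = E8gram) :
    ∃ (r : ℕ) (N : QLat r), Isom L.1 (sumGram E8gram N.1) := by
  obtain ⟨L, hsymm, hpos⟩ := L
  simp only at hR
  have hLt : Lᵀ = L := hsymm
  let K : Submodule ℤ (Fin m → ℤ) := LinearMap.ker (R * L).mulVecLin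
  let bK := Module.finBasis ℤ K
  let r := Module.finrank ℤ K
  let B : Matrix (Fin r) (Fin m) ℤ := Matrix.of fun i => (bK i : Fin m → ℤ)
  have hRB : R * L * Bᵀ = 0 := by
    ext i k
    have := (bK k).2
    rw [LinearMap.mem_ker] at this
    exact congrFun this i
  have hBR : B * L * Rᵀ = 0 := by
    have := congrArg Matrix.transpose hRB
    simpa [Matrix.transpose_mul, hLt, Matrix.mul_assoc] using this
  -- the orthogonal complement is positive definite
  have hvB : ∀ v : Fin r → ℤ, v ᵥ* B = ((∑ i, v i • bK i : K) : Fin m → ℤ) := by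
    intro v
    ext j
    simp [Matrix.vecMul, dotProduct, B]
  have hN : PosDefInt (B * L * Bᵀ) := by
    refine ⟨?_, ?_⟩
    · unfold Matrix.IsSymm
      simp [Matrix.transpose_mul, hLt, Matrix.mul_assoc]
    · intro v hv
      have hne : v ᵥ* B ≠ 0 := by
        intro h0
        apply hv
        rw [hvB] at h0
        have h1 : (∑ i, v i • bK i : K) = 0 := Subtype.ext h0
        funext i
        exact Fintype.linearIndependent_iff.1 bK.linearIndependent v h1 i
      have := hpos _ hne
      rwa [← Matrix.mulVec_mulVec, ← Matrix.mulVec_mulVec, Matrix.dotProduct_mulVec,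
        Matrix.mulVec_transpose]
  let a : Matrix (Fin m) (Fin 8) ℤ := L * Rᵀ * auxE8invᵀ
  let W : Mat m := 1 - a * R
  have hW : R * L * Wᵀ = 0 := by
    have : R * L * (a * R)ᵀ = (R * L * Rᵀ) * auxE8inv * (R * L) := by
      simp only [a, Matrix.transpose_mul, Matrix.transpose_transpose, hLt, Matrix.mul_assoc]
    simp only [W, Matrix.transpose_sub, Matrix.transpose_one, Matrix.mul_sub, Matrix.mul_one]
    rw [this, hR, aux_E8, Matrix.one_mul, sub_self]
  have hWK : ∀ i, W i ∈ K := by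
    intro i
    rw [LinearMap.mem_ker]
    funext k
    exact congrFun (congrFun hW k) i
  let c : Matrix (Fin m) (Fin r) ℤ := Matrix.of fun i k => bK.repr ⟨W i, hWK i⟩ k
  have hcB : c * B = W := by
    funext i
    have h1 : (c * B) i = c i ᵥ* B := rfl
    rw [h1, hvB]
    have := bK.sum_repr ⟨W i, hWK i⟩
    exact congrArg Subtype.val this
  have hone : a * R + c * B = 1 := by
    rw [hcB]; simp [W]
  refine ⟨r, ⟨B * L * Bᵀ, hN⟩, ?_⟩
  let e := (finSumFinEquiv : Fin 8 ⊕ Fin r ≃ Fin (8 + r))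
  let P : Matrix (Fin (8 + r)) (Fin m) ℤ := Matrix.reindex e (Equiv.refl _) (Matrix.fromRows R B)
  let U : Matrix (Fin m) (Fin (8 + r)) ℤ := Matrix.reindex (Equiv.refl _) e (Matrix.fromCols a c)
  have hP : P * L * Pᵀ = sumGram E8gram (B * L * Bᵀ) := by
    have h1 : Matrix.fromRows R B * L * (Matrix.fromRows R B)ᵀ
        = Matrix.fromBlocks E8gram 0 0 (B * L * Bᵀ) := by
      rw [Matrix.fromRows_mul, Matrix.transpose_fromRows, Matrix.fromRows_mul_fromCols,
        hR, hRB, hBR]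
    unfold sumGram
    rw [← h1]
    rfl
  have hU : U * P = 1 := by
    have h1 : U * P = Matrix.fromCols a c * Matrix.fromRows R B := by
      simp only [U, P, Matrix.reindex_apply]
      rw [Matrix.submatrix_mul_equiv]
      rfl
    rw [h1, Matrix.fromCols_mul_fromRows, hone]
  refine ⟨⟨P, hP⟩, ⟨U, ?_⟩⟩
  change U * sumGram E8gram (B * L * Bᵀ) * Uᵀ = L
  have h2 : U * (P * L * Pᵀ) * Uᵀ = (U * P) * L * (U * P)ᵀ := by
    simp only [Matrix.transpose_mul, Matrix.mul_assoc]
  rw [← hP, h2, hU]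
  simp

/-- If a positive definite integral lattice `L` represents `A₈`
imprimitively, then `L ≅ E₈ ⊥ N` for some integral lattice `N`. -/
theorem imprimitive_A8_rep (m : ℕ) (L : QLat m)
    (h : ∃ T : Matrix (Fin 8) (Fin m) ℤ,
      T * L.1 * T.transpose = Agram 8 ∧ ¬ ∃ S : Matrix (Fin m) (Fin 8) ℤ, T * S = 1) :
    ∃ (r : ℕ) (N : QLat r), Isom L.1 (sumGram E8gram N.1) := by
  obtain ⟨T, hT, hS⟩ := h
  have h3 : ∀ j, (3 : ℤ) ∣ (auxU * T) 0 j := by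
    intro j
    by_contra hj
    exact hS (aux_right_inv L.1 T hT j hj)
  obtain ⟨R, hR⟩ := aux_E8_rep L.1 T hT h3
  exact aux_split L R hR
end

section
/- Let L_i = (A_n ⊥ ℤz) + ℤ([i] + z/(n+1)) with Q(z) = k(n+1), and L_j = (A_n ⊥ ℤw) + ℤ([j] + w/(n+1)) with Q(w) = ℓ(n+1), where 0 ≤ i, j ≤ ⌊(n+1)/2⌋, and suppose both L_i and L_j have root sublattice exactly A_n. Then L_i is represented by L_j if and only if there exists a positive integer t with jt ≡ ±i (mod n+1) and k = ℓt². -/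
open Matrix

/-- The glue functional. -/
def gF (n i : ℕ) : Fin n → ℤ := fun r => if (r : ℕ) = n - i then 1 else 0

/-- Scaled coordinates of the fundamental weight, as a function on naturals. -/
def gG (n i : ℕ) (x : ℕ) : ℤ :=
  if x ≤ n + 1 - i then (x : ℤ) * i else ((n : ℤ) + 1 - i) * ((n : ℤ) + 1 - x)

/-- Scaled coordinates of the fundamental weight. -/
def gP (n i : ℕ) : Fin n → ℤ := fun r => gG n i (r + 1)

theorem Agram_symm (n : ℕ) : (Agram n)ᵀ = Agram n := by
  ext a b
  simp only [Agram, transpose_apply, of_apply]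
  have : b = a ↔ a = b := eq_comm
  simp only [this, or_comm]

theorem Agram_mulVec (n : ℕ) (g : ℕ → ℤ) (h0 : g 0 = 0) (h1 : g (n + 1) = 0) (r : Fin n) :
    ((Agram n).mulVec (fun c : Fin n => g (c + 1))) r = 2 * g (r + 1) - g r - g (r + 2) := by
  have key : ∀ c : Fin n, Agram n r c * g (c + 1) =
      (if (r : ℕ) = c then 2 * g (c + 1) else 0) - (if (r : ℕ) = c + 1 then g (c + 1) else 0)
        - (if (r : ℕ) + 1 = c then g (c + 1) else 0) := by
    intro c
    simp only [Agram, of_apply, Fin.ext_iff]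
    split_ifs <;> first | omega | ring
  simp only [mulVec, dotProduct]
  rw [Finset.sum_congr rfl (fun c _ => key c), Finset.sum_sub_distrib, Finset.sum_sub_distrib]
  rw [Fin.sum_univ_eq_sum_range (fun c => if (r : ℕ) = c then 2 * g (c + 1) else 0),
    Fin.sum_univ_eq_sum_range (fun c => if (r : ℕ) = c + 1 then g (c + 1) else 0),
    Fin.sum_univ_eq_sum_range (fun c => if (r : ℕ) + 1 = c then g (c + 1) else 0)]
  have hr := r.2
  congr 1
  · congr 1
    · simp
    · rcases Nat.eq_zero_or_pos (r : ℕ) with h | h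
      · simp [h, h0]
      · obtain ⟨s, hs⟩ := Nat.exists_eq_succ_of_ne_zero h.ne'
        rw [hs]
        simp only [Nat.succ_eq_add_one, add_left_inj]
        rw [Finset.sum_ite_eq, if_pos (by simp; omega)]
  · rw [Finset.sum_ite_eq]
    split_ifs with h
    · rfl
    · have : (r : ℕ) + 2 = n + 1 := by simp at h; omega
      rw [this, h1]

theorem Agram_gP (n i : ℕ) (hi : i ≤ n) :
    (Agram n).mulVec (gP n i) = ((n : ℤ) + 1) • gF n i := by
  ext r
  have hr := r.2
  unfold gP
  rw [Agram_mulVec n (gG n i)]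
  · obtain ⟨m, hm⟩ := Nat.exists_eq_add_of_le (show i ≤ n + 1 by omega)
    have hm' : n + 1 - i = m := by omega
    have hm2 : (n : ℤ) + 1 = i + m := by exact_mod_cast hm
    simp only [gG, gF, hm', Pi.smul_apply, smul_eq_mul, hm2]
    rcases lt_trichotomy ((r : ℕ) + 1) m with h | h | h
    · rw [if_pos (by omega), if_pos (by omega), if_pos (by omega), if_neg (by omega)]
      push_cast; ring
    · rw [if_pos (by omega), if_pos (by omega), if_neg (by omega), if_pos (by omega)]
      have : (r : ℤ) + 1 = m := by exact_mod_cast h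
      push_cast; rw [← this]; ring
    · by_cases h2 : (r : ℕ) ≤ m
      · have : (r : ℕ) = m := by omega
        rw [if_neg (by omega), if_pos h2, if_neg (by omega), if_neg (by omega)]
        push_cast; rw [this]; ring
      · rw [if_neg (by omega), if_neg h2, if_neg (by omega), if_neg (by omega)]
        push_cast; ring
  · simp [gG]
  · simp only [gG]
    split_ifs with h
    · have : i = 0 := by omega
      simp [this]
    · push_cast; ring

theorem gP_cong (n i : ℕ) (r : Fin n) :
    ((n : ℤ) + 1) ∣ gP n i r - i * ((r : ℤ) + 1) := by
  simp only [gP, gG]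
  split_ifs
  · push_cast; ring_nf; simp
  · push_cast
    exact ⟨(n : ℤ) + 1 - i - r - 1, by ring⟩

theorem gP_gF (n i : ℕ) (hi : i ≤ (n + 1) / 2) (hn : 0 < n) :
    gP n i ⬝ᵥ gF n i = (i : ℤ) * ((n : ℤ) + 1 - i) := by
  simp only [gF, dotProduct]
  rcases Nat.eq_zero_or_pos i with h | h
  · subst h
    rw [Finset.sum_eq_zero]
    · simp
    · intro r _
      rw [if_neg (by have := r.2; omega)]; simp
  · rw [Finset.sum_eq_single (⟨n - i, by omega⟩ : Fin n)]
    · simp only [gP, gG]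
      rw [if_pos (by omega)]
      push_cast [Nat.cast_sub (show i ≤ n by omega)]
      simp
      ring
    · intro b _ hb
      rw [if_neg (by intro hh; exact hb (Fin.ext hh))]; simp
    · simp

theorem Agram_bil_comm (n : ℕ) (x y : Fin n → ℤ) :
    x ⬝ᵥ (Agram n).mulVec y = y ⬝ᵥ (Agram n).mulVec x := by
  rw [dotProduct_mulVec, ← mulVec_transpose, Agram_symm, dotProduct_comm]

theorem gP_gF_comm (n i j : ℕ) (hi : i ≤ n) (hj : j ≤ n) :
    gP n i ⬝ᵥ gF n j = gP n j ⬝ᵥ gF n i := by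
  have h := Agram_bil_comm n (gP n i) (gP n j)
  rw [Agram_gP n i hi, Agram_gP n j hj, dotProduct_smul, dotProduct_smul] at h
  have hn : ((n : ℤ) + 1) ≠ 0 := by positivity
  simpa [hn] using h

theorem Agram_det_ne (n : ℕ) : (Agram n).det ≠ 0 := by
  intro h
  let P : Mat n := Matrix.of fun c r => gP n (n - r) c
  have hP : Agram n * P = ((n : ℤ) + 1) • (1 : Mat n) := by
    ext a b
    have := congrFun (Agram_gP n (n - b) (by omega)) a
    have e : (Agram n * P) a b = ((Agram n).mulVec (gP n (n - b))) a := rfl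
    rw [e, this]
    have hb := b.2
    simp only [gF, Pi.smul_apply, Matrix.smul_apply, Matrix.one_apply, Fin.ext_iff]
    have : n - (n - (b : ℕ)) = b := by omega
    rw [this]
  have h2 := congrArg Matrix.det hP
  rw [det_mul, h, det_smul, det_one] at h2
  have : ((n : ℤ) + 1) ≠ 0 := by positivity
  simp at h2
  exact pow_ne_zero n this h2.symm

theorem AGlue_bil (n i : ℕ) (q : ℤ) (x y : Fin (n + 1) → ℤ) :
    x ⬝ᵥ (AGlue n i q).mulVec y =
      Fin.init x ⬝ᵥ (Agram n).mulVec (Fin.init y) + x (Fin.last n) * (Fin.init y ⬝ᵥ gF n i)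
      + y (Fin.last n) * (Fin.init x ⬝ᵥ gF n i) + x (Fin.last n) * y (Fin.last n) * q := by
  have e1 : ∀ a b : Fin n, AGlue n i q a.castSucc b.castSucc = Agram n a b := by
    intro a b; simp [AGlue]
  have e2 : ∀ a : Fin n, AGlue n i q a.castSucc (Fin.last n) = gF n i a := by
    intro a; simp [AGlue, gF]
  have e3 : ∀ a : Fin n, AGlue n i q (Fin.last n) a.castSucc = gF n i a := by
    intro a; simp [AGlue, gF]
  have e4 : AGlue n i q (Fin.last n) (Fin.last n) = q := by simp [AGlue]
  simp only [dotProduct, mulVec, Fin.sum_univ_castSucc, e1, e2, e3, e4, Fin.init]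
  simp only [mul_add, Finset.sum_add_distrib, Finset.mul_sum]
  have : ∀ a : Fin n, x a.castSucc * (gF n i a * y (Fin.last n))
    = y (Fin.last n) * (x a.castSucc * gF n i a) := fun a => by ring
  simp only [this]
  have : ∀ a : Fin n, x (Fin.last n) * (gF n i a * y a.castSucc)
    = x (Fin.last n) * (y a.castSucc * gF n i a) := fun a => by ring
  simp only [this]
  ring

theorem rep_iff {m n : ℕ} (L : Mat m) (N : Mat n) (T : Matrix (Fin n) (Fin m) ℤ) :
    T * L * Tᵀ = N ↔ ∀ a b, T a ⬝ᵥ L.mulVec (T b) = N a b := by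
  rw [← Matrix.ext_iff]
  refine forall_congr' fun a => forall_congr' fun b => ?_
  rw [dotProduct_mulVec]
  rfl

/-- The simple roots in the standard coordinates. -/
def rE (n : ℕ) : Matrix (Fin n) (Fin (n + 1)) ℤ :=
  Matrix.of fun r => Pi.single r.castSucc 1 - Pi.single r.succ 1

theorem rE_mulVec (n : ℕ) (y : Fin (n + 1) → ℤ) (r : Fin n) :
    (rE n).mulVec y r = y r.castSucc - y r.succ := by
  change (Pi.single r.castSucc 1 - Pi.single r.succ 1 : Fin (n + 1) → ℤ) ⬝ᵥ y = _
  rw [sub_dotProduct, single_dotProduct, single_dotProduct]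
  ring

theorem rE_gram (n : ℕ) : rE n * (rE n)ᵀ = Agram n := by
  ext a b
  have : (rE n * (rE n)ᵀ) a b = (rE n).mulVec (rE n b) a := rfl
  rw [this, rE_mulVec]
  simp only [rE, of_apply, Pi.sub_apply, Pi.single_apply, Agram, Fin.ext_iff, Fin.val_castSucc,
    Fin.val_succ]
  split_ifs <;> first | omega | rfl

/-- Automorphisms of the root lattice act as `±1` on the discriminant group. -/
theorem key_sign (n : ℕ) (hn : 0 < n) (w : Fin n → ℤ)
    (hw : ∀ r, ((n : ℤ) + 1) ∣ (Agram n).mulVec w r)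
    (hq : w ⬝ᵥ (Agram n).mulVec w = n * ((n : ℤ) + 1)) :
    ((n : ℤ) + 1) ∣ w ⟨0, hn⟩ - 1 ∨ ((n : ℤ) + 1) ∣ w ⟨0, hn⟩ + 1 := by
  set N : ℤ := (n : ℤ) + 1 with hN
  have hNpos : 0 < N := by positivity
  set x : Fin (n + 1) → ℤ := (rE n)ᵀ.mulVec w with hx
  have hAx : (Agram n).mulVec w = (rE n).mulVec x := by
    rw [hx, mulVec_mulVec, rE_gram]
  have hx0 : x 0 = w ⟨0, hn⟩ := by
    rw [hx]
    simp only [mulVec, dotProduct, transpose_apply, rE, of_apply, Pi.sub_apply, Pi.single_apply]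
    rw [Finset.sum_eq_single (⟨0, hn⟩ : Fin n)]
    · simp [Fin.ext_iff]
    · intro b _ hb
      have : (b : ℕ) ≠ 0 := fun h => hb (Fin.ext h)
      simp [Fin.ext_iff, this.symm]
    · simp
  have hsum : ∑ a, x a = 0 := by
    have : ∑ a, x a = x ⬝ᵥ (fun _ => 1) := by simp [dotProduct]
    rw [this, hx, mulVec_transpose, ← dotProduct_mulVec]
    have : (rE n).mulVec (fun _ => 1) = 0 := by
      ext r; rw [rE_mulVec]; simp
    rw [this, dotProduct_zero]
  have hsq : ∑ a, x a ^ 2 = n * N := by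
    rw [← hq, hAx, dotProduct_mulVec, ← mulVec_transpose]
    simp [dotProduct, sq, hx]
  set s := x 0 % N with hs
  have hs0 : 0 ≤ s := Int.emod_nonneg _ hNpos.ne'
  have hs1 : s < N := Int.emod_lt_of_pos _ hNpos
  have hdvd : ∀ a, N ∣ x a - s := by
    intro a
    induction a using Fin.induction with
    | zero => exact Int.dvd_self_sub_emod
    | succ r ih =>
      have h := hw r
      rw [hAx, rE_mulVec] at h
      have := dvd_sub ih h
      have e : x r.succ - s = x r.castSucc - s - (x r.castSucc - x r.succ) := by ring
      rw [e]; exact this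
  choose y hy using hdvd
  have hxy : ∀ a, x a = s + N * y a := fun a => by linarith [hy a]
  have hcard : ∑ _a : Fin (n + 1), s = N * s := by simp [hN]
  have hcard2 : ∑ _a : Fin (n + 1), s ^ 2 = N * s ^ 2 := by simp [hN]
  have hysum : ∑ a, y a = -s := by
    have h := hsum
    simp only [hxy, Finset.sum_add_distrib, ← Finset.mul_sum, hcard] at h
    have : N * (s + ∑ a, y a) = 0 := by linarith
    rcases mul_eq_zero.1 this with h | h
    · omega
    · linarith
  have hysq : N * ∑ a, y a ^ 2 = s ^ 2 + n := by
    have h := hsq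
    have e : ∀ a, x a ^ 2 = s ^ 2 + 2 * s * N * y a + N ^ 2 * y a ^ 2 := fun a => by
      rw [hxy]; ring
    simp only [e, Finset.sum_add_distrib, ← Finset.mul_sum, hcard2, hysum] at h
    have : N * (N * ∑ a, y a ^ 2) = N * (s ^ 2 + n) := by linear_combination h
    exact mul_left_cancel₀ hNpos.ne' this
  have hle : s ≤ ∑ a, y a ^ 2 := by
    have : s = ∑ a, - y a := by rw [Finset.sum_neg_distrib, hysum]; ring
    rw [this]
    exact Finset.sum_le_sum fun a _ => by nlinarith [Int.le_self_sq (-y a)]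
  have hfin : (s - 1) * (s - n) ≥ 0 := by nlinarith
  have hcases : s = 0 ∨ s = 1 ∨ s = n := by
    by_contra hcon
    push Not at hcon
    have : 1 < s := by omega
    have : s < n := by omega
    nlinarith
  have hx0s := hxy 0
  rw [← hx0]
  rcases hcases with h | h | h
  · exfalso
    rw [h] at hysq
    have : N ∣ (n : ℤ) := ⟨_, by rw [hysq]; ring⟩
    have := Int.le_of_dvd (by exact_mod_cast hn) this
    omega
  · left; exact ⟨y 0, by rw [hx0s, h]; ring⟩
  · right; exact ⟨y 0 + 1, by rw [hx0s, h, hN]; ring⟩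

theorem forward_dir (n i j k l : ℕ) (hn : 0 < n)
    (hi : i ≤ (n + 1) / 2) (hj : j ≤ (n + 1) / 2)
    (qk ql : ℤ)
    (hqk : ((n : ℤ) + 1) * qk = (i : ℤ) * ((n : ℤ) + 1 - (i : ℤ)) + (k : ℤ))
    (hql : ((n : ℤ) + 1) * ql = (j : ℤ) * ((n : ℤ) + 1 - (j : ℤ)) + (l : ℤ))
    (hroot2 : ∀ x : Fin (n + 1) → ℤ,
      x ⬝ᵥ (AGlue n j ql).mulVec x ≤ 2 → x (Fin.last n) = 0)
    (h : Represents (AGlue n j ql) (AGlue n i qk)) :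
    ∃ t : ℤ, (((n : ℤ) + 1) ∣ j * t - i ∨ ((n : ℤ) + 1) ∣ j * t + i) ∧ (k : ℤ) = l * t ^ 2 := by
  obtain ⟨T, hT⟩ := h
  rw [rep_iff] at hT
  have hNpos : (0 : ℤ) < (n : ℤ) + 1 := by positivity
  have hlast : ∀ r : Fin n, T r.castSucc (Fin.last n) = 0 := by
    intro r
    apply hroot2
    rw [hT]
    simp [AGlue, Agram]
  let M : Mat n := Matrix.of fun r => Fin.init (T r.castSucc)
  set u : Fin n → ℤ := Fin.init (T (Fin.last n)) with hu
  set t : ℤ := T (Fin.last n) (Fin.last n) with ht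
  have hM : M * Agram n * Mᵀ = Agram n := by
    rw [rep_iff]
    intro a b
    have h := hT a.castSucc b.castSucc
    rw [AGlue_bil, hlast, hlast] at h
    simp [AGlue] at h
    exact h
  have hf : gF n i = M.mulVec ((Agram n).mulVec u + t • gF n j) := by
    ext r
    have h := hT r.castSucc (Fin.last n)
    rw [AGlue_bil, hlast] at h
    have e : AGlue n i qk r.castSucc (Fin.last n) = gF n i r := by simp [AGlue, gF]
    rw [e] at h
    rw [← h, mulVec_add, mulVec_smul, zero_mul, zero_mul, zero_mul, add_zero, add_zero]
    rfl
  have hq : qk = u ⬝ᵥ (Agram n).mulVec u + 2 * t * (u ⬝ᵥ gF n j) + t ^ 2 * ql := by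
    have h := hT (Fin.last n) (Fin.last n)
    rw [AGlue_bil] at h
    have e : AGlue n i qk (Fin.last n) (Fin.last n) = qk := by simp [AGlue]
    rw [e, ← hu, ← ht] at h
    linear_combination -h
  have hdetM : M.det * M.det = 1 := by
    have h := congrArg Matrix.det hM
    rw [det_mul, det_mul, det_transpose] at h
    apply mul_right_cancel₀ (Agram_det_ne n)
    linear_combination h
  have hdetM0 : M.det ≠ 0 := fun h0 => by simp [h0] at hdetM
  set w : Fin n → ℤ := ((n : ℤ) + 1) • u + t • gP n j with hw
  have hwM : w = Mᵀ.mulVec (gP n i) := by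
    have h1 : (M * Agram n).mulVec (w - Mᵀ.mulVec (gP n i)) = 0 := by
      rw [mulVec_sub, mulVec_mulVec, hM, Agram_gP n i (by omega), hf, ← mulVec_mulVec,
        ← mulVec_smul, hw, mulVec_add, mulVec_smul, mulVec_smul, Agram_gP n j (by omega),
        smul_add, smul_comm t, sub_self]
    have := Matrix.eq_zero_of_mulVec_eq_zero (by rw [det_mul]; exact mul_ne_zero hdetM0 (Agram_det_ne n)) h1
    exact sub_eq_zero.1 this
  have hnorm : ∀ a : Fin n → ℤ, Mᵀ.mulVec a ⬝ᵥ (Agram n).mulVec (Mᵀ.mulVec a) =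
      a ⬝ᵥ (Agram n).mulVec a := by
    intro a
    conv_rhs => rw [← hM]
    rw [← mulVec_mulVec, ← mulVec_mulVec, dotProduct_mulVec a M, ← mulVec_transpose]
  refine ⟨t, ?_, ?_⟩
  · -- congruence
    let v : Fin n → ℤ := fun c => (fun x : ℕ => if x = n + 1 then 0 else (x : ℤ)) ((c : ℕ) + 1)
    have hv : ∀ r : Fin n, (Agram n).mulVec v r = if (r : ℕ) + 1 = n then (n : ℤ) + 1 else 0 := by
      intro r
      have hr := r.2
      rw [Agram_mulVec n (fun x : ℕ => if x = n + 1 then 0 else (x : ℤ)) (by simp) (by simp)]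
      rw [if_neg (by omega), if_neg (by omega)]
      split_ifs <;> push_cast <;> omega
    have hvr : ∀ r : Fin n, v r = (r : ℤ) + 1 := by
      intro r
      have hr := r.2
      simp only [v]
      rw [if_neg (by omega)]; push_cast; rfl
    set w' := Mᵀ.mulVec v with hw'
    have hc : ∀ r, ((n : ℤ) + 1) ∣ (Agram n).mulVec w' r := by
      have h1 : M.mulVec ((Agram n).mulVec w') = (Agram n).mulVec v := by
        rw [hw', mulVec_mulVec, mulVec_mulVec, hM]
      have h2 : (Agram n).mulVec w' = M.det • M.adjugate.mulVec ((Agram n).mulVec v) := by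
        rw [← h1, mulVec_mulVec _ M.adjugate M, adjugate_mul, smul_mulVec, one_mulVec, smul_smul, hdetM, one_smul]
      intro r
      rw [h2]
      simp only [Pi.smul_apply, smul_eq_mul]
      apply Dvd.dvd.mul_left
      rw [mulVec, dotProduct]
      apply Finset.dvd_sum
      intro c _
      apply Dvd.dvd.mul_left
      rw [hv]; split_ifs <;> simp
    have hn2 : w' ⬝ᵥ (Agram n).mulVec w' = n * ((n : ℤ) + 1) := by
      rw [hw', hnorm]
      simp only [dotProduct, hv]
      rw [Finset.sum_eq_single (⟨n - 1, by omega⟩ : Fin n)]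
      · rw [if_pos (by simp; omega), hvr]
        push_cast [Nat.cast_sub (show 1 ≤ n by omega)]
        ring
      · intro b _ hb
        rw [if_neg, mul_zero]
        intro hh; exact hb (Fin.ext (by simp; omega))
      · simp
    have hks := key_sign n hn w' hc hn2
    have hc1 : ((n : ℤ) + 1) ∣ w ⟨0, hn⟩ - j * t := by
      have h := gP_cong n j ⟨0, hn⟩
      obtain ⟨d, hd⟩ := h
      simp only [hw, Pi.add_apply, Pi.smul_apply, smul_eq_mul]
      simp only [Nat.cast_zero] at hd
      exact ⟨u ⟨0, hn⟩ + t * d, by linear_combination t * hd⟩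
    have hc2 : ((n : ℤ) + 1) ∣ w ⟨0, hn⟩ - i * w' ⟨0, hn⟩ := by
      rw [hwM, hw']
      simp only [mulVec, dotProduct]
      rw [Finset.mul_sum, ← Finset.sum_sub_distrib]
      apply Finset.dvd_sum
      intro c _
      have h := gP_cong n i c
      rw [hvr]
      have e : Mᵀ ⟨0, hn⟩ c * gP n i c - i * (Mᵀ ⟨0, hn⟩ c * ((c : ℤ) + 1)) =
        Mᵀ ⟨0, hn⟩ c * (gP n i c - i * ((c : ℤ) + 1)) := by ring
      rw [e]
      exact h.mul_left _
    obtain ⟨d1, hd1⟩ := hc1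
    obtain ⟨d2, hd2⟩ := hc2
    rcases hks with ⟨d3, hd3⟩ | ⟨d3, hd3⟩
    · left; exact ⟨d2 - d1 + i * d3, by linear_combination hd2 - hd1 + i * hd3⟩
    · right; exact ⟨d2 - d1 + i * d3, by linear_combination hd2 - hd1 + i * hd3⟩
  · have h1 : w ⬝ᵥ (Agram n).mulVec w = ((n : ℤ) + 1) * (i * ((n : ℤ) + 1 - i)) := by
      rw [hwM, hnorm, Agram_gP n i (by omega), dotProduct_smul, gP_gF n i hi hn, smul_eq_mul]
    have h2 : w ⬝ᵥ (Agram n).mulVec w = ((n : ℤ) + 1) ^ 2 * (u ⬝ᵥ (Agram n).mulVec u)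
        + 2 * t * ((n : ℤ) + 1) ^ 2 * (u ⬝ᵥ gF n j)
        + t ^ 2 * ((n : ℤ) + 1) * (j * ((n : ℤ) + 1 - j)) := by
      have e3 : gP n j ⬝ᵥ (Agram n).mulVec u = ((n : ℤ) + 1) * (u ⬝ᵥ gF n j) := by
        rw [Agram_bil_comm, Agram_gP n j (by omega), dotProduct_smul, smul_eq_mul]
      rw [hw, mulVec_add, mulVec_smul, mulVec_smul, add_dotProduct, dotProduct_add, dotProduct_add]
      simp only [smul_dotProduct, dotProduct_smul, smul_eq_mul, e3]
      rw [Agram_gP n j (by omega)]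
      simp only [dotProduct_smul, smul_eq_mul, gP_gF n j hj hn]
      ring
    apply mul_left_cancel₀ hNpos.ne'
    linear_combination h1 - h2 - ((n : ℤ) + 1) * hqk + ((n : ℤ) + 1) * t ^ 2 * hql
      + ((n : ℤ) + 1) ^ 2 * hq

theorem backward_dir (n i j k l : ℕ) (hn : 0 < n)
    (hi : i ≤ (n + 1) / 2) (hj : j ≤ (n + 1) / 2)
    (qk ql : ℤ)
    (hqk : ((n : ℤ) + 1) * qk = (i : ℤ) * ((n : ℤ) + 1 - (i : ℤ)) + (k : ℤ))
    (hql : ((n : ℤ) + 1) * ql = (j : ℤ) * ((n : ℤ) + 1 - (j : ℤ)) + (l : ℤ))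
    (s : ℤ) (hs : ((n : ℤ) + 1) ∣ j * s - i) (hks : (k : ℤ) = l * s ^ 2) :
    Represents (AGlue n j ql) (AGlue n i qk) := by
  have hNpos : (0 : ℤ) < (n : ℤ) + 1 := by positivity
  have hdiv : ∀ r, ((n : ℤ) + 1) ∣ gP n i r - s * gP n j r := by
    intro r
    obtain ⟨a, ha⟩ := gP_cong n i r
    obtain ⟨b, hb⟩ := gP_cong n j r
    obtain ⟨c, hc⟩ := hs
    exact ⟨a - s * b - c * (r + 1), by linear_combination ha - s * hb - (r + 1) * hc⟩
  choose u hu using hdiv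
  have hu' : gP n i - s • gP n j = ((n : ℤ) + 1) • u := by
    ext r; simp [← hu r]
  have hAu : (Agram n).mulVec u = gF n i - s • gF n j := by
    have h := congrArg (Agram n).mulVec hu'
    rw [mulVec_sub, mulVec_smul, mulVec_smul, Agram_gP n i (by omega), Agram_gP n j (by omega),
      smul_comm s, ← smul_sub] at h
    exact (smul_right_injective (Fin n → ℤ) hNpos.ne' h).symm
  have hnu : ∀ f : Fin n → ℤ, ((n : ℤ) + 1) * (u ⬝ᵥ f) = gP n i ⬝ᵥ f - s * (gP n j ⬝ᵥ f) := by
    intro f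
    have h := congrArg (fun x => x ⬝ᵥ f) hu'
    simp only [sub_dotProduct, smul_dotProduct, smul_eq_mul] at h
    exact h.symm
  obtain ⟨T, t1, t2⟩ : ∃ T : Fin (n + 1) → Fin (n + 1) → ℤ,
      (∀ r : Fin n, T r.castSucc =
        Fin.snoc (α := fun _ => ℤ) (Pi.single r (1 : ℤ) : Fin n → ℤ) 0) ∧
      T (Fin.last n) = Fin.snoc (α := fun _ => ℤ) u s :=
    ⟨Fin.snoc (α := fun _ => Fin (n + 1) → ℤ)
      (fun r : Fin n => Fin.snoc (α := fun _ => ℤ) (Pi.single r (1 : ℤ) : Fin n → ℤ) 0)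
      (Fin.snoc (α := fun _ => ℤ) u s), fun r => by simp, by simp⟩
  have hself : ∀ a b : Fin (n + 1), AGlue n i qk a b = AGlue n i qk b a := by
    intro a b
    have h1 : ∀ a b : Fin n, Agram n a b = Agram n b a := fun a b => by
      conv_lhs => rw [← Agram_symm]
      rfl
    simp only [AGlue, of_apply]
    split_ifs <;> first | rfl | apply h1
  have hmix : ∀ a : Fin n, T a.castSucc ⬝ᵥ (AGlue n j ql).mulVec (T (Fin.last n)) = AGlue n i qk a.castSucc (Fin.last n) := by
    intro a
    have e : AGlue n i qk a.castSucc (Fin.last n) = gF n i a := by simp [AGlue, gF]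
    rw [AGlue_bil, t1, t2, e]
    simp only [Fin.init_snoc, Fin.snoc_last, hAu]
    simp
  refine ⟨T, (rep_iff _ _ T).2 ?_⟩
  intro a b
  induction a using Fin.lastCases with
  | cast a =>
    induction b using Fin.lastCases with
    | cast b =>
      rw [AGlue_bil, t1, t1]
      simp [Fin.init_snoc, Fin.snoc_last, AGlue]
    | last => exact hmix a
  | last =>
    induction b using Fin.lastCases with
    | cast b =>
      rw [hself, ← hmix b, AGlue_bil, AGlue_bil, Agram_bil_comm]
      ring
    | last =>
      have e : AGlue n i qk (Fin.last n) (Fin.last n) = qk := by simp [AGlue]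
      rw [AGlue_bil, t2, e]
      simp only [Fin.init_snoc, Fin.snoc_last, hAu, dotProduct_sub, dotProduct_smul, smul_eq_mul]
      apply mul_left_cancel₀ hNpos.ne'
      have h1 := hnu (gF n i)
      have h2 := hnu (gF n j)
      rw [gP_gF n i hi hn] at h1
      rw [gP_gF n j hj hn] at h2
      have h3 := gP_gF_comm n i j (by omega) (by omega)
      linear_combination h1 + s * h2 + s ^ 2 * hql - hqk - hks + s * h3

/-- Suppose `A_n k(n+1)[i 1/(n+1)]` and `A_n ℓ(n+1)[j 1/(n+1)]`
(with `0 ≤ i, j ≤ ⌊(n+1)/2⌋`) both have `A_n` as their root sublattices (every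
vector of norm ≤ 2 lies in the `A_n`-part).  Then the former is represented by the
latter iff there is a positive integer `t` with `jt ≡ ±i (mod n+1)` and `k = ℓt²`. -/
theorem AGlue_represents_iff (n i j k l : ℕ) (hn : 0 < n)
    (hi : i ≤ (n + 1) / 2) (hj : j ≤ (n + 1) / 2) (hk : 0 < k) (hl : 0 < l)
    (qk ql : ℤ)
    (hqk : ((n : ℤ) + 1) * qk = (i : ℤ) * ((n : ℤ) + 1 - (i : ℤ)) + (k : ℤ))
    (hql : ((n : ℤ) + 1) * ql = (j : ℤ) * ((n : ℤ) + 1 - (j : ℤ)) + (l : ℤ))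
    (hroot1 : ∀ x : Fin (n + 1) → ℤ,
      x ⬝ᵥ (AGlue n i qk).mulVec x ≤ 2 → x (Fin.last n) = 0)
    (hroot2 : ∀ x : Fin (n + 1) → ℤ,
      x ⬝ᵥ (AGlue n j ql).mulVec x ≤ 2 → x (Fin.last n) = 0) :
    Represents (AGlue n j ql) (AGlue n i qk) ↔
      ∃ t : ℕ, 0 < t ∧
        (((j * t : ℕ) : ZMod (n + 1)) = (i : ZMod (n + 1)) ∨
          ((j * t : ℕ) : ZMod (n + 1)) = -(i : ZMod (n + 1))) ∧
        k = l * t ^ 2 := by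
  have e1 : ∀ t : ℕ, (((j * t : ℕ) : ZMod (n + 1)) = (i : ZMod (n + 1)) ↔
      ((n : ℤ) + 1) ∣ j * (t : ℤ) - i) := by
    intro t
    have := ZMod.intCast_zmod_eq_zero_iff_dvd
    rw [← sub_eq_zero]
    have h := ZMod.intCast_zmod_eq_zero_iff_dvd ((j : ℤ) * t - i) (n + 1)
    push_cast at h ⊢
    exact h
  have e2 : ∀ t : ℕ, (((j * t : ℕ) : ZMod (n + 1)) = -(i : ZMod (n + 1)) ↔
      ((n : ℤ) + 1) ∣ j * (t : ℤ) + i) := by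
    intro t
    rw [eq_neg_iff_add_eq_zero]
    have h := ZMod.intCast_zmod_eq_zero_iff_dvd ((j : ℤ) * t + i) (n + 1)
    push_cast at h ⊢
    exact h
  constructor
  · intro h
    obtain ⟨t, ht, hkt⟩ := forward_dir n i j k l hn hi hj qk ql hqk hql hroot2 h
    refine ⟨t.natAbs, ?_, ?_, ?_⟩
    · rw [Int.natAbs_pos]
      rintro rfl
      simp at hkt; omega
    · rw [e1, e2]
      rcases Int.natAbs_eq t with h | h
      · rw [← h]; exact ht
      · have h' : (t.natAbs : ℤ) = -t := by omega
        rw [h']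
        rcases ht with ⟨d, hd⟩ | ⟨d, hd⟩
        · right; exact ⟨-d, by linear_combination -hd⟩
        · left; exact ⟨-d, by linear_combination -hd⟩
    · zify
      rw [sq_abs]; exact hkt
  · rintro ⟨t, _, ht, hkt⟩
    rw [e1, e2] at ht
    rcases ht with ht | ⟨d, hd⟩
    · exact backward_dir n i j k l hn hi hj qk ql hqk hql t ht (by exact_mod_cast hkt)
    · refine backward_dir n i j k l hn hi hj qk ql hqk hql (-t) ⟨-d, by linear_combination -hd⟩ ?_
      rw [neg_sq]; exact_mod_cast hkt
end

section
/- For any positive integers m and n, there exists a positive definite integral lattice L whose n-exceptional set E_n(L) has exactly m elements; i.e., there are exactly m isometry classes of rank-n positive definite integral lattices not represented by L. -/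
open Matrix

namespace ExcAux

/-- Cone generated by `x xᵀ`, `x` integral with entries bounded by `R`. -/
def Cone (n : ℕ) (R : ℤ) : Submodule NNRat (Matrix (Fin n) (Fin n) ℚ) :=
  Submodule.span NNRat {G | ∃ x : Fin n → ℤ, (∀ i, |x i| ≤ R) ∧ G = Matrix.of fun i j => (x i : ℚ) * x j}

theorem cone_mono {n : ℕ} {R R' : ℤ} (h : R ≤ R') : Cone n R ≤ Cone n R' := by
  apply Submodule.span_mono
  rintro G ⟨x, hx, rfl⟩
  exact ⟨x, fun i => (hx i).trans h, rfl⟩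

theorem cone_smul {n : ℕ} {R : ℤ} {G : Matrix (Fin n) (Fin n) ℚ} (h : G ∈ Cone n R) {c : ℚ}
    (hc : 0 ≤ c) : c • G ∈ Cone n R := by
  have := (Cone n R).smul_mem (⟨c, hc⟩ : NNRat) h
  exact this

theorem cone_mem {n : ℕ} {R : ℤ} (x : Fin n → ℤ) (hx : ∀ i, |x i| ≤ R) :
    (Matrix.of fun i j => (x i : ℚ) * x j : Matrix (Fin n) (Fin n) ℚ) ∈ Cone n R :=
  Submodule.subset_span ⟨x, hx, rfl⟩

theorem cone_congr {n : ℕ} {R : ℤ} {G G' : Matrix (Fin n) (Fin n) ℚ} (h : G ∈ Cone n R)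
    (e : ∀ i j, G' i j = G i j) : G' ∈ Cone n R := by
  have : G' = G := by ext i j; exact e i j
  rw [this]; exact h

theorem cone_ext {n : ℕ} {R : ℤ} (hR : 0 ≤ R) {G : Matrix (Fin n) (Fin n) ℚ} (h : G ∈ Cone n R) :
    (Matrix.of (Fin.cons (fun _ => 0) fun i => Fin.cons 0 (G i)) : Matrix (Fin (n+1)) (Fin (n+1)) ℚ)
      ∈ Cone (n+1) R := by
  induction h using Submodule.span_induction with
  | mem G h =>
    obtain ⟨x, hx, rfl⟩ := h
    have := cone_mem (R := R) (Fin.cons 0 x : Fin (n+1) → ℤ)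
      (by intro i; refine Fin.cases ?_ ?_ i <;> simp [hx, hR])
    refine cone_congr this fun i j => ?_
    refine Fin.cases ?_ (fun i => ?_) i <;> refine Fin.cases ?_ (fun j => ?_) j <;> simp
  | zero =>
    convert (Cone (n+1) R).zero_mem using 1
    ext i j
    refine Fin.cases ?_ (fun i => ?_) i <;> refine Fin.cases ?_ (fun j => ?_) j <;> simp
  | add A B _ _ hA hB =>
    convert (Cone (n+1) R).add_mem hA hB using 1
    ext i j
    refine Fin.cases ?_ (fun i => ?_) i <;> refine Fin.cases ?_ (fun j => ?_) j <;> simp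
  | smul c A _ hA =>
    convert (Cone (n+1) R).smul_mem c hA using 1
    ext i j
    refine Fin.cases ?_ (fun i => ?_) i <;> refine Fin.cases ?_ (fun j => ?_) j <;> simp

theorem cone_round {n : ℕ} (R : ℤ) (s : Finset (Fin n)) :
    ∀ y : Fin n → ℚ, (∀ j, j ∉ s → ∃ z : ℤ, y j = z) → (∀ j, |y j| ≤ R) →
      ∃ δ : Fin n → ℚ, (∀ j, 0 ≤ δ j ∧ δ j ≤ 1) ∧ (∀ j, j ∉ s → δ j = 0) ∧
        (Matrix.of fun i j => y i * y j + if i = j then δ i else 0 : Matrix (Fin n) (Fin n) ℚ) ∈ Cone n R := by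
  induction s using Finset.induction_on with
  | empty =>
    intro y hy hR
    choose z hz using fun j => hy j (by simp)
    refine ⟨0, by simp, by simp, ?_⟩
    have := cone_mem (R := R) z (by
      intro i; have := hR i; rw [hz] at this; exact_mod_cast this)
    refine cone_congr this fun i j => ?_
    simp [hz]
  | insert k s hk ih =>
    intro y hy hR
    set θ : ℚ := Int.fract (y k) with hθ
    have h0 : 0 ≤ θ := Int.fract_nonneg _
    have h1 : θ < 1 := Int.fract_lt_one _
    have hyk : y k = ⌊y k⌋ + θ := (Int.floor_add_fract _).symm
    have hRk := abs_le.1 (hR k)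
    have hf1 : -R ≤ ⌊y k⌋ := by
      rw [Int.le_floor]; push_cast; exact hRk.1
    have hf2 : ⌊y k⌋ ≤ R := by
      have := (Int.floor_le (y k)).trans hRk.2
      exact_mod_cast this
    by_cases hθ0 : θ = 0
    · obtain ⟨δ, h1, h2, h3⟩ := ih y (by
        intro j hj
        by_cases hjk : j = k
        · subst hjk; exact ⟨⌊y j⌋, by rw [hθ0] at hyk; simpa using hyk⟩
        · exact hy j (by simp [hj, hjk])) hR
      exact ⟨δ, h1, fun j hj => h2 j (by simp at hj; exact hj.2), h3⟩
    have hf3 : ⌊y k⌋ + 1 ≤ R := by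
      by_contra hcon
      have : R = ⌊y k⌋ := by omega
      have h4 := hRk.2
      rw [this] at h4
      have : 0 < θ := lt_of_le_of_ne h0 (Ne.symm hθ0)
      linarith
    have key : ∀ z : ℤ, |z| ≤ R → ∃ δ : Fin n → ℚ, (∀ j, 0 ≤ δ j ∧ δ j ≤ 1) ∧ (∀ j, j ∉ s → δ j = 0) ∧
        (Matrix.of fun i j => Function.update y k z i * Function.update y k z j + if i = j then δ i else 0 :
          Matrix (Fin n) (Fin n) ℚ) ∈ Cone n R := by
      intro z hz
      apply ih
      · intro j hj
        by_cases hjk : j = k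
        · subst hjk; exact ⟨z, by simp⟩
        · rw [Function.update_of_ne hjk]; exact hy j (by simp [hj, hjk])
      · intro j
        by_cases hjk : j = k
        · subst hjk; simp; exact_mod_cast hz
        · rw [Function.update_of_ne hjk]; exact hR j
    obtain ⟨δ0, ha0, hb0, hc0⟩ := key ⌊y k⌋ (abs_le.2 ⟨hf1, hf2⟩)
    obtain ⟨δ1, ha1, hb1, hc1⟩ := key (⌊y k⌋ + 1) (abs_le.2 ⟨by omega, hf3⟩)
    refine ⟨fun j => (1 - θ) * δ0 j + θ * δ1 j + if j = k then θ * (1 - θ) else 0, ?_, ?_, ?_⟩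
    · intro j
      have := ha0 j; have := ha1 j
      by_cases hjk : j = k
      · subst hjk
        simp only [hb0 j hk, hb1 j hk, if_true]
        constructor <;> nlinarith
      · simp [hjk]
        constructor <;> nlinarith
    · intro j hj
      simp at hj
      simp [hj.1, hb0 j hj.2, hb1 j hj.2]
    · have := (Cone n R).add_mem (cone_smul hc0 (c := 1 - θ) (by linarith)) (cone_smul hc1 h0)
      refine cone_congr this fun i j => ?_
      simp only [Matrix.add_apply, Matrix.smul_apply, smul_eq_mul, Matrix.of_apply]
      have e0 : (⌊y k⌋ : ℚ) = y k - θ := by linarith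
      by_cases hij : i = j
      · subst hij
        by_cases hik : i = k
        · subst hik; simp [e0]; ring
        · simp [hik, Function.update_of_ne]; ring
      · by_cases hik : i = k
        · subst hik
          simp [hij, Function.update_of_ne (Ne.symm hij), e0]; ring
        · by_cases hjk : j = k
          · subst hjk
            simp [hij, Function.update_of_ne hij, e0]; ring
          · simp [hij, hik, hjk]; ring

/-- Weakly reduced forms. -/
def Red {n : ℕ} (κ C : ℚ) (M : Matrix (Fin n) (Fin n) ℚ) : Prop :=
  (∀ i j, M i j = M j i) ∧ (∀ i, 0 < M i i) ∧ (∀ i j, i ≤ j → M i i ≤ C * M j j) ∧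
  (∀ i j, i < j → |M i j| ≤ C * M i i) ∧
  (∀ x : Fin n → ℚ, κ * ∑ i, M i i * x i ^ 2 ≤ ∑ i, ∑ j, M i j * x i * x j)

theorem red_cone (n : ℕ) : ∀ κ C : ℚ, 0 < κ → 1 ≤ C → ∃ R : ℤ, 0 ≤ R ∧
    ∀ M : Matrix (Fin n) (Fin n) ℚ, Red κ C M → M ∈ Cone n R := by
  induction n with
  | zero =>
    intro κ C _ _
    refine ⟨0, le_rfl, fun M _ => ?_⟩
    exact cone_congr (Cone 0 0).zero_mem (fun i => i.elim0)
  | succ n ih =>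
    intro κ C hκ hC
    obtain ⟨q, hq⟩ := exists_nat_ge (2 * C / κ + 1)
    have hq1 : (1 : ℚ) ≤ q := by
      have : 0 < 2 * C / κ := by positivity
      linarith
    have hq2 : 2 * C / κ ≤ (q : ℚ) ^ 2 := by nlinarith
    have hqpos : (0:ℚ) < (q:ℚ)^2 := by positivity
    set C' : ℚ := (C + C ^ 3 + 1) * (2 / κ) + 1 with hC'
    have hC'1 : 1 ≤ C' := by
      have : 0 < (C + C ^ 3 + 1) * (2 / κ) := by positivity
      linarith
    obtain ⟨R', hR'0, hR'⟩ := ih (κ / 2) C' (by positivity) hC'1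
    obtain ⟨Q, hQ⟩ := exists_nat_ge (q * C)
    refine ⟨max R' Q, le_trans hR'0 (le_max_left _ _), ?_⟩
    intro M ⟨hsym, hpos, hmon, hoff, hlow⟩
    set a := M 0 0 with ha
    have ha0 : 0 < a := hpos 0
    set μ : Fin (n+1) → ℚ := fun j => M 0 j / a with hμ
    have hμ0 : μ 0 = 1 := by simp [hμ, ← ha, ha0.ne']
    have hμC : ∀ j, |μ j| ≤ C := by
      intro j
      refine Fin.cases ?_ (fun j => ?_) j
      · rw [hμ0]; simpa using hC
      · have := hoff 0 j.succ (Fin.succ_pos j)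
        simp only [hμ]
        rw [abs_div, abs_of_pos ha0, div_le_iff₀ ha0]; exact this
    obtain ⟨δ, hδ, hδ0, hcone⟩ := cone_round (n := n+1) (Q : ℤ) (Finset.univ.erase 0)
      (fun j => q * μ j) (by
        intro j hj
        have : j = 0 := by simpa using hj
        subst this
        exact ⟨q, by simp [hμ0]⟩) (by
        intro j
        rw [abs_mul, abs_of_nonneg (by linarith : (0:ℚ) ≤ q)]
        push_cast
        exact le_trans (mul_le_mul_of_nonneg_left (hμC j) (by linarith)) hQ)
    have hδ00 : δ 0 = 0 := hδ0 0 (by simp)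
    set M'' : Matrix (Fin n) (Fin n) ℚ := fun i j =>
      M i.succ j.succ - a * μ i.succ * μ j.succ - (if i = j then a / q^2 * δ i.succ else 0) with hM''
    have hcost : ∀ j, a / q^2 * δ j ≤ κ / 2 * M j j := by
      intro j
      have h1 : a ≤ C * M j j := hmon 0 j (Fin.zero_le j)
      have h2 : a / q^2 ≤ κ / 2 * M j j := by
        rw [div_le_iff₀ hqpos]
        rw [div_le_iff₀ hκ] at hq2
        have := hpos j
        nlinarith
      have h3 : 0 ≤ a / q^2 := by positivity
      nlinarith [hδ j]
    have hcost0 : ∀ j, 0 ≤ a / q^2 * δ j := by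
      intro j
      have h3 : 0 ≤ a / q^2 := by positivity
      exact mul_nonneg h3 (hδ j).1
    have hM0 : ∀ j, M 0 j = a * μ j := by intro j; simp only [hμ]; field_simp
    have hschur : ∀ x : Fin n → ℚ, κ * ∑ i, M i.succ i.succ * x i ^ 2 ≤
        ∑ i, ∑ j, (M i.succ j.succ - a * μ i.succ * μ j.succ) * x i * x j := by
      intro x
      have := hlow (Fin.cons (- ∑ i, μ i.succ * x i) x)
      simp only [Fin.sum_univ_succ, Fin.cons_zero, Fin.cons_succ] at this
      set t := ∑ i, μ i.succ * x i with ht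
      have e1 : ∑ i : Fin n, M 0 i.succ * (-t) * x i = - a * t * t := by
        rw [ht, Finset.mul_sum, ← ht]
        apply Finset.sum_congr rfl; intro i _; rw [hM0]; ring
      have e2 : ∑ i : Fin n, (M i.succ 0 * x i * (-t) + ∑ j : Fin n, M i.succ j.succ * x i * x j) =
         - a * t * t + ∑ i : Fin n, ∑ j : Fin n, M i.succ j.succ * x i * x j := by
        rw [Finset.sum_add_distrib]
        congr 1
        rw [ht, Finset.mul_sum, ← ht]
        apply Finset.sum_congr rfl; intro i _; rw [hsym, hM0]; ring
      have e3 : ∑ i, ∑ j, (M i.succ j.succ - a * μ i.succ * μ j.succ) * x i * x j =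
         (∑ i : Fin n, ∑ j : Fin n, M i.succ j.succ * x i * x j) - a * (t * t) := by
        rw [ht, Finset.sum_mul_sum, Finset.mul_sum, ← Finset.sum_sub_distrib]
        apply Finset.sum_congr rfl; intro i _
        rw [Finset.mul_sum, ← Finset.sum_sub_distrib]
        apply Finset.sum_congr rfl; intro j _; ring
      rw [e1, e2] at this
      rw [e3]
      have h4 : 0 ≤ κ * (M 0 0 * (-t)^2) := by
        have := hpos 0; positivity
      rw [← ha] at *
      nlinarith
    have hMlow : ∀ x : Fin n → ℚ, κ / 2 * ∑ i, M i.succ i.succ * x i ^ 2 ≤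
        ∑ i, ∑ j, M'' i j * x i * x j := by
      intro x
      have e : ∑ i, ∑ j, M'' i j * x i * x j =
         ∑ i, ∑ j, (M i.succ j.succ - a * μ i.succ * μ j.succ) * x i * x j -
           ∑ i, a / q^2 * δ i.succ * x i ^ 2 := by
        rw [← Finset.sum_sub_distrib]
        apply Finset.sum_congr rfl; intro i _
        simp only [hM'', sub_mul, Finset.sum_sub_distrib, ite_mul, zero_mul, Finset.sum_ite_eq,
          Finset.mem_univ, if_true]
        ring
      rw [e]
      have h1 := hschur x
      have h2 : ∑ i : Fin n, a / q^2 * δ i.succ * x i ^ 2 ≤ κ / 2 * ∑ i, M i.succ i.succ * x i ^ 2 := by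
        rw [Finset.mul_sum]
        apply Finset.sum_le_sum
        intro i _
        have := mul_le_mul_of_nonneg_right (hcost i.succ) (sq_nonneg (x i))
        linarith
      linarith
    have hdiag1 : ∀ j, κ / 2 * M j.succ j.succ ≤ M'' j j := by
      intro j
      have := hMlow (Pi.single j 1)
      simpa [Pi.single_apply, ite_pow, Finset.sum_ite_eq] using this
    have hdiag2 : ∀ j, M'' j j ≤ M j.succ j.succ := by
      intro j
      simp only [hM'', if_true]
      have := hcost0 j.succ
      have : 0 ≤ a * (μ j.succ * μ j.succ) := mul_nonneg ha0.le (mul_self_nonneg _)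
      nlinarith
    have hκk : ∀ j, M j.succ j.succ ≤ 2 / κ * M'' j j := by
      intro j
      have := hdiag1 j
      rw [div_mul_eq_mul_div, le_div_iff₀ hκ]; linarith
    have hM''0 : ∀ j, 0 < M'' j j := by
      intro j
      have := hdiag1 j
      have h2 := hpos j.succ
      have : 0 < κ / 2 * M j.succ j.succ := by positivity
      linarith
    have hκ2 : 0 < 2 / κ := by positivity
    have hred : Red (κ / 2) C' M'' := by
      refine ⟨?_, hM''0, ?_, ?_, ?_⟩
      · intro i j
        simp only [hM'']
        rw [hsym i.succ j.succ]
        by_cases hij : i = j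
        · subst hij; rfl
        · simp [hij, Ne.symm hij]; ring
      · intro i j hij
        have h1 := hmon i.succ j.succ (Fin.succ_le_succ_iff.2 hij)
        have h2 := hdiag2 i
        have h3 := hκk j
        have h4 := hM''0 j
        have h5 : C * M j.succ j.succ ≤ C * (2 / κ * M'' j j) := mul_le_mul_of_nonneg_left h3 (by linarith)
        have h6 : 0 < (C ^ 3 + 1) * (2 / κ) * M'' j j := by positivity
        rw [hC']; nlinarith
      · intro i j hij
        have h1 := hoff i.succ j.succ (Fin.succ_lt_succ_iff.2 hij)
        have h2 := hκk i
        have h3 : |M'' i j| ≤ |M i.succ j.succ| + a * C * C := by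
          simp only [hM'', hij.ne, if_false, sub_zero]
          refine (abs_sub _ _).trans ?_
          gcongr
          rw [abs_mul, abs_mul, abs_of_pos ha0]
          gcongr
          · exact hμC _
          · exact hμC _
        have h4 : a ≤ C * M i.succ i.succ := hmon 0 i.succ (Fin.zero_le _)
        have h5 : a * C * C ≤ (C * M i.succ i.succ) * C * C := by gcongr
        have h6 : (C + C^3) * M i.succ i.succ ≤ (C + C^3) * (2 / κ * M'' i i) :=
          mul_le_mul_of_nonneg_left h2 (by positivity)
        have h7 : 0 < (2 / κ) * M'' i i := by have := hM''0 i; positivity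
        have := hM''0 i
        rw [hC']; nlinarith
      · intro x
        refine le_trans ?_ (hMlow x)
        gcongr with i
        exact hdiag2 i
    have c1 := cone_mono (le_max_left R' Q) (cone_ext hR'0 (hR' M'' hred))
    have c2 := cone_mono (le_max_right R' Q) (cone_smul hcone (c := a / q^2) (by positivity))
    refine cone_congr (Submodule.add_mem _ c1 c2) ?_
    intro i j
    have hqne : (q:ℚ) ≠ 0 := by linarith
    refine Fin.cases ?_ (fun i => ?_) i <;> refine Fin.cases ?_ (fun j => ?_) j
    · simp [hδ00, hμ0, ← ha]; field_simp
    · simp [Ne.symm (Fin.succ_ne_zero j), hμ0, hM0]; field_simp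
    · simp [(Fin.succ_ne_zero i), hμ0, hsym i.succ 0, hM0]; field_simp
    · simp only [hM'', Matrix.add_apply, Matrix.smul_apply, smul_eq_mul, Matrix.of_apply, Fin.cons_succ, Fin.succ_inj]
      by_cases hij : i = j
      · simp [hij]; field_simp; ring
      · simp [hij]; field_simp; ring

end ExcAux

namespace ExcAux

theorem red_step {n : ℕ} {κ' C' : ℚ} (hκ' : 0 < κ') (hC' : 1 ≤ C') {D : Matrix (Fin n) (Fin n) ℚ}
    (hD : Red κ' C' D) {M : Matrix (Fin (n+1)) (Fin (n+1)) ℚ} {h : Fin n → ℚ} {a : ℚ} (ha : 0 < a)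
    (h00 : M 0 0 = a) (h0s : ∀ j : Fin n, M 0 j.succ = h j) (hs0 : ∀ j : Fin n, M j.succ 0 = h j)
    (hss : ∀ i j : Fin n, a * M i.succ j.succ = D i j + h i * h j)
    (hh : ∀ j, |h j| ≤ a / 2) (hmin : ∀ j : Fin n, a ≤ M j.succ j.succ) :
    Red (κ' / (2 * κ' + n + 2)) (4 / 3 * C' + 1) M := by
  obtain ⟨hsym, hpos, hmon, hoff, hlow⟩ := hD
  have hsq : ∀ j, h j ^ 2 ≤ a ^ 2 / 4 := by
    intro j
    have := hh j
    rw [abs_le] at this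
    nlinarith
  have hup : ∀ j, D j j ≤ a * M j.succ j.succ := by
    intro j; rw [hss]; nlinarith
  have hlo : ∀ j, 3 / 4 * (a * M j.succ j.succ) ≤ D j j := by
    intro j
    have h1 := hss j j
    have h2 := hsq j
    have h3 := hmin j
    nlinarith
  have hMs : ∀ i j, M i j = M j i := by
    intro i j
    refine Fin.cases ?_ (fun i => ?_) i <;> refine Fin.cases ?_ (fun j => ?_) j
    · rfl
    · rw [h0s, hs0]
    · rw [h0s, hs0]
    · have h1 := hss i j
      have h2 := hss j i
      rw [hsym] at h1
      have : a * M i.succ j.succ = a * M j.succ i.succ := by linarith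
      exact mul_left_cancel₀ ha.ne' this
  have hMp : ∀ j : Fin n, 0 < M j.succ j.succ := fun j => lt_of_lt_of_le ha (hmin j)
  refine ⟨hMs, ?_, ?_, ?_, ?_⟩
  · intro i
    refine Fin.cases ?_ (fun i => ?_) i
    · rw [h00]; exact ha
    · exact hMp i
  · intro i j hij
    revert hij
    refine Fin.cases ?_ (fun i => ?_) i <;> refine Fin.cases ?_ (fun j => ?_) j <;> intro hij
    · rw [h00]; nlinarith
    · rw [h00]; have := hmin j; have := hMp j; nlinarith
    · exact absurd hij (by simp)
    · have h1 := hmon i j (Fin.succ_le_succ_iff.1 hij)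
      have h2 := hlo i
      have h3 := hup j
      have h4 : C' * D j j ≤ C' * (a * M j.succ j.succ) := mul_le_mul_of_nonneg_left h3 (by linarith)
      have h5 : a * M i.succ i.succ ≤ a * ((4 / 3 * C' + 1) * M j.succ j.succ) := by
        have : 0 < a * M j.succ j.succ := mul_pos ha (hMp j)
        nlinarith
      exact le_of_mul_le_mul_left h5 ha
  · intro i j hij
    revert hij
    refine Fin.cases ?_ (fun i => ?_) i <;> refine Fin.cases ?_ (fun j => ?_) j <;> intro hij
    · exact absurd hij (by simp)
    · rw [h00, h0s]; have := hh j; nlinarith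
    · exact absurd hij (by simp)
    · have h1 := hoff i j (Fin.succ_lt_succ_iff.1 hij)
      have h2 := hup i
      have h3 : |h i * h j| ≤ (a / 2) * (a / 2) := by
        rw [abs_mul]
        exact mul_le_mul (hh i) (hh j) (abs_nonneg _) (by linarith)
      have h4 : C' * D i i ≤ C' * (a * M i.succ i.succ) := mul_le_mul_of_nonneg_left h2 (by linarith)
      have h5 : |a * M i.succ j.succ| ≤ |D i j| + |h i * h j| := by rw [hss]; exact abs_add_le _ _
      rw [abs_mul, abs_of_pos ha] at h5
      have h6 := hmin i
      have h7 : a * a ≤ a * M i.succ i.succ := mul_le_mul_of_nonneg_left h6 ha.le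
      have h8 : 0 < C' * (a * M i.succ i.succ) := by have := hMp i; positivity
      have : a * |M i.succ j.succ| ≤ a * ((4 / 3 * C' + 1) * M i.succ i.succ) := by nlinarith
      exact le_of_mul_le_mul_left this ha
  · intro x
    set t := ∑ j, h j * x j.succ with ht
    set S := ∑ j : Fin n, M j.succ j.succ * x j.succ ^ 2 with hS
    have hS0 : 0 ≤ S := Finset.sum_nonneg fun j _ => mul_nonneg (hMp j).le (sq_nonneg _)
    set Dy := ∑ i, ∑ j, D i j * x i.succ * x j.succ with hDy
    have e1 : a * ∑ i, ∑ j, M i j * x i * x j = (a * x 0 + t) ^ 2 + Dy := by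
      simp only [Fin.sum_univ_succ, h00, h0s, hs0]
      have e2 : ∑ j, h j * x 0 * x j.succ = x 0 * t := by
        rw [ht, Finset.mul_sum]; apply Finset.sum_congr rfl; intro i _; ring
      have e3 : ∑ i : Fin n, (h i * x i.succ * x 0 + ∑ j : Fin n, M i.succ j.succ * x i.succ * x j.succ)
         = x 0 * t + ∑ i : Fin n, ∑ j : Fin n, M i.succ j.succ * x i.succ * x j.succ := by
        rw [Finset.sum_add_distrib, ht, Finset.mul_sum]; congr 1
        apply Finset.sum_congr rfl; intro i _; ring
      have e4 : a * ∑ i : Fin n, ∑ j : Fin n, M i.succ j.succ * x i.succ * x j.succ = Dy + t * t := by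
        rw [ht, Finset.sum_mul_sum, hDy, ← Finset.sum_add_distrib, Finset.mul_sum]
        apply Finset.sum_congr rfl; intro i _
        rw [← Finset.sum_add_distrib, Finset.mul_sum]
        apply Finset.sum_congr rfl; intro j _
        have := hss i j
        linear_combination (x i.succ * x j.succ) * this
      rw [e2, e3]
      linear_combination e4
    have hDlow : 3 / 4 * κ' * (a * S) ≤ Dy := by
      refine le_trans ?_ (hlow fun j => x j.succ)
      rw [hS, Finset.mul_sum, Finset.mul_sum, Finset.mul_sum]
      apply Finset.sum_le_sum
      intro j _
      have := mul_le_mul_of_nonneg_right (hlo j) (sq_nonneg (x j.succ))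
      have := mul_le_mul_of_nonneg_left this hκ'.le
      nlinarith
    have ht2 : t ^ 2 ≤ n / 4 * (a * S) := by
      have h1 := sq_sum_le_card_mul_sum_sq (s := Finset.univ) (f := fun j => h j * x j.succ)
      rw [← ht] at h1
      simp only [Finset.card_univ, Fintype.card_fin] at h1
      have h2 : ∑ j, (h j * x j.succ) ^ 2 ≤ 1 / 4 * (a * S) := by
        rw [hS, Finset.mul_sum, Finset.mul_sum]
        apply Finset.sum_le_sum
        intro j _
        have h3 := mul_le_mul_of_nonneg_left (hmin j) ha.le
        have h4 := mul_le_mul_of_nonneg_right ((hsq j).trans (by linarith : a^2/4 ≤ (a * M j.succ j.succ)/4)) (sq_nonneg (x j.succ))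
        nlinarith
      have := mul_le_mul_of_nonneg_left h2 (Nat.cast_nonneg (α := ℚ) n)
      linarith
    have hden : 0 < 2 * κ' + n + 2 := by positivity
    rw [Fin.sum_univ_succ, h00, ← hS, div_mul_eq_mul_div, div_le_iff₀ hden]
    refine le_of_mul_le_mul_left ?_ ha
    have : a * ((∑ i, ∑ j, M i j * x i * x j) * (2 * κ' + n + 2)) =
       ((a * x 0 + t) ^ 2 + Dy) * (2 * κ' + n + 2) := by rw [← e1]; ring
    rw [this]
    have hA : a ^ 2 * x 0 ^ 2 ≤ 2 * (a * x 0 + t) ^ 2 + 2 * t ^ 2 := by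
      nlinarith [sq_nonneg (a * x 0 + 2 * t)]
    have haS : 0 ≤ a * S := by positivity
    have hDy0 : 0 ≤ Dy := le_trans (by positivity) hDlow
    have n0 : (0:ℚ) ≤ n := Nat.cast_nonneg n
    have f1 : κ' * (a ^ 2 * x 0 ^ 2) ≤ κ' * (2 * (a * x 0 + t) ^ 2 + 2 * t ^ 2) :=
      mul_le_mul_of_nonneg_left hA hκ'.le
    have f2 : κ' * t ^ 2 ≤ κ' * (n / 4 * (a * S)) := mul_le_mul_of_nonneg_left ht2 hκ'.le
    have f3 : 3 / 4 * κ' * (a * S) * (n + 2) ≤ Dy * (n + 2) :=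
      mul_le_mul_of_nonneg_right hDlow (by linarith)
    have f4 : 0 ≤ Dy * (2 * κ') := by positivity
    have f5 : 0 ≤ (a * x 0 + t) ^ 2 * (n + 2) := by positivity
    have f6 : 0 ≤ κ' * (a * S) := by positivity
    have f7 : 0 ≤ κ' * (a * S) * n := by positivity
    nlinarith


theorem conj_apply {m n : ℕ} (U : Matrix (Fin m) (Fin n) ℤ) (G : Mat n) (i j : Fin m) :
    (U * G * Uᵀ) i j = U i ⬝ᵥ G *ᵥ U j := by
  rw [Matrix.mul_assoc, Matrix.mul_apply]
  simp only [dotProduct, Matrix.mul_apply, mulVec, Matrix.transpose_apply]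

theorem bil_cons {n : ℕ} (M : Mat (n+1)) (hM : M.IsSymm) (s t : ℤ) (x y : Fin n → ℤ) :
    (Fin.cons s x : Fin (n+1) → ℤ) ⬝ᵥ M *ᵥ (Fin.cons t y : Fin (n+1) → ℤ) =
      M 0 0 * s * t + s * ((fun j => M 0 j.succ) ⬝ᵥ y) + t * ((fun j => M 0 j.succ) ⬝ᵥ x) +
      x ⬝ᵥ (M.submatrix Fin.succ Fin.succ) *ᵥ y := by
  have hs : ∀ i : Fin n, M i.succ 0 = M 0 i.succ := fun i => hM.apply _ _
  simp only [dotProduct, mulVec, Fin.sum_univ_succ, Fin.cons_zero, Fin.cons_succ, hs, submatrix_apply]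
  have : ∑ i : Fin n, x i * (M 0 i.succ * t + ∑ j : Fin n, M i.succ j.succ * y j) =
     t * ∑ i : Fin n, M 0 i.succ * x i + ∑ i : Fin n, x i * ∑ j : Fin n, M i.succ j.succ * y j := by
    rw [Finset.mul_sum, ← Finset.sum_add_distrib]
    apply Finset.sum_congr rfl; intro i _; ring
  rw [this]; ring

theorem symm_conj {m n : ℕ} {G : Mat n} (hG : G.IsSymm) (U : Matrix (Fin m) (Fin n) ℤ) :
    (U * G * Uᵀ).IsSymm := by
  unfold Matrix.IsSymm
  rw [Matrix.transpose_mul, Matrix.transpose_mul, Matrix.transpose_transpose, hG.eq, Matrix.mul_assoc]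

theorem quad_conj {m n : ℕ} (G : Mat n) (U : Matrix (Fin m) (Fin n) ℤ) (v : Fin m → ℤ) :
    v ⬝ᵥ (U * G * Uᵀ) *ᵥ v = (v ᵥ* U) ⬝ᵥ G *ᵥ (v ᵥ* U) := by
  rw [← Matrix.mulVec_mulVec, ← Matrix.mulVec_mulVec, Matrix.dotProduct_mulVec, Matrix.mulVec_transpose]

theorem pd_conj {n : ℕ} {G U V : Mat n} (hG : PosDefInt G) (hUV : U * V = 1) :
    PosDefInt (U * G * Uᵀ) := by
  refine ⟨symm_conj hG.1 U, fun v hv => ?_⟩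
  rw [quad_conj]
  apply hG.2
  intro h0
  apply hv
  have : (v ᵥ* U) ᵥ* V = v := by rw [Matrix.vecMul_vecMul, hUV, Matrix.vecMul_one]
  rw [← this, h0, Matrix.zero_vecMul]

theorem pd_diag {n : ℕ} {G : Mat n} (hG : PosDefInt G) (i : Fin n) : 0 < G i i := by
  have := hG.2 (Pi.single i 1) (by
    intro h; have := congrFun h i; simp at this)
  simpa using this

theorem round_near (a u : ℤ) (ha : 0 < a) : |((u - round ((u : ℚ) / a) * a : ℤ) : ℚ)| ≤ (a : ℚ) / 2 := by
  have h := abs_sub_round ((u : ℚ) / a)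
  have ha' : (0:ℚ) < a := by exact_mod_cast ha
  have e : ((u - round ((u : ℚ) / a) * a : ℤ) : ℚ) = a * ((u : ℚ) / a - round ((u : ℚ) / a)) := by
    push_cast; field_simp
  rw [e, abs_mul, abs_of_pos ha']
  nlinarith

theorem reduction (n : ℕ) : ∃ κ C : ℚ, 0 < κ ∧ 1 ≤ C ∧ ∀ G : Mat n, PosDefInt G →
    ∃ U V : Mat n, U * V = 1 ∧ Red κ C ((U * G * Uᵀ).map (Int.cast : ℤ → ℚ)) := by
  induction n with
  | zero =>
    refine ⟨1, 1, one_pos, le_rfl, fun G _ => ⟨1, 1, by simp, ?_⟩⟩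
    exact ⟨fun i => i.elim0, fun i => i.elim0, fun i => i.elim0, fun i => i.elim0, by simp⟩
  | succ n ih =>
    obtain ⟨κ', C', hκ', hC', ih⟩ := ih
    refine ⟨κ' / (2 * κ' + n + 2), 4 / 3 * C' + 1, by positivity, by linarith, fun G hG => ?_⟩
    obtain ⟨U1, V1, hUV1, hmin⟩ : ∃ U V : Mat (n+1), U * V = 1 ∧
        ∀ U' V' : Mat (n+1), U' * V' = 1 → (U * G * Uᵀ) 0 0 ≤ (U' * G * U'ᵀ) 0 0 := by
      let P : ℕ → Prop := fun k => ∃ U V : Mat (n+1), U * V = 1 ∧ (U * G * Uᵀ) 0 0 = k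
      have hP : ∃ k, P k := by
        have := pd_diag hG 0
        exact ⟨(G 0 0).toNat, 1, 1, by simp, by simp; omega⟩
      classical
      obtain ⟨U, V, hUV, hk⟩ := Nat.find_spec hP
      refine ⟨U, V, hUV, fun U' V' h' => ?_⟩
      have h1 := pd_diag (pd_conj hG h') 0
      have : Nat.find hP ≤ ((U' * G * U'ᵀ) 0 0).toNat := Nat.find_min' hP ⟨U', V', h', by omega⟩
      rw [hk]; omega
    set G1 := U1 * G * U1ᵀ with hG1
    have hp1 : PosDefInt G1 := pd_conj hG hUV1
    have hmin1 : ∀ U' V' : Mat (n+1), U' * V' = 1 → G1 0 0 ≤ (U' * G1 * U'ᵀ) 0 0 := by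
      intro U' V' h
      have := hmin (U' * U1) (V1 * V') (by
        calc U' * U1 * (V1 * V') = U' * (U1 * V1) * V' := by simp only [Matrix.mul_assoc]
          _ = 1 := by rw [hUV1, Matrix.mul_one, h])
      have e : U' * G1 * U'ᵀ = U' * U1 * G * (U' * U1)ᵀ := by
        rw [hG1]; simp only [Matrix.transpose_mul, Matrix.mul_assoc]
      rw [e]; exact this
    set a := G1 0 0 with ha
    have ha0 : 0 < a := pd_diag hp1 0
    set g : Fin n → ℤ := fun j => G1 0 j.succ with hg
    set G'' := G1.submatrix Fin.succ Fin.succ with hG''d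
    set G' : Mat n := a • G'' - Matrix.vecMulVec g g with hG'
    have hG'q : ∀ x y, x ⬝ᵥ G' *ᵥ y = a * (x ⬝ᵥ G'' *ᵥ y) - (g ⬝ᵥ x) * (g ⬝ᵥ y) := by
      intro x y
      rw [hG', Matrix.sub_mulVec, dotProduct_sub, Matrix.smul_mulVec, dotProduct_smul, smul_eq_mul,
        Matrix.vecMulVec_mulVec]
      congr 1
      simp only [dotProduct, Pi.smul_apply, MulOpposite.smul_eq_mul_unop, MulOpposite.unop_op,
        Finset.sum_mul]
      apply Finset.sum_congr rfl; intro i _; ring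
    have hG'' : G''.IsSymm := by ext i j; exact hp1.1.apply _ _
    have hpG' : PosDefInt G' := by
      constructor
      · ext i j
        have := hG''.apply i j
        simp only [hG', Matrix.transpose_apply, Matrix.sub_apply, Matrix.smul_apply, vecMulVec_apply, this]
        ring
      · intro v hv
        have := hp1.2 (Fin.cons (-(g ⬝ᵥ v)) (a • v)) (by
          intro h
          apply hv
          ext i
          have := congrFun h i.succ
          simpa [ha0.ne'] using this)
        rw [bil_cons _ hp1.1] at this
        rw [hG'q]
        simp only [dotProduct_smul, smul_dotProduct, Matrix.mulVec_smul, smul_eq_mul] at this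
        refine pos_of_mul_pos_right (a := a) ?_ ha0.le
        nlinarith
    obtain ⟨U', V', hUV', hred⟩ := ih G' hpG'
    set u : Fin n → ℤ := U' *ᵥ g with hu
    set m : Fin n → ℤ := fun i => round ((u i : ℚ) / a) with hm
    set h : Fin n → ℤ := fun i => u i - m i * a with hh
    set U2 : Mat (n+1) := Matrix.of (Fin.cons (Fin.cons 1 0) (fun i => Fin.cons (-m i) (U' i))) with hU2
    set V2 : Mat (n+1) := Matrix.of (Fin.cons (Fin.cons 1 0) (fun i => Fin.cons ((V' *ᵥ m) i) (V' i))) with hV2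
    have hUV2 : U2 * V2 = 1 := by
      ext i j
      rw [Matrix.mul_apply, Fin.sum_univ_succ]
      refine Fin.cases ?_ (fun i => ?_) i
      · refine Fin.cases ?_ (fun j => ?_) j
        · simp [hU2, hV2]
        · simp [hU2, hV2, Ne.symm (Fin.succ_ne_zero j), Matrix.one_apply]
      · refine Fin.cases ?_ (fun j => ?_) j
        · have : (U' *ᵥ (V' *ᵥ m)) i = m i := by rw [Matrix.mulVec_mulVec, hUV', Matrix.one_mulVec]
          simp only [mulVec, dotProduct] at this
          simp [hU2, hV2, Matrix.one_apply, mulVec, dotProduct, this]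
        · have : (U' * V') i j = (1 : Mat n) i j := by rw [hUV']
          rw [Matrix.mul_apply] at this
          simp [hU2, hV2, this, Matrix.one_apply]
    have r0 : U2 0 = (Fin.cons 1 0 : Fin (n+1) → ℤ) := rfl
    have rs : ∀ i : Fin n, U2 i.succ = (Fin.cons (-m i) (U' i) : Fin (n+1) → ℤ) := fun i => rfl
    have gu : ∀ i, g ⬝ᵥ U' i = u i := by intro i; rw [dotProduct_comm]; rfl
    set G2 := U2 * G1 * U2ᵀ with hG2
    have hp2 : PosDefInt G2 := pd_conj hp1 hUV2
    have e00 : G2 0 0 = a := by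
      rw [hG2, conj_apply, r0, bil_cons _ hp1.1]; simp [ha]
    have e0s : ∀ j : Fin n, G2 0 j.succ = h j := by
      intro j
      rw [hG2, conj_apply, r0, rs, bil_cons _ hp1.1]
      have := gu j
      simp only [hg] at this
      simp [hh, ← ha, this]; ring
    have ess : ∀ i j : Fin n, a * G2 i.succ j.succ = (U' * G' * U'ᵀ) i j + h i * h j := by
      intro i j
      rw [hG2, conj_apply, conj_apply, rs, rs, bil_cons _ hp1.1, hG'q]
      have h1 := gu i
      have h2 := gu j
      rw [h1, h2]
      simp only [hh, ← ha, ← hG''d]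
      ring
    refine ⟨U2 * U1, V1 * V2, ?_, ?_⟩
    · calc U2 * U1 * (V1 * V2) = U2 * (U1 * V1) * V2 := by simp only [Matrix.mul_assoc]
        _ = 1 := by rw [hUV1, Matrix.mul_one, hUV2]
    · have e : U2 * U1 * G * (U2 * U1)ᵀ = G2 := by
        rw [hG2, hG1]; simp [Matrix.transpose_mul, Matrix.mul_assoc]
      rw [e]
      refine red_step hκ' hC' hred (h := fun j => (h j : ℚ)) (a := a) (by exact_mod_cast ha0) ?_ ?_ ?_ ?_ ?_ ?_
      · simp [e00]
      · intro j; simp [e0s]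
      · intro j; simp only [Matrix.map_apply]; rw [← e0s, hp2.1.apply]
      · intro i j; simp only [Matrix.map_apply]; exact_mod_cast ess i j
      · intro j; exact round_near a (u j) ha0
      · intro j
        simp only [Matrix.map_apply]
        have := hmin1 (U2.submatrix (Equiv.swap 0 j.succ) id) (V2.submatrix id (Equiv.swap 0 j.succ)) (by
          rw [← Matrix.submatrix_mul _ _ _ _ _ Function.bijective_id, hUV2]
          simp)
        rw [conj_apply] at this
        have e3 : (U2.submatrix (Equiv.swap 0 j.succ) id) 0 = U2 j.succ := by ext k; simp
        rw [e3, ← conj_apply] at this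
        exact_mod_cast this

end ExcAux

namespace ExcAux

/-- Box of integral vectors. -/
abbrev Box (n : ℕ) (R : ℤ) : Type :=
  {x : Fin n → ℤ // x ∈ Fintype.piFinset fun _ : Fin n => Finset.Icc (-R) R}

theorem decomp (n : ℕ) : ∃ R B : ℤ, ∀ G : Mat n, PosDefInt G →
    ∃ (U V : Mat n) (f : Fin n → Fin n → Finset.Icc (-B) B) (a : Box n R → ℕ), U * V = 1 ∧
      ∀ i j, (U * G * Uᵀ) i j = (f i j : ℤ) + ∑ x : Box n R, (a x : ℤ) * (x.1 i * x.1 j) := by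
  obtain ⟨κ, C, hκ, hC, hred⟩ := reduction n
  obtain ⟨R, hR0, hR⟩ := red_cone n κ C hκ hC
  refine ⟨R, Fintype.card (Box n R) * R ^ 2, fun G hG => ?_⟩
  obtain ⟨U, V, hUV, hr⟩ := hred G hG
  have hc := hR _ hr
  have hset : {G : Matrix (Fin n) (Fin n) ℚ | ∃ x : Fin n → ℤ, (∀ i, |x i| ≤ R) ∧
      G = Matrix.of fun i j => (x i : ℚ) * x j} =
      Set.range (fun x : Box n R => (Matrix.of fun i j => (x.1 i : ℚ) * x.1 j : Matrix (Fin n) (Fin n) ℚ)) := by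
    ext G
    constructor
    · rintro ⟨x, hx, rfl⟩
      exact ⟨⟨x, by simp only [Fintype.mem_piFinset, Finset.mem_Icc]; exact fun i => abs_le.1 (hx i)⟩, rfl⟩
    · rintro ⟨⟨x, hx⟩, rfl⟩
      simp only [Fintype.mem_piFinset, Finset.mem_Icc] at hx
      exact ⟨x, fun i => abs_le.2 (hx i), rfl⟩
  rw [Cone, hset, Submodule.mem_span_range_iff_exists_fun] at hc
  obtain ⟨c, hc⟩ := hc
  have hent : ∀ i j, ((U * G * Uᵀ) i j : ℚ) = ∑ x : Box n R, (c x : ℚ) * ((x.1 i : ℚ) * x.1 j) := by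
    intro i j
    have := congrFun (congrFun hc i) j
    rw [Matrix.sum_apply] at this
    simp only [Matrix.map_apply] at this
    rw [← this]
    rfl
  obtain ⟨a, ha⟩ : ∃ a : Box n R → ℕ, ∀ x, (a x : ℚ) ≤ c x ∧ (c x : ℚ) < a x + 1 :=
    ⟨fun x => ⌊c x⌋₊, fun x => ⟨by exact_mod_cast Nat.floor_le (zero_le (a := c x)),
      by exact_mod_cast Nat.lt_floor_add_one (c x)⟩⟩
  have hbound : ∀ i j, |(U * G * Uᵀ) i j - ∑ x : Box n R, (a x : ℤ) * (x.1 i * x.1 j)| ≤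
      Fintype.card (Box n R) * R ^ 2 := by
    intro i j
    have : |((U * G * Uᵀ) i j : ℚ) - ∑ x : Box n R, (a x : ℚ) * ((x.1 i : ℚ) * x.1 j)| ≤
      Fintype.card (Box n R) * (R : ℚ) ^ 2 := by
      rw [hent, ← Finset.sum_sub_distrib]
      refine (Finset.abs_sum_le_sum_abs _ _).trans ?_
      rw [← nsmul_eq_mul, ← Finset.card_univ]
      apply Finset.sum_le_card_nsmul
      intro x _
      have hx := x.2
      simp only [Fintype.mem_piFinset, Finset.mem_Icc] at hx
      have h1 : |(x.1 i : ℚ)| ≤ R := by exact_mod_cast abs_le.2 (hx i)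
      have h2 : |(x.1 j : ℚ)| ≤ R := by exact_mod_cast abs_le.2 (hx j)
      rw [← sub_mul, abs_mul, abs_mul]
      have h3 : |(c x : ℚ) - a x| ≤ 1 := by
        have h4 := (ha x).1
        have h5 := (ha x).2
        rw [abs_le]; constructor <;> linarith
      calc _ ≤ 1 * ((R : ℚ) * R) := by gcongr
        _ = _ := by ring
    rw [← Int.cast_le (R := ℚ)]
    push_cast
    exact this
  refine ⟨U, V, fun i j => ⟨_, Finset.mem_Icc.2 (abs_le.1 (hbound i j))⟩, a, hUV, ?_⟩
  intro i j
  simp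

theorem wqo_basis {α A ι : Type*} [Finite A] [Finite ι] (S : Set α) (k1 : α → A) (k2 : α → ι → ℕ) :
    ∃ S0 : Finset α, (∀ x ∈ S0, x ∈ S) ∧ ∀ M ∈ S, ∃ M0 ∈ S0, k1 M0 = k1 M ∧ ∀ i, k2 M0 i ≤ k2 M i := by
  by_contra hcon
  push Not at hcon
  obtain ⟨f, hf, hbad⟩ := exists_seq_of_forall_finset_exists (fun x => x ∈ S)
    (fun x y => ¬ (k1 x = k1 y ∧ ∀ i, k2 x i ≤ k2 y i)) (by
      intro s hs
      obtain ⟨M, hM, h⟩ := hcon s hs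
      refine ⟨M, hM, fun x hx hxy => ?_⟩
      obtain ⟨i, hi⟩ := h x hx hxy.1
      exact absurd (hxy.2 i) (not_le.2 hi))
  have hw1 : WellQuasiOrdered (fun a b : A => a = b) := Finite.wellQuasiOrdered _
  have hw2 : WellQuasiOrdered (fun a b : ι → ℕ => ∀ i, a i ≤ b i) :=
    WellQuasiOrdered.pi (r := fun _ => (· ≤ ·)) fun _ => wellQuasiOrdered_le
  haveI : IsPreorder A (fun a b : A => a = b) :=
    { refl := fun _ => rfl, trans := fun _ _ _ h1 h2 => h1.trans h2 }
  obtain ⟨m, n, hmn, h⟩ := (hw1.prod hw2) (fun t => (k1 (f t), k2 (f t)))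
  exact hbad m n hmn h

theorem finite_basis (n b : ℕ) (hb : 0 < b) : ∃ K : ℕ, ∀ S : Set (QLat n),
    ∃ S0 : Finset (QLat n), (∀ x ∈ S0, x ∈ S) ∧ ∀ M ∈ S, ∃ M0 ∈ S0, ∃ T : Mat n,
      ∃ y : Fin K → Fin n → ℤ,
        M.1 = T * M0.1 * Tᵀ + ∑ i, (b : ℤ) • Matrix.vecMulVec (y i) (y i) := by
  obtain ⟨R, B, hdec⟩ := decomp n
  refine ⟨Fintype.card (Box n R × Fin 4), fun S => ?_⟩
  choose U V f a hUV hG using fun G : QLat n => hdec G.1 G.2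
  obtain ⟨S0, hS0, hbas⟩ := wqo_basis S
    (fun G => (f G, fun x => (⟨a G x % b, Nat.mod_lt _ hb⟩ : Fin b))) a
  refine ⟨S0, hS0, fun M hM => ?_⟩
  obtain ⟨M0, hM0, hkey, hle⟩ := hbas M hM
  simp only [Prod.mk.injEq] at hkey
  obtain ⟨hf, hres⟩ := hkey
  have hd : ∀ x, ∃ d : ℕ, a M x = a M0 x + b * d := by
    intro x
    have h1 := congrFun hres x
    simp only [Fin.mk.injEq] at h1
    have h2 : (a M0 x) ≡ (a M x) [MOD b] := h1
    obtain ⟨d, hd⟩ := (Nat.modEq_iff_dvd' (hle x)).1 h2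
    have := hle x
    exact ⟨d, by omega⟩
  choose d hd using hd
  have hs : ∀ x, ∃ s : Fin 4 → ℕ, ∑ k, s k ^ 2 = d x := by
    intro x
    obtain ⟨p, q, r, t, h⟩ := Nat.sum_four_squares (d x)
    exact ⟨![p, q, r, t], by simp [Fin.sum_univ_four, h]⟩
  choose s hs using hs
  have hVU : V M * U M = 1 := mul_eq_one_comm.1 (hUV M)
  let e := Fintype.equivFin (Box n R × Fin 4)
  let w : Box n R × Fin 4 → Fin n → ℤ := fun p => (s p.1 p.2 : ℤ) • p.1.1
  refine ⟨M0, hM0, V M * U M0, fun i => V M *ᵥ w (e.symm i), ?_⟩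
  have e1 : ∑ i, (b : ℤ) • Matrix.vecMulVec (V M *ᵥ w (e.symm i)) (V M *ᵥ w (e.symm i)) =
      ∑ p, (b : ℤ) • Matrix.vecMulVec (V M *ᵥ w p) (V M *ᵥ w p) :=
    Equiv.sum_comp e.symm (fun p => (b : ℤ) • Matrix.vecMulVec (V M *ᵥ w p) (V M *ᵥ w p))
  rw [e1]
  have e2 : ∀ p, Matrix.vecMulVec (V M *ᵥ w p) (V M *ᵥ w p) = V M * Matrix.vecMulVec (w p) (w p) * (V M)ᵀ := by
    intro p
    rw [Matrix.mul_vecMulVec, Matrix.vecMulVec_mul, Matrix.vecMul_transpose]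
  have e3 : U M * M.1 * (U M)ᵀ = U M0 * M0.1 * (U M0)ᵀ + ∑ p, (b : ℤ) • Matrix.vecMulVec (w p) (w p) := by
    ext i j
    rw [Matrix.add_apply, hG, hG, hf, Matrix.sum_apply, add_assoc]
    congr 1
    rw [Fintype.sum_prod_type, ← Finset.sum_add_distrib]
    apply Finset.sum_congr rfl
    intro x _
    simp only [Matrix.smul_apply, vecMulVec_apply, w, Pi.smul_apply, smul_eq_mul]
    rw [hd x, ← hs x]
    push_cast
    rw [Finset.mul_sum, add_mul, Finset.sum_mul]
    congr 1
    apply Finset.sum_congr rfl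
    intro k _
    ring
  calc M.1 = (V M * U M) * M.1 * (V M * U M)ᵀ := by rw [hVU]; simp
    _ = V M * (U M * M.1 * (U M)ᵀ) * (V M)ᵀ := by simp only [Matrix.transpose_mul, Matrix.mul_assoc]
    _ = _ := by
      rw [e3, Matrix.mul_add, Matrix.add_mul, Matrix.mul_sum, Matrix.sum_mul]
      congr 1
      · simp only [Matrix.transpose_mul, Matrix.mul_assoc]
      · apply Finset.sum_congr rfl
        intro p _
        rw [e2, Matrix.mul_smul, Matrix.smul_mul]

end ExcAux

namespace ExcAux

theorem ortho2 {p q : ℕ} (A : QLat p) (B : QLat q) : ∃ L : QLat (p + q), ∀ (r : ℕ) (N : Mat r),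
    Represents L.1 N ↔ ∃ P Q : Mat r, Represents A.1 P ∧ Represents B.1 Q ∧ N = P + Q := by
  let L : Mat (p + q) := (Matrix.fromBlocks A.1 0 0 B.1).submatrix finSumFinEquiv.symm finSumFinEquiv.symm
  have key : ∀ (r : ℕ) (T1 : Matrix (Fin r) (Fin p) ℤ) (T2 : Matrix (Fin r) (Fin q) ℤ),
      ((Matrix.fromCols T1 T2).submatrix id finSumFinEquiv.symm) * L *
        ((Matrix.fromCols T1 T2).submatrix id finSumFinEquiv.symm)ᵀ = T1 * A.1 * T1ᵀ + T2 * B.1 * T2ᵀ := by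
    intro r T1 T2
    rw [Matrix.transpose_submatrix, Matrix.submatrix_mul_equiv, Matrix.submatrix_mul_equiv,
      Matrix.fromCols_mul_fromBlocks, Matrix.transpose_fromCols, Matrix.fromCols_mul_fromRows]
    simp
  have hT : ∀ (r : ℕ) (T : Matrix (Fin r) (Fin (p + q)) ℤ),
      T = (Matrix.fromCols (T.submatrix id (Fin.castAdd q)) (T.submatrix id (Fin.natAdd p))).submatrix id
        finSumFinEquiv.symm := by
    intro r T
    ext i j
    refine Fin.addCases (fun j => ?_) (fun j => ?_) j <;> simp
  have hL : PosDefInt L := by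
    constructor
    · ext i j
      refine Fin.addCases (fun j => ?_) (fun j => ?_) j <;>
      refine Fin.addCases (fun i => ?_) (fun i => ?_) i <;> simp [L]
      · exact A.2.1.apply _ _
      · exact B.2.1.apply _ _
    · intro v hv
      have h1 := conj_apply (m := 1) (Matrix.of fun _ => v) L 0 0
      rw [hT 1 (Matrix.of fun _ => v), key, ← hT 1 (Matrix.of fun _ => v), Matrix.add_apply,
        conj_apply, conj_apply] at h1
      have e : (Matrix.of fun (_ : Fin 1) => v) 0 = v := rfl
      rw [e] at h1
      rw [← h1]
      set v1 : Fin p → ℤ := ((Matrix.of fun (_ : Fin 1) => v).submatrix id (Fin.castAdd q)) 0 with hv1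
      set v2 : Fin q → ℤ := ((Matrix.of fun (_ : Fin 1) => v).submatrix id (Fin.natAdd p)) 0 with hv2
      have n1 : 0 ≤ v1 ⬝ᵥ A.1 *ᵥ v1 := by
        by_cases h : v1 = 0
        · simp [h]
        · exact (A.2.2 v1 h).le
      have n2 : 0 ≤ v2 ⬝ᵥ B.1 *ᵥ v2 := by
        by_cases h : v2 = 0
        · simp [h]
        · exact (B.2.2 v2 h).le
      by_cases h : v1 = 0
      · have : v2 ≠ 0 := by
          intro h'
          apply hv
          ext j
          refine Fin.addCases (fun j => ?_) (fun j => ?_) j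
          · exact congrFun h j
          · exact congrFun h' j
        have := B.2.2 v2 this
        linarith
      · have := A.2.2 v1 h
        linarith
  refine ⟨⟨L, hL⟩, fun r N => ⟨?_, ?_⟩⟩
  · rintro ⟨T, hTN⟩
    refine ⟨_, _, ⟨T.submatrix id (Fin.castAdd q), rfl⟩, ⟨T.submatrix id (Fin.natAdd p), rfl⟩, ?_⟩
    rw [← key, ← hT]; exact hTN.symm
  · rintro ⟨P, Q, ⟨T1, h1⟩, ⟨T2, h2⟩, rfl⟩
    exact ⟨_, (key r T1 T2).trans (by rw [h1, h2])⟩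

theorem pd_one (k : ℕ) : PosDefInt (1 : Mat k) := by
  refine ⟨Matrix.isSymm_one, fun v hv => ?_⟩
  rw [Matrix.one_mulVec]
  have h0 : 0 ≤ v ⬝ᵥ v := Finset.sum_nonneg fun i _ => mul_self_nonneg _
  exact lt_of_le_of_ne h0 (fun h => hv (dotProduct_self_eq_zero.1 h.symm))

theorem ortho {n : ℕ} (k s : ℕ) (f : Fin s → QLat n) : ∃ (r : ℕ) (L : QLat r),
    ∀ (q : ℕ) (N : Mat q), Represents L.1 N ↔ ∃ (P0 : Mat q) (P : Fin s → Mat q),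
      Represents (1 : Mat k) P0 ∧ (∀ i, Represents (f i).1 (P i)) ∧ N = P0 + ∑ i, P i := by
  induction s with
  | zero =>
    refine ⟨k, ⟨1, pd_one k⟩, fun q N => ⟨fun h => ⟨N, fun i => i.elim0, h, fun i => i.elim0, by simp⟩, ?_⟩⟩
    rintro ⟨P0, P, h0, _, rfl⟩
    simpa using h0
  | succ s ih =>
    obtain ⟨r, L, hL⟩ := ih (fun i => f i.castSucc)
    obtain ⟨L', hL'⟩ := ortho2 L (f (Fin.last s))
    refine ⟨_, L', fun q N => ?_⟩
    rw [hL']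
    constructor
    · rintro ⟨P, Q, hP, hQ, rfl⟩
      obtain ⟨P0, P', h0, h1, rfl⟩ := (hL q P).1 hP
      refine ⟨P0, Fin.snoc (α := fun _ => Mat q) P' Q, h0, ?_, ?_⟩
      · intro i
        refine Fin.lastCases ?_ (fun i => ?_) i
        · simpa using hQ
        · simpa using h1 i
      · rw [Fin.sum_univ_castSucc]; simp [add_assoc]
    · rintro ⟨P0, P, h0, h1, rfl⟩
      refine ⟨P0 + ∑ i : Fin s, P i.castSucc, P (Fin.last s), (hL q _).2 ⟨P0, _, h0, fun i => h1 _, rfl⟩, h1 _, ?_⟩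
      rw [Fin.sum_univ_castSucc, add_assoc]

end ExcAux

namespace ExcAux

/-- Positive semidefinite integral matrices. -/
def Psd {n : ℕ} (W : Mat n) : Prop := W.IsSymm ∧ ∀ v : Fin n → ℤ, 0 ≤ v ⬝ᵥ W *ᵥ v

theorem psd_of_pd {n : ℕ} {W : Mat n} (h : PosDefInt W) : Psd W := by
  refine ⟨h.1, fun v => ?_⟩
  by_cases hv : v = 0
  · simp [hv]
  · exact (h.2 v hv).le

theorem psd_conj {m n : ℕ} {W : Mat n} (h : Psd W) (U : Matrix (Fin m) (Fin n) ℤ) :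
    Psd (U * W * Uᵀ) := by
  refine ⟨symm_conj h.1 U, fun v => ?_⟩
  rw [quad_conj]; exact h.2 _

theorem psd_rep {m n : ℕ} {L : Mat m} {W : Mat n} (h : Psd L) (hr : Represents L W) : Psd W := by
  obtain ⟨T, rfl⟩ := hr
  exact psd_conj h T

theorem bil_symm {n : ℕ} {W : Mat n} (h : W.IsSymm) (u v : Fin n → ℤ) :
    u ⬝ᵥ W *ᵥ v = v ⬝ᵥ W *ᵥ u := by
  rw [Matrix.dotProduct_mulVec, ← Matrix.mulVec_transpose, h.eq, dotProduct_comm]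

theorem psd_null {n : ℕ} {W : Mat n} (h : Psd W) {v : Fin n → ℤ} (hv : v ⬝ᵥ W *ᵥ v = 0) :
    W *ᵥ v = 0 := by
  have key : ∀ u, u ⬝ᵥ W *ᵥ v = 0 := by
    intro u
    by_contra hne
    have h1 := h.2 u
    have h2 := h.2 ((-(u ⬝ᵥ W *ᵥ u + 1) * (u ⬝ᵥ W *ᵥ v)) • v + u)
    have h3 := bil_symm h.1 v u
    simp only [Matrix.mulVec_add, Matrix.mulVec_smul, dotProduct_add, add_dotProduct, smul_dotProduct,
      dotProduct_smul, smul_eq_mul, hv, h3] at h2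
    set p := u ⬝ᵥ W *ᵥ u
    set q := u ⬝ᵥ W *ᵥ v
    have h4 : 1 ≤ q ^ 2 := by
      have : 0 < q ^ 2 := by positivity
      linarith
    nlinarith
  ext i
  have := key (Pi.single i 1)
  simpa using this

theorem psd_zero_diag {n : ℕ} {W : Mat n} (h : Psd W) {i : Fin n} (hi : W i i = 0) (j : Fin n) :
    W i j = 0 ∧ W j i = 0 := by
  have := psd_null h (v := Pi.single i 1) (by simpa using hi)
  have h2 := congrFun this j
  simp at h2
  exact ⟨by rw [← h.1.apply]; exact h2, h2⟩

theorem psd_diag {n : ℕ} {W : Mat n} (h : Psd W) (i : Fin n) : 0 ≤ W i i := by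
  have := h.2 (Pi.single i 1)
  simpa using this

theorem psd_add {n : ℕ} {W V : Mat n} (h : Psd W) (h' : Psd V) : Psd (W + V) := by
  refine ⟨h.1.add h'.1, fun v => ?_⟩
  rw [Matrix.add_mulVec, dotProduct_add]
  exact add_nonneg (h.2 v) (h'.2 v)

theorem psd_one (n : ℕ) : Psd (1 : Mat n) := psd_of_pd (pd_one n)

theorem pd_of_psd {n : ℕ} {W : Mat n} (h : Psd W) (hd : W.det ≠ 0) : PosDefInt W := by
  refine ⟨h.1, fun v hv => lt_of_le_of_ne (h.2 v) fun h0 => hd ?_⟩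
  exact Matrix.exists_mulVec_eq_zero_iff.1 ⟨v, hv, psd_null h h0.symm⟩

theorem pd_det {n : ℕ} {W : Mat n} (h : PosDefInt W) : W.det ≠ 0 := by
  intro h0
  obtain ⟨v, hv, h1⟩ := Matrix.exists_mulVec_eq_zero_iff.2 h0
  have := h.2 v hv
  rw [h1] at this
  simp at this

/-- Bordered Gram matrices of the root lattice `A_k`. -/
def Bord {k : ℕ} (W : Mat (k+1)) : Prop :=
  W.IsSymm ∧ ∀ i j : Fin k, W i.succ j.succ = 1 + if i = j then 1 else 0

theorem det_ones (k : ℕ) : (Matrix.of fun i j : Fin k => (1 + if i = j then 1 else 0 : ℤ)).det = k + 1 := by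
  have e : (Matrix.of fun i j : Fin k => (1 + if i = j then 1 else 0 : ℤ)) =
      1 + Matrix.replicateCol Unit (fun _ => (1:ℤ)) * Matrix.replicateRow Unit (fun _ => (1:ℤ)) := by
    ext i j
    simp [Matrix.mul_apply, Matrix.one_apply, add_comm]
  rw [e, Matrix.det_one_add_replicateCol_mul_replicateRow]
  simp [dotProduct, add_comm]

theorem det_corner {k : ℕ} {W W' : Mat (k+1)} (hW : Bord W)
    (h : ∀ a b, (a ≠ 0 ∨ b ≠ 0) → W' a b = W a b) :
    W'.det = W.det + (W' 0 0 - W 0 0) * (k + 1) := by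
  rw [Matrix.det_succ_row_zero, Matrix.det_succ_row_zero, Fin.sum_univ_succ, Fin.sum_univ_succ]
  have e1 : W.submatrix Fin.succ (Fin.succAbove 0) =
      (Matrix.of fun i j : Fin k => (1 + if i = j then 1 else 0 : ℤ)) := by
    ext i j; simp [hW.2]
  have e2 : W'.submatrix Fin.succ (Fin.succAbove 0) =
      (Matrix.of fun i j : Fin k => (1 + if i = j then 1 else 0 : ℤ)) := by
    rw [← e1]; ext i j; exact h _ _ (Or.inl (Fin.succ_ne_zero i))
  rw [e1, e2, det_ones]
  have e3 : ∀ j : Fin k, W'.submatrix Fin.succ (Fin.succAbove j.succ) =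
      W.submatrix Fin.succ (Fin.succAbove j.succ) := by
    intro j; ext a b; exact h _ _ (Or.inl (Fin.succ_ne_zero a))
  have e4 : ∀ j : Fin k, W' 0 j.succ = W 0 j.succ := fun j => h _ _ (Or.inr (Fin.succ_ne_zero j))
  simp only [e3, e4, Fin.val_zero, pow_zero, one_mul]
  ring

theorem single_component {k : ℕ} (hk : 1 ≤ k) {ι : Type*} [Fintype ι] [DecidableEq ι]
    (W : ι → Mat (k+1)) (hp : ∀ i, Psd (W i)) {Wt : Mat (k+1)} (hsum : Wt = ∑ i, W i) (hB : Bord Wt)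
    (hd : ∀ t : Fin k, ∃ i, ∀ l, l ≠ i → W l t.succ t.succ = 0) :
    ∃ i, ∀ a b, (a ≠ 0 ∨ b ≠ 0) → Wt a b = W i a b := by
  choose idx hidx using hd
  have hrow : ∀ t : Fin k, ∀ l, l ≠ idx t → ∀ b, W l t.succ b = 0 ∧ W l b t.succ = 0 :=
    fun t l hl b => psd_zero_diag (hp l) (hidx t l hl) b
  have hconst : ∀ t t' : Fin k, idx t = idx t' := by
    intro t t'
    by_contra hne
    have htt : t ≠ t' := fun h => hne (by rw [h])
    have h1 := hB.2 t t'
    rw [hsum, Matrix.sum_apply] at h1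
    rw [Finset.sum_eq_zero] at h1
    · simp [htt] at h1
    · intro l _
      by_cases hl : l = idx t
      · exact (hrow t' l (by rw [hl]; exact hne) _).2
      · exact (hrow t l hl _).1
  let t0 : Fin k := ⟨0, hk⟩
  refine ⟨idx t0, fun a b hab => ?_⟩
  rw [hsum, Matrix.sum_apply]
  apply Finset.sum_eq_single
  · intro l _ hl
    rcases hab with h | h
    · obtain ⟨t, rfl⟩ := Fin.exists_succ_eq.2 h
      exact (hrow t l (by rw [hconst t t0]; exact hl) b).1
    · obtain ⟨t, rfl⟩ := Fin.exists_succ_eq.2 h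
      exact (hrow t l (by rw [hconst t t0]; exact hl) a).2
  · simp

theorem lemG {k s : ℕ} (hk : 1 ≤ k) (W0 : Mat (k+1)) (W : Fin s → Mat (k+1)) (hp0 : Psd W0)
    (hd0 : W0.det = 0) (hp : ∀ i, Psd (W i)) (hne : ∀ i t, W i t t ≠ 1) {Wt : Mat (k+1)}
    (hsum : Wt = W0 + ∑ i, W i) (hB : Bord Wt) (hdet : ¬ ((k:ℤ)+1) ∣ Wt.det) :
    ∃ i, Bord (W i) ∧ ¬ ((k:ℤ)+1) ∣ (W i).det ∧ W i 0 0 ≤ Wt 0 0 ∧ (W i 0 0 = Wt 0 0 → W i = Wt) := by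
  classical
  let V : Option (Fin s) → Mat (k+1) := fun o => o.elim W0 W
  have hV : ∀ o, Psd (V o) := by
    rintro (_ | i)
    · exact hp0
    · exact hp i
  have hVs : Wt = ∑ o, V o := by rw [Fintype.sum_option]; exact hsum
  obtain ⟨o, ho⟩ := single_component hk V hV hVs hB (by
    intro t
    have h2 := hB.2 t t
    rw [hVs, Matrix.sum_apply] at h2
    simp only [if_true] at h2
    have hnn : ∀ o, 0 ≤ V o t.succ t.succ := fun o => psd_diag (hV o) _
    by_cases hex : ∃ i, W i t.succ t.succ ≠ 0
    · obtain ⟨i, hi⟩ := hex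
      refine ⟨some i, fun l hl => ?_⟩
      have h3 := Finset.sum_le_sum_of_subset_of_nonneg (f := fun o => V o t.succ t.succ)
        (Finset.subset_univ {some i, l}) (fun o _ _ => hnn o)
      rw [Finset.sum_pair (Ne.symm hl), h2] at h3
      have h4 : 0 ≤ W i t.succ t.succ := hnn (some i)
      have h5 := hne i t.succ
      have h6 := hnn l
      have h7 : V (some i) t.succ t.succ = W i t.succ t.succ := rfl
      rw [h7] at h3
      omega
    · push Not at hex
      refine ⟨none, ?_⟩
      rintro (_ | l) hl
      · exact absurd rfl hl
      · exact hex l)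
  have hle : V o 0 0 ≤ Wt 0 0 := by
    rw [hVs, Matrix.sum_apply]
    exact Finset.single_le_sum (f := fun o => V o 0 0) (fun o _ => psd_diag (hV o) 0) (Finset.mem_univ o)
  have hBo : Bord (V o) := ⟨(hV o).1, fun i j => by rw [← ho _ _ (Or.inl (Fin.succ_ne_zero i))]; exact hB.2 i j⟩
  have hdo := det_corner hBo ho
  have hnd : ¬ ((k:ℤ)+1) ∣ (V o).det := by
    intro h
    apply hdet
    rw [hdo]
    exact dvd_add h (dvd_mul_left _ _)
  rcases o with _ | i
  · exact absurd (by rw [show V none = W0 from rfl, hd0]; exact dvd_zero _) hnd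
  · refine ⟨i, hBo, hnd, hle, fun h => ?_⟩
    ext a b
    by_cases hab : a ≠ 0 ∨ b ≠ 0
    · exact (ho a b hab).symm
    · push Not at hab
      rw [hab.1, hab.2]; exact h

end ExcAux

namespace ExcAux

theorem rep_zero {m n : ℕ} (L : Mat m) : Represents L (0 : Mat n) := ⟨0, by simp⟩

theorem pd_smul_one (n b : ℕ) (hb : 0 < b) : PosDefInt ((b:ℤ) • (1 : Mat n)) := by
  refine ⟨?_, fun v hv => ?_⟩
  · simp [Matrix.IsSymm]
  · have := (pd_one n).2 v hv
    rw [Matrix.smul_mulVec, dotProduct_smul, smul_eq_mul]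
    exact mul_pos (by exact_mod_cast hb) this

theorem rep_rank_one {n q : ℕ} (hn : 0 < n) (b : ℤ) (y : Fin q → ℤ) :
    Represents (b • (1 : Mat n)) (b • Matrix.vecMulVec y y) := by
  refine ⟨Matrix.vecMulVec y (Pi.single ⟨0, hn⟩ 1), ?_⟩
  rw [Matrix.mul_smul, Matrix.smul_mul, Matrix.mul_one]
  congr 1
  ext i j
  simp [Matrix.mul_apply, Matrix.vecMulVec_apply, Pi.single_apply]

theorem build {n b : ℕ} (hn : 0 < n) (hb : 0 < b) (S : Set (QLat n))
    (hS : (⟨(b:ℤ) • (1 : Mat n), pd_smul_one n b hb⟩ : QLat n) ∈ S) :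
    ∃ (s : ℕ) (f : Fin s → QLat n), (∀ i, f i ∈ S) ∧ ∀ M ∈ S, ∀ (q : ℕ) (N : Mat q),
      Represents M.1 N → ∃ P : Fin s → Mat q, (∀ i, Represents (f i).1 (P i)) ∧ N = ∑ i, P i := by
  classical
  obtain ⟨K, hK⟩ := finite_basis n b hb
  obtain ⟨S0, h0, h1⟩ := hK S
  let e := S0.equivFin
  let g : Fin S0.card → QLat n := fun i => (e.symm i).1
  let d : Fin K → QLat n := fun _ => ⟨(b:ℤ) • (1 : Mat n), pd_smul_one n b hb⟩
  refine ⟨S0.card + K, Fin.append g d, ?_, ?_⟩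
  · intro i
    refine Fin.addCases (fun i => ?_) (fun i => ?_) i
    · rw [Fin.append_left]; exact h0 _ (e.symm i).2
    · rw [Fin.append_right]; exact hS
  · rintro M hM q N ⟨U, hU⟩
    obtain ⟨M0, hM0, T, y, hy⟩ := h1 M hM
    let i0 : Fin S0.card := e ⟨M0, hM0⟩
    have hg : g i0 = M0 := by simp [g, i0]
    refine ⟨Fin.append (fun i => if i = i0 then (U * T) * M0.1 * (U * T)ᵀ else 0)
      (fun i => (b:ℤ) • Matrix.vecMulVec (U *ᵥ y i) (U *ᵥ y i)), ?_, ?_⟩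
    · intro i
      refine Fin.addCases (fun i => ?_) (fun i => ?_) i
      · rw [Fin.append_left, Fin.append_left]
        by_cases h : i = i0
        · simp only [h, if_true]; rw [hg]; exact ⟨_, rfl⟩
        · simp only [h, if_false]; exact rep_zero _
      · rw [Fin.append_right, Fin.append_right]
        exact rep_rank_one hn _ _
    · rw [Fin.sum_univ_add]
      simp only [Fin.append_left, Fin.append_right, Finset.sum_ite_eq', Finset.mem_univ, if_true]
      rw [← hU, hy, Matrix.mul_add, Matrix.add_mul, Matrix.transpose_mul, Matrix.mul_sum, Matrix.sum_mul]
      congr 1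
      · simp only [Matrix.mul_assoc]
      · refine Finset.sum_congr rfl fun i _ => ?_
        rw [Matrix.mul_smul, Matrix.smul_mul, Matrix.mul_vecMulVec, Matrix.vecMulVec_mul, Matrix.vecMul_transpose]

theorem rep_natAbs {n : ℕ} {A B : QLat n} (h : Represents A.1 B.1) : A.1.det.natAbs ≤ B.1.det.natAbs := by
  obtain ⟨T, hT⟩ := h
  have h1 : A.1.det ∣ B.1.det := by
    rw [← hT, Matrix.det_mul, Matrix.det_mul, mul_right_comm]
    exact dvd_mul_left _ _
  exact Nat.le_of_dvd (Int.natAbs_pos.2 (pd_det B.2)) (Int.natAbs_dvd_natAbs.2 h1)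

theorem rep_back {n : ℕ} {A B : QLat n} (h : Represents A.1 B.1)
    (hd : A.1.det.natAbs = B.1.det.natAbs) : Represents B.1 A.1 := by
  obtain ⟨T, hT⟩ := h
  have hu : IsUnit T.det := by
    rw [Int.isUnit_iff_natAbs_eq]
    rw [← hT, Matrix.det_mul, Matrix.det_mul, Matrix.det_transpose, Int.natAbs_mul, Int.natAbs_mul] at hd
    have := Int.natAbs_pos.2 (pd_det A.2)
    have h2 : T.det.natAbs * T.det.natAbs = 1 := by
      apply Nat.eq_of_mul_eq_mul_right this
      rw [one_mul]; linarith [mul_right_comm T.det.natAbs A.1.det.natAbs T.det.natAbs]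
    exact Nat.eq_one_of_mul_eq_one_right h2
  refine ⟨T⁻¹, ?_⟩
  rw [← hT, Matrix.transpose_nonsing_inv]
  have hu' : IsUnit Tᵀ.det := by rwa [Matrix.det_transpose]
  have e1 := Matrix.nonsing_inv_mul T hu
  have e2 := Matrix.mul_nonsing_inv Tᵀ hu'
  calc T⁻¹ * (T * A.1 * Tᵀ) * Tᵀ⁻¹ = (T⁻¹ * T) * A.1 * (Tᵀ * Tᵀ⁻¹) := by simp only [Matrix.mul_assoc]
    _ = A.1 := by rw [e1, e2]; simp

/-- Chosen representative of a class. -/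
noncomputable def rp {n : ℕ} (c : Cls n) : QLat n := Quotient.out (s := latSetoid n) c

theorem cls_rp {n : ℕ} (c : Cls n) : cls (rp c) = c := Quotient.out_eq (s := latSetoid n) c

theorem cls_eq {n : ℕ} {A B : QLat n} : cls A = cls B ↔ Isom A.1 B.1 :=
  Quotient.eq (r := latSetoid n)

theorem rp_cls {n : ℕ} (A : QLat n) : Isom (rp (cls A)).1 A.1 := cls_eq.1 (cls_rp _)

theorem repCls_iff {r n : ℕ} (L : QLat r) (c : Cls n) : RepCls L c ↔ Represents L.1 (rp c).1 := by
  constructor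
  · rintro ⟨N, rfl, h⟩
    exact h.trans' (rp_cls N).2
  · exact fun h => ⟨rp c, cls_rp c, h⟩

/-- Absolute determinant of a class. -/
noncomputable def nd {n : ℕ} (c : Cls n) : ℕ := (rp c).1.det.natAbs

theorem nd_cls {n : ℕ} (A : QLat n) : nd (cls A) = A.1.det.natAbs :=
  le_antisymm (rep_natAbs (rp_cls A).1) (rep_natAbs (rp_cls A).2)

theorem selection {α β : Type*} [LinearOrder β] [WellFoundedLT β] (𝓕 : Set α) (hinf : 𝓕.Infinite)
    (μ : α → β) (c0 : α) (h0 : c0 ∈ 𝓕) (hmin : ∀ c ∈ 𝓕, ¬ μ c < μ c0) (m : ℕ) :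
    ∃ F : Finset α, F.card = m + 1 ∧ c0 ∈ F ∧ (∀ c ∈ F, c ∈ 𝓕) ∧
      ∀ c ∈ F, ∀ c' ∈ 𝓕, μ c' < μ c → c' ∈ F := by
  classical
  induction m with
  | zero =>
    refine ⟨{c0}, by simp, by simp, by simpa using h0, ?_⟩
    intro c hc c' hc' hlt
    rw [Finset.mem_singleton] at hc
    subst hc
    exact absurd hlt (hmin c' hc')
  | succ m ih =>
    obtain ⟨F, hc, h0F, hF, hd⟩ := ih
    have hne : (𝓕 \ F).Nonempty := (hinf.diff F.finite_toSet).nonempty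
    obtain ⟨x, hx, hxm⟩ := WellFounded.has_min (InvImage.wf μ (wellFounded_lt (α := β))) (𝓕 \ F) hne
    refine ⟨insert x F, ?_, Finset.mem_insert_of_mem h0F, ?_, ?_⟩
    · rw [Finset.card_insert_of_notMem (by exact_mod_cast hx.2), hc]
    · intro c hc
      rcases Finset.mem_insert.1 hc with rfl | h
      · exact hx.1
      · exact hF c h
    · intro c hc c' hc' hlt
      rcases Finset.mem_insert.1 hc with rfl | h
      · by_contra hn
        rw [Finset.mem_insert, not_or] at hn
        exact hxm c' ⟨hc', by exact_mod_cast hn.2⟩ hlt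
      · exact Finset.mem_insert_of_mem (hd c h c' hc' hlt)

/-- The rank one case. -/
theorem case_one (m : ℕ) (hm : 0 < m) :
    ∃ (r : ℕ) (L : QLat r), (ExcSet 1 L).Finite ∧ (ExcSet 1 L).ncard = m := by
  classical
  let S : Set (QLat 1) := {M | (m:ℤ) < M.1 0 0}
  obtain ⟨s, f, hf, hrep⟩ := build (n := 1) (b := m+1) one_pos (Nat.succ_pos m) S (by
    show (m:ℤ) < _
    simp)
  obtain ⟨r, L, hL⟩ := ortho 0 s f
  have hpd : ∀ a : ℕ, PosDefInt (((a+1 : ℕ):ℤ) • (1 : Mat 1)) := fun a => pd_smul_one 1 (a+1) (Nat.succ_pos a)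
  let g : ℕ → Cls 1 := fun a => cls ⟨_, hpd a⟩
  have hg : Function.Injective g := by
    intro a a' h
    have := congrArg nd h
    have e : ∀ a, nd (g a) = a + 1 := by
      intro a
      refine (nd_cls _).trans ?_
      rw [Matrix.det_fin_one]
      simp
      omega
    rw [e, e] at this
    omega
  have hE : ExcSet 1 L = g '' (Set.Iio m) := by
    ext c
    show ¬ RepCls L c ↔ _
    rw [repCls_iff]
    have hpos := pd_diag (rp c).2 0
    constructor
    · intro h
      by_contra hc
      apply h
      rw [hL]
      by_cases hlt : (m:ℤ) < (rp c).1 0 0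
      · obtain ⟨P, hP, hs⟩ := hrep (rp c) hlt 1 _ (Represents.rfl' _)
        exact ⟨0, P, rep_zero _, hP, by rw [zero_add]; exact hs⟩
      · exfalso
        apply hc
        refine ⟨((rp c).1 0 0).toNat - 1, ?_, ?_⟩
        · show _ < m
          omega
        · rw [← cls_rp c]
          show cls _ = _
          congr 1
          apply Subtype.ext
          ext i j
          rw [Subsingleton.elim i 0, Subsingleton.elim j 0]
          simp only [cls_rp]
          simp
          omega
    · rintro ⟨a, ha, rfl⟩ h
      have h' := h.trans' (rp_cls _).1
      rw [hL] at h'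
      obtain ⟨P0, P, ⟨T0, h0⟩, hP, hs⟩ := h'
      have ha' : a < m := ha
      have e0 : P0 = 0 := by
        rw [← h0]; ext i j; simp [Matrix.mul_apply]
      have hall : ∀ i, P i 0 0 = 0 := by
        intro i
        by_contra hne
        obtain ⟨T, hT⟩ := hP i
        have e1 : P i 0 0 = T 0 0 ^ 2 * (f i).1 0 0 := by
          rw [← hT]; simp [Matrix.mul_apply]; ring
        have h1 : (m:ℤ) < (f i).1 0 0 := hf i
        have h2 : 0 < T 0 0 ^ 2 := by
          have : T 0 0 ≠ 0 := by
            intro h; rw [h] at e1; simp at e1; exact hne e1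
          positivity
        have h3 : P i 0 0 ≤ ∑ l, P l 0 0 := Finset.single_le_sum (f := fun l => P l 0 0)
          (fun l _ => psd_diag (psd_rep (psd_of_pd (f l).2) (hP l)) 0) (Finset.mem_univ i)
        have h4 := congrFun (congrFun hs 0) 0
        rw [e0, zero_add, Matrix.sum_apply] at h4
        simp at h4
        nlinarith
      have h4 := congrFun (congrFun hs 0) 0
      rw [e0, zero_add, Matrix.sum_apply, Finset.sum_eq_zero (fun i _ => hall i)] at h4
      simp at h4
      omega
  refine ⟨r, L, ?_, ?_⟩
  · rw [hE]; exact (Set.finite_Iio m).image g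
  · rw [hE, Set.ncard_image_of_injective _ hg, ← Finset.coe_Iio, Set.ncard_coe_finset]
    simp

end ExcAux

namespace ExcAux

theorem quad_vecMulVec {n : ℕ} (y v : Fin n → ℤ) : v ⬝ᵥ Matrix.vecMulVec y y *ᵥ v = (y ⬝ᵥ v) ^ 2 := by
  have : Matrix.vecMulVec y y *ᵥ v = (y ⬝ᵥ v) • y := by
    ext i
    simp only [Matrix.mulVec, dotProduct, Matrix.vecMulVec_apply, Pi.smul_apply, smul_eq_mul, Finset.sum_mul]
    exact Finset.sum_congr rfl fun _ _ => by ring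
  rw [this, dotProduct_smul, dotProduct_comm v y, smul_eq_mul, sq]

theorem psd_vecMulVec {n : ℕ} {b : ℤ} (hb : 0 ≤ b) (y : Fin n → ℤ) : Psd (b • Matrix.vecMulVec y y) := by
  refine ⟨?_, fun v => ?_⟩
  · ext i j
    simp only [Matrix.transpose_apply, Matrix.smul_apply, Matrix.vecMulVec_apply, mul_comm]
  · rw [Matrix.smul_mulVec, dotProduct_smul, quad_vecMulVec, smul_eq_mul]
    positivity

theorem det_rank_one {k : ℕ} (hk : 1 ≤ k) (b : ℤ) (y : Fin (k+1) → ℤ) :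
    (b • Matrix.vecMulVec y y).det = 0 := by
  have : Nontrivial (Fin (k+1)) := Fin.nontrivial_iff_two_le.2 (by omega)
  rw [Matrix.det_smul, Matrix.det_vecMulVec, mul_zero]

theorem noG {k j : ℕ} (hk : 1 ≤ k) {W' Wt : Mat (k+1)} (Y : Matrix (Fin (k+1)) (Fin j) ℤ) (hp : Psd W')
    (hd : W'.det = 0) (hs : Wt = W' + (2:ℤ) • (Y * Yᵀ)) (hB : Bord Wt) : ((k:ℤ)+1) ∣ Wt.det := by
  by_contra hnd
  have e : (2:ℤ) • (Y * Yᵀ) = ∑ i : Fin j, (2:ℤ) • Matrix.vecMulVec (Yᵀ i) (Yᵀ i) := by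
    rw [← Finset.smul_sum]
    congr 1
    ext a b
    simp [Matrix.mul_apply, Matrix.sum_apply, Matrix.vecMulVec_apply]
  rw [e] at hs
  obtain ⟨i, _, h2, _⟩ := lemG hk W' _ hp hd (fun i => psd_vecMulVec (by norm_num) (Yᵀ i)) (by
    intro i t
    simp [Matrix.vecMulVec_apply]
    omega) hs hB hnd
  rw [det_rank_one hk] at h2
  exact h2 (dvd_zero _)

/-- `M` represents a bordered `A_k` matrix with corner `a` and determinant not divisible by `k+1`. -/
def HW {k : ℕ} (M : Mat (k+1)) (a : ℕ) : Prop :=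
  ∃ W : Mat (k+1), Bord W ∧ ¬ ((k:ℤ)+1) ∣ W.det ∧ W 0 0 = (a:ℤ) ∧ Represents M W

theorem HW_mono {k a : ℕ} {M1 M2 : Mat (k+1)} (h : Represents M1 M2) (h2 : HW M2 a) : HW M1 a := by
  obtain ⟨W, h3, h4, h5, h6⟩ := h2
  exact ⟨W, h3, h4, h5, h.trans' h6⟩

theorem pd_of_ndvd {k : ℕ} {W : Mat (k+1)} (h : Psd W) (hd : ¬ ((k:ℤ)+1) ∣ W.det) : PosDefInt W :=
  pd_of_psd h fun h0 => hd (by rw [h0]; exact dvd_zero _)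

theorem HW_pos {k a : ℕ} {M : Mat (k+1)} (hM : PosDefInt M) (h : HW M a) : 1 ≤ a := by
  obtain ⟨W, _, h4, h5, h6⟩ := h
  have := pd_diag (pd_of_ndvd (psd_rep (psd_of_pd hM) h6) h4) 0
  omega

/-- The infinite family of classes. -/
def FF (k : ℕ) : Set (Cls (k+1)) := {c | ∃ a, HW (rp c).1 a}

/-- Minimal corner. -/
noncomputable def HH {k : ℕ} (c : Cls (k+1)) : ℕ := sInf {a | HW (rp c).1 a}

/-- Ordering invariant. -/
noncomputable def mu {k : ℕ} (c : Cls (k+1)) : ℕ ×ₗ ℕ := toLex (HH c, nd c)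

theorem HH_spec {k : ℕ} {c : Cls (k+1)} (h : c ∈ FF k) : HW (rp c).1 (HH c) := Nat.sInf_mem h

theorem HH_le {k a : ℕ} {A : QLat (k+1)} (h : HW A.1 a) : cls A ∈ FF k ∧ HH (cls A) ≤ a := by
  have := HW_mono (rp_cls A).1 h
  exact ⟨⟨a, this⟩, Nat.sInf_le this⟩

theorem mu_lt {k : ℕ} {c d : Cls (k+1)} : mu c < mu d ↔ HH c < HH d ∨ HH c = HH d ∧ nd c < nd d :=
  Prod.Lex.toLex_lt_toLex

/-- Closedness of a finite set of classes. -/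
def Low {k : ℕ} (F : Finset (Cls (k+1))) : Prop :=
  (∀ c ∈ F, c ∈ FF k) ∧ ∀ c ∈ F, ∀ c' ∈ FF k, mu c' < mu c → c' ∈ F

theorem low1 {k a : ℕ} {F : Finset (Cls (k+1))} (hF : Low F) {A : QLat (k+1)} (hA : HW A.1 a)
    {c : Cls (k+1)} (hc : c ∈ F) (ha : a < HH c) : cls A ∈ F :=
  hF.2 c hc _ (HH_le hA).1 (mu_lt.2 (Or.inl ((HH_le hA).2.trans_lt ha)))

theorem low2 {k : ℕ} {F : Finset (Cls (k+1))} (hF : Low F) {A : QLat (k+1)}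
    {c : Cls (k+1)} (hc : c ∈ F) (h : Represents A.1 (rp c).1) : cls A ∈ F := by
  have h1 := HH_le (HW_mono h (HH_spec (hF.1 c hc)))
  have h2 : nd (cls A) ≤ nd c := by rw [nd_cls]; exact rep_natAbs h
  by_cases hlt : mu (cls A) < mu c
  · exact hF.2 c hc _ h1.1 hlt
  · rw [mu_lt] at hlt
    push Not at hlt
    have h3 : nd (cls A) = nd c := le_antisymm h2 (hlt.2 (le_antisymm h1.2 hlt.1))
    rw [nd_cls] at h3
    have : cls A = c := by
      rw [← cls_rp c, cls_eq]
      exact ⟨h, rep_back h h3⟩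
    rwa [this]

/-- Test matrices. -/
def Wa (k : ℕ) (a : ℕ) : Mat (k+1) :=
  (1:ℤ) • Matrix.vecMulVec (fun _ => 1) (fun _ => 1) + Matrix.diagonal (Fin.cons (a:ℤ) fun _ => 1)

theorem Wa_psd (k a : ℕ) : Psd (Wa k a) := by
  refine psd_add (psd_vecMulVec (by norm_num) _) ⟨Matrix.isSymm_diagonal _, fun v => ?_⟩
  simp only [dotProduct, Matrix.mulVec_diagonal]
  refine Finset.sum_nonneg fun i _ => ?_
  refine Fin.cases ?_ (fun i => ?_) i
  · simp only [Fin.cons_zero]; nlinarith [mul_self_nonneg (v 0), mul_nonneg (Int.natCast_nonneg a) (mul_self_nonneg (v 0))]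
  · simp only [Fin.cons_succ]; nlinarith [mul_self_nonneg (v i.succ)]

theorem Wa_bord (k a : ℕ) : Bord (Wa k a) := by
  refine ⟨(Wa_psd k a).1, fun i j => ?_⟩
  simp [Wa, Matrix.vecMulVec_apply, Matrix.diagonal_apply]

theorem Wa_det (k a : ℕ) : (Wa k a).det = 1 + a * (k+1) := by
  have h1 := det_ones (k+1)
  have h2 := det_corner (W := (Matrix.of fun i j : Fin (k+1) => (1 + if i = j then 1 else 0 : ℤ)))
    (W' := Wa k a) ⟨by ext i j; simp [eq_comm], by intro i j; simp⟩ (by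
      intro i j h
      by_cases hij : i = j
      · subst hij
        obtain ⟨t, rfl⟩ := Fin.exists_succ_eq.2 (show i ≠ 0 by tauto)
        simp [Wa, Matrix.vecMulVec_apply]
      · simp [Wa, Matrix.vecMulVec_apply, hij])
  rw [h2, h1]
  simp [Wa, Matrix.vecMulVec_apply]
  ring

theorem Wa_ndvd {k : ℕ} (hk : 1 ≤ k) (a : ℕ) : ¬ ((k:ℤ)+1) ∣ (Wa k a).det := by
  rw [Wa_det, Int.dvd_add_left (dvd_mul_left _ _)]
  intro h
  have := Int.le_of_dvd one_pos h
  omega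

theorem Wa_rep (k : ℕ) : Represents (1 : Mat (k+1)) (Wa k 0) := by
  refine ⟨Matrix.of fun i j => if j = 0 then 1 else if i = j then 1 else 0, ?_⟩
  ext i j
  rw [Matrix.mul_one, Matrix.mul_apply, Fin.sum_univ_succ]
  simp only [Wa]
  refine Fin.cases ?_ (fun i => ?_) i <;> refine Fin.cases ?_ (fun j => ?_) j <;>
    simp [Matrix.vecMulVec_apply, Matrix.diagonal_apply, Fin.succ_ne_zero, (Fin.succ_ne_zero _).symm]

/-- The cubic lattice. -/
def cube (n : ℕ) : QLat n := ⟨1, pd_one n⟩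

theorem HW_Wa {k : ℕ} (hk : 1 ≤ k) (a : ℕ) : HW (Wa k a) (a+1) :=
  ⟨Wa k a, Wa_bord k a, Wa_ndvd hk a, by simp [Wa, Matrix.vecMulVec_apply, add_comm], Represents.rfl' _⟩

/-- Test lattices. -/
def QWa {k : ℕ} (hk : 1 ≤ k) (a : ℕ) : QLat (k+1) := ⟨Wa k a, pd_of_ndvd (Wa_psd k a) (Wa_ndvd hk a)⟩

theorem nd_QWa {k : ℕ} (hk : 1 ≤ k) (a : ℕ) : nd (cls (QWa hk a)) = 1 + a * (k+1) := by
  rw [nd_cls]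
  have h : (QWa hk a).1.det = ((1 + a * (k+1) : ℕ) : ℤ) := by
    refine (Wa_det k a).trans ?_
    push_cast; ring
  rw [h]
  exact Int.natAbs_natCast _

theorem FF_inf {k : ℕ} (hk : 1 ≤ k) : (FF k).Infinite := by
  have hg : Function.Injective (fun a => cls (QWa hk a)) := by
    intro a b h
    have := congrArg nd h
    simp only [nd_QWa] at this
    exact Nat.eq_of_mul_eq_mul_right (Nat.succ_pos k) (Nat.add_left_cancel this)
  refine (Set.infinite_range_of_injective hg).mono ?_
  rintro _ ⟨a, rfl⟩
  exact (HH_le (A := QWa hk a) (HW_Wa hk a)).1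

theorem cube_HH {k : ℕ} (hk : 1 ≤ k) : cls (cube (k+1)) ∈ FF k ∧ HH (cls (cube (k+1))) ≤ 1 :=
  HH_le (A := cube (k+1)) (HW_mono (Wa_rep k) (HW_Wa hk 0))

theorem cube_min {k : ℕ} (hk : 1 ≤ k) (c : Cls (k+1)) (hc : c ∈ FF k) : ¬ mu c < mu (cls (cube (k+1))) := by
  intro hlt
  rw [mu_lt] at hlt
  have h5 := HW_pos (rp c).2 (HH_spec hc)
  have h6 : 0 < nd c := Int.natAbs_pos.2 (pd_det (rp c).2)
  have h7 : nd (cls (cube (k+1))) = 1 := by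
    rw [nd_cls, cube, Matrix.det_one]; rfl
  have h8 := (cube_HH hk).2
  omega

theorem select {k : ℕ} (hk : 1 ≤ k) (m : ℕ) : ∃ F : Finset (Cls (k+1)), F.card = m + 1 ∧
    cls (cube (k+1)) ∈ F ∧ Low F := by
  obtain ⟨F, h1, h2, h3, h4⟩ := selection (FF k) (FF_inf hk) mu _ (cube_HH hk).1 (cube_min hk) m
  exact ⟨F, h1, h2, h3, h4⟩

end ExcAux

namespace ExcAux

/-- Lattices without norm one vectors representing no member of `F`. -/
def CC {k : ℕ} (F : Finset (Cls (k+1))) : Set (QLat (k+1)) :=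
  {M | (∀ v, v ⬝ᵥ M.1 *ᵥ v ≠ 1) ∧ ∀ c ∈ F, ¬ Represents M.1 (rp c).1}

theorem cancel {n : ℕ} {S A B : Mat n} (hS : S.det ≠ 0) (h : S * A * Sᵀ = S * B * Sᵀ) : A = B := by
  have h1 : S * (A - B) * Sᵀ = 0 := by
    rw [Matrix.mul_sub, Matrix.sub_mul, h, sub_self]
  have h2 : adjugate S * (S * (A - B) * Sᵀ) * adjugate Sᵀ = (S.det * S.det) • (A - B) := by
    calc _ = (adjugate S * S) * (A - B) * (Sᵀ * adjugate Sᵀ) := by simp only [Matrix.mul_assoc]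
      _ = _ := by
        rw [Matrix.adjugate_mul, Matrix.mul_adjugate, Matrix.det_transpose]
        rw [Matrix.smul_mul, Matrix.one_mul, Matrix.mul_smul, Matrix.mul_one, smul_smul]
  rw [h1, Matrix.mul_zero, Matrix.zero_mul] at h2
  exact sub_eq_zero.1 ((smul_eq_zero.1 h2.symm).resolve_left (mul_ne_zero hS hS))

theorem det_lowrank {k : ℕ} {P : Mat (k+1)} (h : Represents (1 : Mat k) P) : P.det = 0 := by
  obtain ⟨T, rfl⟩ := h
  have e : T * (1 : Mat k) * Tᵀ = (Matrix.of fun a => (Fin.cons 0 (T a) : Fin (k+1) → ℤ)) *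
      (Matrix.of fun a => (Fin.cons 0 (T a) : Fin (k+1) → ℤ))ᵀ := by
    ext a b
    rw [Matrix.mul_one, Matrix.mul_apply, Matrix.mul_apply, Fin.sum_univ_succ]
    simp
  rw [e, Matrix.det_mul, Matrix.det_eq_zero_of_column_eq_zero 0 (by intro a; simp), zero_mul]

theorem nonrep {k s : ℕ} (hk : 1 ≤ k) {F : Finset (Cls (k+1))} (hF : Low F) (f : Fin s → QLat (k+1))
    (hf : ∀ i, f i ∈ CC F) {c : Cls (k+1)} (hc : c ∈ F) {P0 : Mat (k+1)} {P : Fin s → Mat (k+1)}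
    (h0 : Represents (1 : Mat k) P0) (hP : ∀ i, Represents (f i).1 (P i))
    (hs : (rp c).1 = P0 + ∑ i, P i) : False := by
  obtain ⟨Wt, hB, hnd, ha, S, hS⟩ := HH_spec (hF.1 c hc)
  have hpsd : ∀ i, Psd (P i) := fun i => psd_rep (psd_of_pd (f i).2) (hP i)
  obtain ⟨i, hBi, hdi, hle, heq⟩ := lemG hk (S * P0 * Sᵀ) (fun i => S * P i * Sᵀ)
    (psd_conj (psd_rep (psd_one k) h0) S) (by simp [Matrix.det_mul, det_lowrank h0])
    (fun i => psd_conj (hpsd i) S) (by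
      intro i t
      show (S * P i * Sᵀ) t t ≠ 1
      rw [conj_apply]
      obtain ⟨T, hT⟩ := hP i
      rw [← hT, quad_conj]
      exact (hf i).1 _) (Wt := Wt)
    (by rw [← hS, hs, Matrix.mul_add, Matrix.add_mul, Matrix.mul_sum, Matrix.sum_mul]) hB hnd
  rcases eq_or_lt_of_le hle with h | h
  · have hdS : S.det ≠ 0 := by
      intro h0
      apply hnd
      rw [← hS, Matrix.det_mul, Matrix.det_mul, h0]; simp
    have := cancel hdS ((heq h).trans hS.symm)
    exact (hf i).2 c hc (this ▸ hP i)
  · have hpd : PosDefInt (S * P i * Sᵀ) := pd_of_ndvd (psd_conj (hpsd i) S) hdi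
    have hpos := pd_diag hpd 0
    let Q : QLat (k+1) := ⟨_, hpd⟩
    have hQ : HW Q.1 ((S * P i * Sᵀ) 0 0).toNat := by
      refine ⟨_, hBi, hdi, ?_, Represents.rfl' _⟩
      exact (Int.toNat_of_nonneg hpos.le).symm
    have hmem := low1 hF hQ hc (by
      have h' : (S * P i * Sᵀ) 0 0 < Wt 0 0 := h
      omega)
    refine (hf i).2 _ hmem ?_
    exact ((hP i).trans' ⟨S, rfl⟩ : Represents (f i).1 Q.1).trans' (rp_cls Q).2

theorem two_mem {k : ℕ} (hk : 1 ≤ k) {F : Finset (Cls (k+1))} (hF : Low F) :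
    (⟨((2:ℕ):ℤ) • (1 : Mat (k+1)), pd_smul_one (k+1) 2 two_pos⟩ : QLat (k+1)) ∈ CC F := by
  refine ⟨fun v => ?_, fun c hc hr => ?_⟩
  · simp only [Matrix.smul_mulVec, dotProduct_smul, smul_eq_mul]
    push_cast
    omega
  · obtain ⟨Wt, hB, hnd, ha, hS⟩ := HH_spec (hF.1 c hc)
    obtain ⟨S, hS⟩ := hr.trans' hS
    refine hnd (noG hk S (W' := 0) ⟨by simp [Matrix.IsSymm], by simp⟩ (by simp) ?_ hB)
    rw [← hS, zero_add, Matrix.mul_smul, Matrix.smul_mul, Matrix.mul_one]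
    rfl

theorem decompose {k : ℕ} (hk : 1 ≤ k) {F : Finset (Cls (k+1))} (hF : Low F)
    (hF0 : cls (cube (k+1)) ∈ F) (M : QLat (k+1)) (hM : cls M ∉ F) :
    ∃ (Q : QLat (k+1)) (P0 P : Mat (k+1)), Q ∈ CC F ∧ Represents (1 : Mat k) P0 ∧ Represents Q.1 P ∧
      M.1 = P0 + P := by
  classical
  have hsy : M.1ᵀ = M.1 := M.2.1
  let p : ℕ → Prop := fun j => Represents M.1 (1 : Mat j)
  let j := Nat.findGreatest p (k+1)
  have hp0 : p 0 := by
    show Represents M.1 (1 : Mat 0)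
    rw [Subsingleton.elim (1 : Mat 0) 0]; exact rep_zero _
  have hj : p j := Nat.findGreatest_spec (Nat.zero_le _) hp0
  have hjk : j ≤ k := by
    by_contra hlt
    have hle : j ≤ k + 1 := Nat.findGreatest_le _
    have : j = k + 1 := by omega
    rw [this] at hj
    exact hM (low2 hF hF0 (Represents.trans' (hj : Represents M.1 (cube (k+1)).1) (rp_cls (cube (k+1))).2))
  have hj1 : ¬ p (j+1) := Nat.findGreatest_is_greatest (Nat.lt_succ_self _) (by omega)
  clear_value j
  obtain ⟨E, hE⟩ := hj
  have hw : ∀ w, w ⬝ᵥ M.1 *ᵥ w = 1 → E *ᵥ (M.1 *ᵥ w) = 0 → False := by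
    intro w h1 h2
    apply hj1
    have h3 : ∀ i, E i ⬝ᵥ M.1 *ᵥ w = 0 := fun i => congrFun h2 i
    refine ⟨Matrix.of (Fin.cons w E), ?_⟩
    ext a b
    rw [conj_apply]
    refine Fin.cases ?_ (fun a => ?_) a <;> refine Fin.cases ?_ (fun b => ?_) b
    · exact h1
    · rw [Matrix.one_apply_ne (Fin.succ_ne_zero b).symm, bil_symm M.2.1]
      exact h3 b
    · rw [Matrix.one_apply_ne (Fin.succ_ne_zero a)]
      exact h3 a
    · have := conj_apply E M.1 a b
      rw [hE] at this
      refine this.symm.trans ?_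
      simp [Matrix.one_apply]
  let C := M.1 * Eᵀ
  have hCt : Cᵀ = E * M.1 := by simp [C, Matrix.transpose_mul, hsy]
  let P := M.1 - C * Cᵀ
  have hPE : P * Eᵀ = 0 := by
    show (M.1 - C * Cᵀ) * Eᵀ = 0
    rw [Matrix.sub_mul, hCt, Matrix.mul_assoc C, hE, Matrix.mul_one, sub_self]
  let T : Mat (k+1) := 1 - M.1 * Eᵀ * E
  have hTM : T * M.1 = P := by
    show (1 - M.1 * Eᵀ * E) * M.1 = M.1 - C * Cᵀ
    rw [Matrix.sub_mul, hCt, Matrix.one_mul, Matrix.mul_assoc (M.1 * Eᵀ)]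
  have hTt : Tᵀ = 1 - Eᵀ * (E * M.1) := by
    simp [T, Matrix.transpose_sub, Matrix.transpose_mul, hsy]
  have hTMT : T * M.1 * Tᵀ = P := by
    rw [hTM, hTt, Matrix.mul_sub, ← Matrix.mul_assoc P, hPE]; simp
  have hTC : T * C = 0 := by
    show T * (M.1 * Eᵀ) = 0
    rw [← Matrix.mul_assoc, hTM, hPE]
  have hPp : Psd P := psd_rep (psd_of_pd M.2) ⟨T, hTMT⟩
  have hCp : Psd (C * Cᵀ) := psd_rep (psd_one j) ⟨C, by simp⟩
  have hQ : PosDefInt (M.1 + C * Cᵀ) := by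
    refine ⟨M.2.1.add hCp.1, fun v hv => ?_⟩
    rw [Matrix.add_mulVec, dotProduct_add]
    exact add_pos_of_pos_of_nonneg (M.2.2 v hv) (hCp.2 v)
  have hMP : M.1 = C * Cᵀ + P := by simp [P]
  refine ⟨⟨_, hQ⟩, C * Cᵀ, P, ⟨?_, ?_⟩, ?_, ⟨T, ?_⟩, hMP⟩
  · intro v hv
    simp only [Matrix.add_mulVec, dotProduct_add] at hv
    have h1 : v ⬝ᵥ M.1 *ᵥ v = v ⬝ᵥ (C * Cᵀ) *ᵥ v + v ⬝ᵥ P *ᵥ v := by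
      rw [← dotProduct_add, ← Matrix.add_mulVec, ← hMP]
    have h2 := hCp.2 v
    have h3 := hPp.2 v
    have h4 : v ⬝ᵥ (C * Cᵀ) *ᵥ v = 0 := by omega
    have h5 : Cᵀ *ᵥ v = 0 := by
      have : v ⬝ᵥ (C * Cᵀ) *ᵥ v = (Cᵀ *ᵥ v) ⬝ᵥ (Cᵀ *ᵥ v) := by
        rw [← Matrix.mulVec_mulVec, Matrix.dotProduct_mulVec, ← Matrix.mulVec_transpose]
      rw [this] at h4
      exact dotProduct_self_eq_zero.1 h4
    refine hw v (by omega) ?_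
    rw [Matrix.mulVec_mulVec, ← hCt]; exact h5
  · intro c hc hr
    rcases Nat.eq_zero_or_pos j with h0 | h0
    · subst h0
      have hC0 : C * Cᵀ = 0 := by ext a b; simp [Matrix.mul_apply]
      simp only [hC0, add_zero] at hr
      exact hM (low2 hF hc hr)
    · obtain ⟨Wt, hB, hnd, ha, hS⟩ := HH_spec (hF.1 c hc)
      obtain ⟨S, hS⟩ := hr.trans' hS
      have hdP : P.det = 0 := by
        rw [← Matrix.exists_mulVec_eq_zero_iff]
        refine ⟨E ⟨0, h0⟩, ?_, ?_⟩
        · intro hz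
          have := congrFun (congrFun hE ⟨0, h0⟩) ⟨0, h0⟩
          rw [conj_apply, hz] at this
          simp at this
        · ext a
          exact congrFun (congrFun hPE a) ⟨0, h0⟩
      refine hnd (noG hk (S * C) (W' := S * P * Sᵀ) (psd_conj hPp S) (by simp [Matrix.det_mul, hdP]) ?_ hB)
      rw [← hS]
      have : M.1 + C * Cᵀ = P + (2:ℤ) • (C * Cᵀ) := by
        rw [hMP, two_smul]; abel
      simp only
      rw [this, Matrix.mul_add, Matrix.add_mul, Matrix.transpose_mul S C, Matrix.mul_smul, Matrix.smul_mul]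
      simp only [Matrix.mul_assoc]
  · refine ⟨Matrix.of fun a (b : Fin k) => if h : b.1 < j then C a ⟨b.1, h⟩ else 0, ?_⟩
    obtain ⟨d, rfl⟩ := Nat.exists_eq_add_of_le hjk
    ext a b
    rw [Matrix.mul_one, Matrix.mul_apply, Matrix.mul_apply, Fin.sum_univ_add]
    simp
  · simp only
    rw [Matrix.mul_add, Matrix.add_mul, hTMT, ← Matrix.mul_assoc T, hTC]; simp

theorem case_big {k : ℕ} (hk : 1 ≤ k) (m : ℕ) : ∃ (r : ℕ) (L : QLat r),
    (ExcSet (k+1) L).Finite ∧ (ExcSet (k+1) L).ncard = m + 1 := by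
  classical
  obtain ⟨F, hcard, hF0, hF⟩ := select hk m
  obtain ⟨s, f, hf, hrep⟩ := build (Nat.succ_pos k) two_pos (CC F) (two_mem hk hF)
  obtain ⟨r, L, hL⟩ := ortho k s f
  have hE : ExcSet (k+1) L = (F : Set (Cls (k+1))) := by
    ext c
    show ¬ RepCls L c ↔ c ∈ F
    rw [repCls_iff, hL]
    constructor
    · intro h
      by_contra hc
      apply h
      obtain ⟨Q, P0, P, hQ, h0, hQP, hs⟩ := decompose hk hF hF0 (rp c) (by rwa [cls_rp])
      obtain ⟨PP, hPP, hs2⟩ := hrep Q hQ _ P hQP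
      exact ⟨P0, PP, h0, hPP, by rw [hs, hs2]⟩
    · rintro hc ⟨P0, P, h0, hP, hs⟩
      exact nonrep hk hF f hf hc h0 hP hs
  refine ⟨r, L, ?_, ?_⟩
  · rw [hE]; exact F.finite_toSet
  · rw [hE, Set.ncard_coe_finset, hcard]

end ExcAux

/-- For any positive integers `m` and `n`, there exists a positive
definite integral lattice `L` whose `n`-exceptional set has exactly `m` elements. -/
theorem exists_exceptional_set_of_size (m n : ℕ) (hm : 0 < m) (hn : 0 < n) :
    ∃ (r : ℕ) (L : QLat r), (ExcSet n L).Finite ∧ (ExcSet n L).ncard = m := by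
  obtain ⟨k, rfl⟩ := Nat.exists_eq_succ_of_ne_zero hn.ne'
  obtain ⟨l, rfl⟩ := Nat.exists_eq_succ_of_ne_zero hm.ne'
  rcases Nat.eq_zero_or_pos k with rfl | hk
  · exact ExcAux.case_one _ hm
  · exact ExcAux.case_big hk l
end
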